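/- A finite-dimensional basic algebra B over a field is isomorphic to a k-shifted algebra (of some finite-dimensional algebra with dominant dimension at least k) if and only if there exist an injective B-module I and an I-special k-cotilting B-module C with ν⁻I ∈ add C; under this isomorphism, C corresponds to the dual of the k-shifted module. Dually, a finite-dimensional basic algebra B is isomorphic to a k-coshifted algebra if and only if there exist a projective B-module P and a P-special k-tilting B-module T with νP ∈ add T; under this isomorphism, T corresponds to the dual of the k-coshifted module. -/

import Mathlib

/-!
Formalization of definitions from "Special tilting modules for algebras with positive
dominant dimension" (Pressland–Sauter), together with one of its statements.
-/

open CategoryTheory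

noncomputable section
namespace PS

variable {R : Type} [Ring R]

/-- `N` is (isomorphic to) a direct summand of `M`. -/
def IsSummand (N M : ModuleCat.{0} R) : Prop :=
  ∃ (ι : N →ₗ[R] M) (π : M →ₗ[R] N), π ∘ₗ ι = LinearMap.id

/-- `M` lies in `add X`: it is a direct summand of a finite direct sum of copies of `X`. -/
def MemAdd (X M : ModuleCat.{0} R) : Prop :=
  ∃ n : ℕ, IsSummand M (ModuleCat.of R (Fin n → X))

/-- `M` is projective-injective. -/
def ProjInj (M : ModuleCat.{0} R) : Prop :=
  Module.Projective R M ∧ Module.Injective R M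

/-- The regular left module. -/
def reg (R : Type) [Ring R] : ModuleCat.{0} R := ModuleCat.of R R

/-- A module is basic if no nonzero module `X` has `X ⊕ X` as a direct summand of it
(equivalently, for finite length modules, its indecomposable direct summands are pairwise
non-isomorphic). -/
def IsBasic (M : ModuleCat.{0} R) : Prop :=
  ∀ X : ModuleCat.{0} R, IsSummand (ModuleCat.of R (X × X)) M → Subsingleton X

/-- `P` is a maximal projective-injective direct summand of the regular module. -/
def IsMaxProjInjSummand (P : ModuleCat.{0} R) : Prop :=
  IsSummand P (reg R) ∧ ProjInj P ∧
    ∀ Q : ModuleCat.{0} R, IsSummand Q (reg R) → ProjInj Q → MemAdd P Q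

/-- The data `Y 0 → Y 1 → ⋯ → Y n` forms an exact sequence
`0 → Y 0 → Y 1 → ⋯ → Y n → 0` (with `n ≥ 1` maps; terms beyond `Y n` are ignored). -/
def IsExactSeq (n : ℕ) (Y : ℕ → ModuleCat.{0} R) (f : ∀ i, Y i →ₗ[R] Y (i+1)) : Prop :=
  Function.Injective (f 0) ∧ Function.Surjective (f (n-1)) ∧
    ∀ i, i + 2 ≤ n → Function.Exact (f i) (f (i+1))

/-- The algebra `R` has dominant dimension at least `k`: the regular module has an
injective resolution whose first `k` terms are projective-injective. -/
def DomdimGE (R : Type) [Ring R] (k : ℕ) : Prop :=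
  ∃ (Y : ℕ → ModuleCat.{0} R) (g : reg R →ₗ[R] Y 0) (f : ∀ i, Y i →ₗ[R] Y (i+1)),
    Function.Injective g ∧ Function.Exact g (f 0) ∧
    (∀ i, Function.Exact (f i) (f (i+1))) ∧
    (∀ i, Module.Injective R (Y i)) ∧ (∀ i, i < k → Module.Projective R (Y i))

/-- `domdim R = d`. -/
def DomdimEq (R : Type) [Ring R] (d : ℕ) : Prop :=
  DomdimGE R d ∧ ¬ DomdimGE R (d+1)

/-- The Ext group `Ext^j(M, N)` in the category of `R`-modules. -/
def ext (M N : ModuleCat.{0} R) (j : ℕ) : Type :=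
  ((Ext ℤ (ModuleCat.{0} R) j).obj (Opposite.op M)).obj N

/-- `Ext^j(M, N) = 0` (for a single `j`). -/
def ExtZero (M N : ModuleCat.{0} R) (j : ℕ) : Prop := Subsingleton (ext M N j)

/-- `Ext^j(M, N) = 0` for all `j ≥ 1`. -/
def ExtVanishing (M N : ModuleCat.{0} R) : Prop :=
  ∀ j : ℕ, 1 ≤ j → ExtZero M N j

/-- Projective dimension at most `k`. -/
def PdimLE (k : ℕ) (M : ModuleCat.{0} R) : Prop :=
  ∃ (Y : ℕ → ModuleCat.{0} R) (f : ∀ i, Y i →ₗ[R] Y (i+1)),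
    IsExactSeq (k+1) Y f ∧ (∀ i, i ≤ k → Module.Projective R (Y i)) ∧ Y (k+1) = M

/-- Injective dimension at most `k`. -/
def IdimLE (k : ℕ) (M : ModuleCat.{0} R) : Prop :=
  ∃ (Y : ℕ → ModuleCat.{0} R) (f : ∀ i, Y i →ₗ[R] Y (i+1)),
    IsExactSeq (k+1) Y f ∧ (∀ i, 1 ≤ i → i ≤ k+1 → Module.Injective R (Y i)) ∧ Y 0 = M

/-- `T` is a `k`-tilting module. -/
def IsTilting (k : ℕ) (T : ModuleCat.{0} R) : Prop :=
  Module.Finite R T ∧ PdimLE k T ∧ ExtVanishing T T ∧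
    ∃ (Y : ℕ → ModuleCat.{0} R) (f : ∀ i, Y i →ₗ[R] Y (i+1)),
      IsExactSeq (k+1) Y f ∧ Y 0 = reg R ∧ ∀ i, 1 ≤ i → i ≤ k+1 → MemAdd T (Y i)

/-- `T` is a `P`-special `k`-tilting module: it is `k`-tilting, and there is a coresolution
`0 → R → t_0 → ⋯ → t_k → 0` with all `t_j ∈ add T` and `t_j ∈ add P` for `j ≤ k-1`. -/
def IsSpecialTilting (P : ModuleCat.{0} R) (k : ℕ) (T : ModuleCat.{0} R) : Prop :=
  IsTilting k T ∧
    ∃ (Y : ℕ → ModuleCat.{0} R) (f : ∀ i, Y i →ₗ[R] Y (i+1)),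
      IsExactSeq (k+1) Y f ∧ Y 0 = reg R ∧ (∀ i, 1 ≤ i → i ≤ k+1 → MemAdd T (Y i)) ∧
        (∀ i, 1 ≤ i → i ≤ k → MemAdd P (Y i))

/-- `M ∈ gen_k(X)`: there is an exact sequence `X^k → ⋯ → X^0 → M → 0` with `X^i ∈ add X`. -/
def MemGen (k : ℕ) (X M : ModuleCat.{0} R) : Prop :=
  ∃ (Y : ℕ → ModuleCat.{0} R) (f : ∀ i, Y i →ₗ[R] Y (i+1)),
    (∀ i, i ≤ k → MemAdd X (Y i)) ∧ Y (k+1) = M ∧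
    Function.Surjective (f k) ∧ ∀ i, i < k → Function.Exact (f i) (f (i+1))

/-- `M ∈ cogen^k(X)`: there is an exact sequence `0 → M → X_0 → ⋯ → X_k` with `X_i ∈ add X`. -/
def MemCogen (k : ℕ) (X M : ModuleCat.{0} R) : Prop :=
  ∃ (Y : ℕ → ModuleCat.{0} R) (f : ∀ i, Y i →ₗ[R] Y (i+1)),
    (∀ i, 1 ≤ i → i ≤ k+1 → MemAdd X (Y i)) ∧ Y 0 = M ∧
    Function.Injective (f 0) ∧ ∀ i, i < k → Function.Exact (f i) (f (i+1))

/-- `M ∈ gen_{k-1}(X)`, where `gen_{-1}(X)` is the whole module category. -/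
def MemGenShift : ℕ → ModuleCat.{0} R → ModuleCat.{0} R → Prop
  | 0, _X, _M => True
  | (k+1), X, M => MemGen k X M

/-- `M ∈ cogen^{k-1}(X)`, where `cogen^{-1}(X)` is the whole module category. -/
def MemCogenShift : ℕ → ModuleCat.{0} R → ModuleCat.{0} R → Prop
  | 0, _X, _M => True
  | (k+1), X, M => MemCogen k X M

/-- Global dimension at most `n` (on finitely generated modules). -/
def GldimLE (R : Type) [Ring R] (n : ℕ) : Prop :=
  ∀ M : ModuleCat.{0} R, Module.Finite R M → PdimLE n M

/-- Global dimension exactly `n`. -/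
def GldimEq (R : Type) [Ring R] (n : ℕ) : Prop :=
  GldimLE R n ∧ ∀ m : ℕ, GldimLE R m → n ≤ m

section Duality

variable (K : Type) [Field K]

section DualDefs
variable (S M : Type) [Semiring S] [AddCommGroup M] [Module K M]

/-- The action of `s : S` as a `K`-linear endomorphism. -/
def actMap [Module S M] [SMulCommClass S K M] (s : S) : M →ₗ[K] M where
  toFun m := s • m
  map_add' := smul_add s
  map_smul' c m := (smul_comm s c m)

/-- The `K`-linear dual of a left `S`-module is a left `Sᵐᵒᵖ`-module (i.e. a right
`S`-module), by precomposition. -/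
def dualModuleOp [Module S M] [SMulCommClass S K M] : Module Sᵐᵒᵖ (M →ₗ[K] K) where
  smul s φ := φ ∘ₗ actMap K S M s.unop
  one_smul φ := by ext m; exact congrArg φ (one_smul S m)
  mul_smul s t φ := by ext m; exact congrArg φ (mul_smul t.unop s.unop m)
  smul_zero s := by ext m; rfl
  smul_add s φ ψ := by ext m; rfl
  add_smul s t φ := by
    ext m
    show φ ((s.unop + t.unop) • m) = φ (s.unop • m) + φ (t.unop • m)
    rw [add_smul, map_add]
  zero_smul φ := by
    ext m
    show φ ((0 : S) • m) = 0
    rw [zero_smul, map_zero]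

/-- The `K`-linear dual of a right `S`-module is a left `S`-module, by precomposition. -/
def dualModuleUnop [Module Sᵐᵒᵖ M] [SMulCommClass Sᵐᵒᵖ K M] : Module S (M →ₗ[K] K) where
  smul s φ := φ ∘ₗ actMap K Sᵐᵒᵖ M (MulOpposite.op s)
  one_smul φ := by ext m; exact congrArg φ (one_smul Sᵐᵒᵖ m)
  mul_smul s t φ := by
    ext m
    show φ (MulOpposite.op (s * t) • m) = φ (MulOpposite.op t • MulOpposite.op s • m)
    rw [← mul_smul]
    rfl
  smul_zero s := by ext m; rfl
  smul_add s φ ψ := by ext m; rfl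
  add_smul s t φ := by
    ext m
    show φ ((MulOpposite.op s + MulOpposite.op t) • m)
      = φ (MulOpposite.op s • m) + φ (MulOpposite.op t • m)
    rw [add_smul, map_add]
  zero_smul φ := by
    ext m
    show φ ((0 : Sᵐᵒᵖ) • m) = 0
    rw [zero_smul, map_zero]

end DualDefs

/-- `D R`: the `K`-linear dual of the right regular module, as a left `R`-module. -/
def Dreg (R : Type) [Ring R] [Algebra K R] : ModuleCat.{0} R :=
  letI : Module R (R →ₗ[K] K) := dualModuleUnop K R R
  ModuleCat.of R (R →ₗ[K] K)

variable {R : Type} [Ring R] [Algebra K R]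

/-- The `K`-module structure on an `R`-module, via restriction of scalars. -/
def kMod (M : ModuleCat.{0} R) : Module K M := Module.compHom M (algebraMap K R)

theorem kMod_smulCommClass (M : ModuleCat.{0} R) :
    letI := kMod K M; SMulCommClass R K M := by
  letI := kMod K M
  constructor
  intro r c m
  show r • (algebraMap K R c • m) = algebraMap K R c • (r • m)
  rw [← mul_smul, ← mul_smul, Algebra.commutes]

theorem kMod_end_smulCommClass (M : ModuleCat.{0} R) :
    letI := kMod K M; SMulCommClass (Module.End R M) K M := by
  letI := kMod K M
  constructor
  intro f c m
  show f (algebraMap K R c • m) = algebraMap K R c • f m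
  rw [map_smul]

/-- The dual `D T` of a left `R`-module `T`, as a left module over `B = End_R(T)ᵒᵖ`. -/
def DT (T : ModuleCat.{0} R) : ModuleCat.{0} ((Module.End R T)ᵐᵒᵖ) :=
  letI := kMod K T
  letI := kMod_end_smulCommClass K T
  letI : Module (Module.End R T)ᵐᵒᵖ (T →ₗ[K] K) := dualModuleOp K (Module.End R T) T
  ModuleCat.of _ (T →ₗ[K] K)

/-- `C` is a `k`-cotilting module. -/
def IsCotilting (k : ℕ) (C : ModuleCat.{0} R) : Prop :=
  Module.Finite R C ∧ IdimLE k C ∧ ExtVanishing C C ∧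
    ∃ (Y : ℕ → ModuleCat.{0} R) (f : ∀ i, Y i →ₗ[R] Y (i+1)),
      IsExactSeq (k+1) Y f ∧ Y (k+1) = Dreg K R ∧ ∀ i, i ≤ k → MemAdd C (Y i)

/-- `C` is an `I`-special `k`-cotilting module: it is `k`-cotilting, and there is a resolution
`0 → c^k → ⋯ → c^0 → D R → 0` with all `c^j ∈ add C` and `c^j ∈ add I` for `j ≤ k-1`. -/
def IsSpecialCotilting (I : ModuleCat.{0} R) (k : ℕ) (C : ModuleCat.{0} R) : Prop :=
  IsCotilting K k C ∧
    ∃ (Y : ℕ → ModuleCat.{0} R) (f : ∀ i, Y i →ₗ[R] Y (i+1)),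
      IsExactSeq (k+1) Y f ∧ Y (k+1) = Dreg K R ∧ (∀ i, i ≤ k → MemAdd C (Y i)) ∧
        (∀ i, 1 ≤ i → i ≤ k → MemAdd I (Y i))

/-- `R` is a `d`-Auslander–Gorenstein algebra: `id R ≤ d+1 ≤ domdim R`. -/
def IsAuslanderGorenstein (R : Type) [Ring R] (d : ℕ) : Prop :=
  IdimLE (d+1) (reg R) ∧ DomdimGE R (d+1)

/-- `R` is a `d`-Auslander algebra: `gldim R ≤ d+1 ≤ domdim R`. -/
def IsAuslander (R : Type) [Ring R] (d : ℕ) : Prop :=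
  GldimLE R (d+1) ∧ DomdimGE R (d+1)

end Duality

section EndAlgebra

variable (K : Type) [Field K] {Γ : Type} [Ring Γ] [Algebra K Γ]

/-- For `Γ`-modules `T`, `X`, the Hom-space `Hom_Γ(T, X)` is a left module over
`B = End_Γ(T)ᵒᵖ` by precomposition. -/
def homEndModule (T X : ModuleCat.{0} Γ) : Module (Module.End Γ T)ᵐᵒᵖ (T →ₗ[Γ] X) where
  smul f φ := φ ∘ₗ f.unop
  one_smul φ := by ext t; rfl
  mul_smul f g φ := by ext t; rfl
  smul_zero f := by ext t; rfl
  smul_add f φ ψ := by ext t; rfl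
  add_smul f g φ := by ext t; exact map_add φ _ _
  zero_smul φ := by ext t; exact map_zero φ

/-- `Hom_Γ(T, X)` as a module over `B = End_Γ(T)ᵒᵖ`. -/
def homTX (T X : ModuleCat.{0} Γ) : ModuleCat.{0} ((Module.End Γ T)ᵐᵒᵖ) :=
  letI := homEndModule T X
  ModuleCat.of _ (T →ₗ[Γ] X)

/-- `D Hom_Γ(P, T)`, the dual of `Hom_Γ(P, T)`, as a left module over `B = End_Γ(T)ᵒᵖ`. -/
def Ihom (P T : ModuleCat.{0} Γ) : ModuleCat.{0} ((Module.End Γ T)ᵐᵒᵖ) :=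
  letI := kMod K T
  letI := kMod_smulCommClass K T
  letI := kMod_end_smulCommClass K T
  letI : SMulCommClass (Module.End Γ T) K (P →ₗ[Γ] T) :=
    ⟨fun f c φ => LinearMap.ext fun p => smul_comm f c (φ p)⟩
  letI : Module (Module.End Γ T)ᵐᵒᵖ ((P →ₗ[Γ] T) →ₗ[K] K) :=
    dualModuleOp K (Module.End Γ T) (P →ₗ[Γ] T)
  ModuleCat.of _ ((P →ₗ[Γ] T) →ₗ[K] K)

/-- The scalar action of `K` on `End_Γ(T)`, as a `Γ`-linear endomorphism of `T`. -/
def centralEnd (T : ModuleCat.{0} Γ) (c : K) : Module.End Γ T where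
  toFun t := algebraMap K Γ c • t
  map_add' := smul_add _
  map_smul' γ t := by
    simp only [RingHom.id_apply]
    rw [← mul_smul, ← mul_smul, Algebra.commutes]

/-- `End_Γ(T)` is a `K`-algebra. -/
instance endAlgebra (T : ModuleCat.{0} Γ) : Algebra K (Module.End Γ T) :=
  RingHom.toAlgebra'
    { toFun := centralEnd K T
      map_one' := by
        ext t
        show algebraMap K Γ 1 • t = t
        rw [map_one, one_smul]
      map_mul' := fun c d => by
        ext t
        show (algebraMap K Γ (c * d)) • t = algebraMap K Γ c • algebraMap K Γ d • t
        rw [map_mul, mul_smul]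
      map_zero' := by
        ext t
        show algebraMap K Γ 0 • t = 0
        rw [map_zero, zero_smul]
      map_add' := fun c d => by
        ext t
        show (algebraMap K Γ (c + d)) • t = algebraMap K Γ c • t + algebraMap K Γ d • t
        rw [map_add, add_smul] }
    (by
      intro c f
      ext t
      show algebraMap K Γ c • f t = f (algebraMap K Γ c • t)
      rw [map_smul])

/-- The right action of `s : S` on a `(B, S)`-bimodule, as a `B`-linear endomorphism. -/
def bact (B S M : Type) [Ring B] [Semiring S] [AddCommGroup M] [Module B M] [Module Sᵐᵒᵖ M]
    [SMulCommClass Sᵐᵒᵖ B M] (s : S) : M →ₗ[B] M where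
  toFun m := MulOpposite.op s • m
  map_add' := smul_add _
  map_smul' b m := smul_comm (MulOpposite.op s) b m

/-- For a `(B, S)`-bimodule `M` and a left `B`-module `I`, the Hom-space `Hom_B(M, I)` is a
left `S`-module by precomposition with the right `S`-action. -/
def homBimodule (B S M I : Type) [Ring B] [Semiring S] [AddCommGroup M] [Module B M]
    [AddCommGroup I] [Module B I] [Module Sᵐᵒᵖ M] [SMulCommClass Sᵐᵒᵖ B M] :
    Module S (M →ₗ[B] I) where
  smul s f := f ∘ₗ bact B S M s
  one_smul f := by ext m; exact congrArg f (one_smul Sᵐᵒᵖ m)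
  mul_smul s t f := by
    ext m
    exact congrArg f (mul_smul (MulOpposite.op t) (MulOpposite.op s) m)
  smul_zero s := by ext m; rfl
  smul_add s f g := by ext m; rfl
  add_smul s t f := by
    ext m
    show f ((MulOpposite.op s + MulOpposite.op t) • m)
      = f (MulOpposite.op s • m) + f (MulOpposite.op t • m)
    rw [add_smul, map_add]
  zero_smul f := by
    ext m
    show f ((0 : Sᵐᵒᵖ) • m) = 0
    rw [zero_smul, map_zero]

/-- The Nakayama functor `ν = D Hom_B(-, B)` applied to a `B'`-module `P`. -/
def Nakayama (B' : Type) [Ring B'] [Algebra K B'] (P : ModuleCat.{0} B') : ModuleCat.{0} B' :=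
  letI : SMulCommClass B'ᵐᵒᵖ K (P →ₗ[B'] B') :=
    ⟨fun s c φ => LinearMap.ext fun p => smul_comm s c (φ p)⟩
  letI : Module B' ((P →ₗ[B'] B') →ₗ[K] K) := dualModuleUnop K B' (P →ₗ[B'] B')
  ModuleCat.of B' ((P →ₗ[B'] B') →ₗ[K] K)

/-- The inverse Nakayama functor `ν⁻ = Hom_B(D B, -)` applied to a `B'`-module `I`. -/
def NakayamaInv (B' : Type) [Ring B'] [Algebra K B'] (I : ModuleCat.{0} B') :
    ModuleCat.{0} B' :=
  letI : Module B' (B' →ₗ[K] K) := dualModuleUnop K B' B'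
  letI : Module B'ᵐᵒᵖ (B' →ₗ[K] K) := dualModuleOp K B' B'
  letI : SMulCommClass B'ᵐᵒᵖ B' (B' →ₗ[K] K) :=
    ⟨fun b γ φ => LinearMap.ext fun x => congrArg φ (mul_assoc b.unop x γ)⟩
  letI : Module B' ((B' →ₗ[K] K) →ₗ[B'] I) := homBimodule B' B' (B' →ₗ[K] K) I
  ModuleCat.of B' ((B' →ₗ[K] K) →ₗ[B'] I)

end EndAlgebra

end PS
end

namespace PS

section ExtFacts
variable {R : Type} [Ring R]

/-- Short exact sequence given by explicit linear maps. -/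
structure IsSES {A X Z : ModuleCat.{0} R} (i : A →ₗ[R] X) (p : X →ₗ[R] Z) : Prop where
  inj : Function.Injective i
  exact : Function.Exact i p
  surj : Function.Surjective p

theorem IsSES.shortExact {A X Z : ModuleCat.{0} R} {i : A →ₗ[R] X} {p : X →ₗ[R] Z}
    (h : IsSES i p) :
    (ShortComplex.mk (ModuleCat.ofHom i) (ModuleCat.ofHom p)
      (by ext x; exact h.exact.apply_apply_eq_zero x)).ShortExact := by
  have : Mono (ModuleCat.ofHom i) := (ModuleCat.mono_iff_injective _).mpr h.inj
  have : Epi (ModuleCat.ofHom p) := (ModuleCat.epi_iff_surjective _).mpr h.surj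
  exact { exact := (ShortComplex.ShortExact.moduleCat_exact_iff_function_exact _).mpr h.exact
          mono_f := by assumption
          epi_g := by assumption }

theorem extZero_succ_iff (M N : ModuleCat.{0} R) (n : ℕ) :
    ExtZero M N (n+1) ↔ Subsingleton (Abelian.Ext M N (n+1)) := by
  let P := ProjectiveResolution.of M
  have key : ExtZero M N (n+1) ↔ ∀ f : P.complex.X (n+1) ⟶ N, P.complex.d (n+2) (n+1) ≫ f = 0 →
      ∃ g : P.complex.X n ⟶ N, P.complex.d (n+1) n ≫ g = f := by
    have e := P.isoExt (R := ℤ) (n+1) N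
    have h1 : ExtZero M N (n+1) ↔
        Limits.IsZero ((P.complex.linearYonedaObj ℤ N).homology (n+1)) := by
      rw [← e.isZero_iff]
      exact (ModuleCat.isZero_iff_subsingleton).symm
    rw [h1, ← HomologicalComplex.exactAt_iff_isZero_homology,
      HomologicalComplex.exactAt_iff' _ n (n+1) (n+2) (by simp) (by simp),
      ShortComplex.moduleCat_exact_iff]
    rfl
  rw [key]
  constructor
  · intro h
    refine subsingleton_of_forall_eq 0 fun α => ?_
    obtain ⟨f, hf, rfl⟩ := P.extMk_surjective α (n+2) rfl
    exact (P.extMk_eq_zero_iff f (n+2) rfl hf n rfl).mpr (h f hf)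
  · intro h f hf
    exact (P.extMk_eq_zero_iff f (n+2) rfl hf n rfl).mp (Subsingleton.elim _ _)

theorem extVanishing_iff (M N : ModuleCat.{0} R) :
    ExtVanishing M N ↔ ∀ n : ℕ, Subsingleton (Abelian.Ext M N (n+1)) := by
  constructor
  · intro h n
    exact (extZero_succ_iff M N n).mp (h (n+1) (by omega))
  · intro h j hj
    obtain ⟨n, rfl⟩ : ∃ n, j = n + 1 := ⟨j - 1, by omega⟩
    exact (extZero_succ_iff M N n).mpr (h n)

theorem extVanishing_of_injective (M N : ModuleCat.{0} R) (h : Module.Injective R N) :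
    ExtVanishing M N := by
  rw [extVanishing_iff]
  intro n
  have : Injective N := Module.injective_object_of_injective_module R N
  exact Abelian.Ext.subsingleton_of_injective M N n

theorem extVanishing_of_projective (M N : ModuleCat.{0} R) (h : Module.Projective R M) :
    ExtVanishing M N := by
  rw [extVanishing_iff]
  intro n
  have : Projective M := (IsProjective.iff_projective (R := R) M).mp h
  exact Abelian.Ext.subsingleton_of_projective M N n

variable {A X Z : ModuleCat.{0} R} {i : A →ₗ[R] X} {p : X →ₗ[R] Z}

theorem ExtVanishing.coker {M : ModuleCat.{0} R} (hA : ExtVanishing M A) (hX : ExtVanishing M X)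
    (h : IsSES i p) : ExtVanishing M Z := by
  rw [extVanishing_iff] at *
  intro n
  refine subsingleton_of_forall_eq 0 fun α => ?_
  obtain ⟨x, rfl⟩ := Abelian.Ext.covariant_sequence_exact₃ M h.shortExact α rfl
    ((hA (n+1)).elim _ _)
  rw [(hX n).elim x 0, Abelian.Ext.zero_comp]

theorem ExtVanishing.ker {M : ModuleCat.{0} R} (hZ : ExtVanishing Z M) (hX : ExtVanishing X M)
    (h : IsSES i p) : ExtVanishing A M := by
  rw [extVanishing_iff] at *
  intro n
  refine subsingleton_of_forall_eq 0 fun α => ?_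
  obtain ⟨x, rfl⟩ := Abelian.Ext.contravariant_sequence_exact₁ h.shortExact M α
    (n₁ := n+1+1) (by omega) ((hZ (n+1)).elim _ _)
  rw [(hX n).elim x 0, Abelian.Ext.comp_zero]

/-- lifting along the surjection of a short exact sequence -/
theorem ExtVanishing.lift {M : ModuleCat.{0} R} (hA : ExtVanishing M A) (h : IsSES i p)
    (g : M →ₗ[R] Z) : ∃ g' : M →ₗ[R] X, p ∘ₗ g' = g := by
  rw [extVanishing_iff] at hA
  obtain ⟨x, hx⟩ := Abelian.Ext.covariant_sequence_exact₃ M h.shortExact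
    (Abelian.Ext.mk₀ (ModuleCat.ofHom g)) rfl ((hA 0).elim _ _)
  obtain ⟨x, rfl⟩ := (Abelian.Ext.mk₀_bijective _ _).2 x
  rw [Abelian.Ext.mk₀_comp_mk₀] at hx
  have := (Abelian.Ext.mk₀_bijective _ _).1 hx
  exact ⟨x.hom, by rw [← ModuleCat.ofHom_hom x] at this; exact ModuleCat.hom_ext_iff.mp this⟩

/-- extension along the injection of a short exact sequence -/
theorem ExtVanishing.extend {M : ModuleCat.{0} R} (hZ : ExtVanishing Z M) (h : IsSES i p)
    (g : A →ₗ[R] M) : ∃ g' : X →ₗ[R] M, g' ∘ₗ i = g := by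
  rw [extVanishing_iff] at hZ
  obtain ⟨x, hx⟩ := Abelian.Ext.contravariant_sequence_exact₁ h.shortExact M
    (Abelian.Ext.mk₀ (ModuleCat.ofHom g)) rfl ((hZ 0).elim _ _)
  obtain ⟨x, rfl⟩ := (Abelian.Ext.mk₀_bijective _ _).2 x
  rw [Abelian.Ext.mk₀_comp_mk₀] at hx
  have := (Abelian.Ext.mk₀_bijective _ _).1 hx
  exact ⟨x.hom, ModuleCat.hom_ext_iff.mp this⟩

theorem extVanishing_of_extend {W : ModuleCat.{0} R} (hX : ExtVanishing X W)
    (hA : ExtVanishing A W) (h : IsSES i p)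
    (he : ∀ g : A →ₗ[R] W, ∃ g' : X →ₗ[R] W, g' ∘ₗ i = g) : ExtVanishing Z W := by
  rw [extVanishing_iff] at *
  intro n
  refine subsingleton_of_forall_eq 0 fun α => ?_
  obtain ⟨x, rfl⟩ := Abelian.Ext.contravariant_sequence_exact₃ h.shortExact W α
    ((hX n).elim _ _) (n₀ := n) (by omega)
  cases n with
  | zero =>
    obtain ⟨x, rfl⟩ := (Abelian.Ext.mk₀_bijective _ _).2 x
    obtain ⟨g', hg'⟩ := he x.hom
    have : x = ModuleCat.ofHom i ≫ ModuleCat.ofHom g' := by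
      apply ModuleCat.hom_ext; exact hg'.symm
    rw [this, ← Abelian.Ext.mk₀_comp_mk₀]
    have h2 := h.shortExact.extClass_comp_assoc (Abelian.Ext.mk₀ (ModuleCat.ofHom g')) (h := rfl)
    exact h2
  | succ n => rw [(hA n).elim x 0, Abelian.Ext.comp_zero]

theorem extVanishing_of_lift {W : ModuleCat.{0} R} (hX : ExtVanishing W X)
    (hZ : ExtVanishing W Z) (h : IsSES i p)
    (he : ∀ g : W →ₗ[R] Z, ∃ g' : W →ₗ[R] X, p ∘ₗ g' = g) : ExtVanishing W A := by
  rw [extVanishing_iff] at *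
  intro n
  refine subsingleton_of_forall_eq 0 fun α => ?_
  obtain ⟨x, rfl⟩ := Abelian.Ext.covariant_sequence_exact₁ W h.shortExact α
    ((hX n).elim _ _) (n₀ := n) (by omega)
  cases n with
  | zero =>
    obtain ⟨x, rfl⟩ := (Abelian.Ext.mk₀_bijective _ _).2 x
    obtain ⟨g', hg'⟩ := he x.hom
    have : x = ModuleCat.ofHom g' ≫ ModuleCat.ofHom p := by
      apply ModuleCat.hom_ext; exact hg'.symm
    rw [this, ← Abelian.Ext.mk₀_comp_mk₀]
    rw [Abelian.Ext.comp_assoc_of_second_deg_zero]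
    have h2 := h.shortExact.comp_extClass
    rw [h2, Abelian.Ext.comp_zero]
  | succ n => rw [(hZ n).elim x 0, Abelian.Ext.zero_comp]

/-- retracts in both variables -/
theorem ExtVanishing.of_retract {M M' N N' : ModuleCat.{0} R} (h : ExtVanishing M N)
    (hM : IsSummand M' M) (hN : IsSummand N' N) : ExtVanishing M' N' := by
  rw [extVanishing_iff] at *
  obtain ⟨a, b, hab⟩ := hM
  obtain ⟨c, d, hcd⟩ := hN
  intro n
  refine subsingleton_of_forall_eq 0 fun α => ?_
  have e1 : ModuleCat.ofHom a ≫ ModuleCat.ofHom b = 𝟙 M' := by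
    apply ModuleCat.hom_ext; exact hab
  have e2 : ModuleCat.ofHom c ≫ ModuleCat.ofHom d = 𝟙 N' := by
    apply ModuleCat.hom_ext; exact hcd
  have h3 : ((Abelian.Ext.mk₀ (ModuleCat.ofHom b)).comp α (zero_add _)).comp
      (Abelian.Ext.mk₀ (ModuleCat.ofHom c)) (add_zero _) = 0 := (h n).elim _ _
  have h4 := congrArg (fun z => ((Abelian.Ext.mk₀ (ModuleCat.ofHom a)).comp z (zero_add _)).comp
      (Abelian.Ext.mk₀ (ModuleCat.ofHom d)) (add_zero _)) h3
  simpa [Abelian.Ext.comp_assoc_of_third_deg_zero, Abelian.Ext.mk₀_comp_mk₀_assoc, e1, e2,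
    Abelian.Ext.mk₀_comp_mk₀, Abelian.Ext.comp_assoc_of_second_deg_zero] using h4

end ExtFacts
end PS

namespace PS

section SeqFacts
variable {R : Type} [Ring R]

theorem IsSES.congr_left {A A' X Z : ModuleCat.{0} R} {i : A →ₗ[R] X} {p : X →ₗ[R] Z}
    (h : IsSES i p) (e : A' ≃ₗ[R] A) : IsSES (i ∘ₗ e.toLinearMap) p := by
  refine ⟨h.inj.comp e.injective, ?_, h.surj⟩
  intro x
  rw [h.exact x]
  constructor
  · rintro ⟨a, rfl⟩
    exact ⟨e.symm a, by simp⟩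
  · rintro ⟨a, rfl⟩
    exact ⟨e a, rfl⟩

theorem IsSES.congr_right {A X Z Z' : ModuleCat.{0} R} {i : A →ₗ[R] X} {p : X →ₗ[R] Z}
    (h : IsSES i p) (e : Z ≃ₗ[R] Z') : IsSES i (e.toLinearMap ∘ₗ p) := by
  refine ⟨h.inj, ?_, e.surjective.comp h.surj⟩
  intro x
  rw [← h.exact x]
  simp

/-- Cokernel short exact sequence. -/
theorem isSES_coker {A X : ModuleCat.{0} R} (i : A →ₗ[R] X) (h : Function.Injective i) :
    IsSES (Z := ModuleCat.of R (X ⧸ LinearMap.range i)) i (LinearMap.range i).mkQ :=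
  ⟨h, LinearMap.exact_map_mkQ_range i, Submodule.mkQ_surjective _⟩

/-- Kernel short exact sequence. -/
theorem isSES_ker {X Z : ModuleCat.{0} R} (p : X →ₗ[R] Z) (h : Function.Surjective p) :
    IsSES (A := ModuleCat.of R (LinearMap.ker p)) (LinearMap.ker p).subtype p :=
  ⟨Subtype.val_injective, LinearMap.exact_subtype_ker_map p, h⟩

/-- Exact sequences `0 → A → Y₁ → ⋯ → Yₙ → Z → 0` with middle terms satisfying `PP`. -/
def LP (PP : ModuleCat.{0} R → Prop) : ℕ → ModuleCat.{0} R → ModuleCat.{0} R → Prop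
  | 0, A, Z => Nonempty (A ≃ₗ[R] Z)
  | (n+1), A, Z => ∃ (X N : ModuleCat.{0} R) (i : A →ₗ[R] X) (p : X →ₗ[R] N),
      PP X ∧ IsSES i p ∧ LP PP n N Z

variable {PP PP' : ModuleCat.{0} R → Prop}

theorem LP.mono {n : ℕ} {A Z : ModuleCat.{0} R} (h : LP PP n A Z) (hP : ∀ X, PP X → PP' X) :
    LP PP' n A Z := by
  induction n generalizing A with
  | zero => exact h
  | succ n ih =>
    obtain ⟨X, N, i, p, hX, hs, hN⟩ := h
    exact ⟨X, N, i, p, hP X hX, hs, ih hN⟩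

theorem LP.congr_left {n : ℕ} {A A' Z : ModuleCat.{0} R} (h : LP PP n A Z) (e : A' ≃ₗ[R] A) :
    LP PP n A' Z := by
  cases n with
  | zero => obtain ⟨e'⟩ := h; exact ⟨e.trans e'⟩
  | succ n =>
    obtain ⟨X, N, i, p, hX, hs, hN⟩ := h
    exact ⟨X, N, _, p, hX, hs.congr_left e, hN⟩

theorem LP.congr_right {n : ℕ} {A Z Z' : ModuleCat.{0} R} (h : LP PP n A Z) (e : Z ≃ₗ[R] Z') :
    LP PP n A Z' := by
  induction n generalizing A with
  | zero => obtain ⟨e'⟩ := h; exact ⟨e'.trans e⟩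
  | succ n ih =>
    obtain ⟨X, N, i, p, hX, hs, hN⟩ := h
    exact ⟨X, N, i, p, hX, hs, ih hN⟩

theorem LP.append {n : ℕ} {A N X Z : ModuleCat.{0} R} (h : LP PP n A N) {i : N →ₗ[R] X}
    {p : X →ₗ[R] Z} (hX : PP X) (hs : IsSES i p) : LP PP (n+1) A Z := by
  induction n generalizing A with
  | zero =>
    obtain ⟨e⟩ := h
    exact ⟨X, Z, _, p, hX, hs.congr_left e, ⟨LinearEquiv.refl R Z⟩⟩
  | succ n ih =>
    obtain ⟨X', N', i', p', hX', hs', hN'⟩ := h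
    exact ⟨X', N', i', p', hX', hs', ih hN'⟩

theorem LP.peel {n : ℕ} {A Z : ModuleCat.{0} R} (h : LP PP (n+1) A Z) :
    ∃ (X N : ModuleCat.{0} R) (i : N →ₗ[R] X) (p : X →ₗ[R] Z),
      PP X ∧ IsSES i p ∧ LP PP n A N := by
  induction n generalizing A with
  | zero =>
    obtain ⟨X, N, i, p, hX, hs, ⟨e⟩⟩ := h
    exact ⟨X, A, i, _, hX, hs.congr_right e, ⟨LinearEquiv.refl R A⟩⟩
  | succ n ih =>
    obtain ⟨X, N, i, p, hX, hs, hN⟩ := h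
    obtain ⟨X', N', i', p', hX', hs', hN'⟩ := ih hN
    exact ⟨X', N', i', p', hX', hs', X, N, i, p, hX, hs, hN'⟩

theorem LP.of_seq {k : ℕ} {Y : ℕ → ModuleCat.{0} R} {f : ∀ i, Y i →ₗ[R] Y (i+1)}
    (h : IsExactSeq (k+1) Y f) (hP : ∀ i, 1 ≤ i → i ≤ k → PP (Y i)) :
    LP PP k (Y 0) (Y (k+1)) := by
  induction k generalizing Y with
  | zero => exact ⟨LinearEquiv.ofBijective (f 0) ⟨h.1, h.2.1⟩⟩
  | succ k ih =>
    obtain ⟨h1, h2, h3⟩ := h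
    have hex : Function.Exact (f 0) (f 1) := h3 0 (by omega)
    refine ⟨Y 1, ModuleCat.of R (Y 1 ⧸ LinearMap.range (f 0)), f 0, _, hP 1 (by omega) (by omega),
      isSES_coker (f 0) h1, ?_⟩
    let Y' : ℕ → ModuleCat.{0} R := fun n =>
      match n with
      | 0 => ModuleCat.of R (Y 1 ⧸ LinearMap.range (f 0))
      | (m+1) => Y (m+2)
    let f' : ∀ i, Y' i →ₗ[R] Y' (i+1) := fun n =>
      match n with
      | 0 => (LinearMap.range (f 0)).liftQ (f 1) (by
          rintro _ ⟨x, rfl⟩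
          exact hex.apply_apply_eq_zero x)
      | (m+1) => f (m+2)
    have hf0 : ∀ y : Y 1, f' 0 ((LinearMap.range (f 0)).mkQ y) = f 1 y := fun y =>
      Submodule.liftQ_apply _ _ _
    have := ih (Y := Y') (f := f') ?_ ?_
    · exact this
    · refine ⟨?_, ?_, ?_⟩
      · rw [← LinearMap.ker_eq_bot, LinearMap.ker_eq_bot']
        intro m hm
        obtain ⟨y, rfl⟩ := Submodule.mkQ_surjective _ m
        rw [hf0, hex y] at hm
        exact (Submodule.Quotient.mk_eq_zero _).mpr hm
      · cases k with
        | zero =>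
          intro z
          obtain ⟨y, hy⟩ := h2 z
          exact ⟨(LinearMap.range (f 0)).mkQ y, (hf0 y).trans hy⟩
        | succ k => exact h2
      · intro i hi
        cases i with
        | zero =>
          intro z
          have := h3 1 (by omega) z
          rw [show f' (0+1) z = f 2 z from rfl, this]
          constructor
          · rintro ⟨y, rfl⟩
            exact ⟨(LinearMap.range (f 0)).mkQ y, hf0 y⟩
          · rintro ⟨y, rfl⟩
            obtain ⟨y, rfl⟩ := Submodule.mkQ_surjective _ y
            exact ⟨y, (hf0 y).symm⟩
        | succ i => exact h3 (i+2) (by omega)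
    · intro i hi hik
      obtain ⟨j, rfl⟩ : ∃ j, i = j + 1 := ⟨i - 1, by omega⟩
      exact hP (j+2) (by omega) (by omega)

theorem LP.to_seq {k : ℕ} {A Z : ModuleCat.{0} R} (h : LP PP k A Z) :
    ∃ (Y : ℕ → ModuleCat.{0} R) (f : ∀ i, Y i →ₗ[R] Y (i+1)),
      IsExactSeq (k+1) Y f ∧ Y 0 = A ∧ Y (k+1) = Z ∧ ∀ i, 1 ≤ i → i ≤ k → PP (Y i) := by
  induction k generalizing A with
  | zero =>
    obtain ⟨e⟩ := h
    let Y : ℕ → ModuleCat.{0} R := fun n => match n with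
      | 0 => A
      | (_+1) => Z
    let f : ∀ i, Y i →ₗ[R] Y (i+1) := fun n => match n with
      | 0 => e.toLinearMap
      | (_+1) => LinearMap.id (R := R) (M := Z)
    exact ⟨Y, f, ⟨e.injective, e.surjective, fun i hi => by omega⟩, rfl, rfl,
      fun i h1 h2 => by omega⟩
  | succ k ih =>
    obtain ⟨X, N, i, p, hX, hs, hN⟩ := h
    obtain ⟨Y, f, hY, rfl, hZ, hP⟩ := ih hN
    let Y' : ℕ → ModuleCat.{0} R := fun n => match n with
      | 0 => A
      | 1 => X
      | (m+2) => Y (m+1)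
    let f' : ∀ i, Y' i →ₗ[R] Y' (i+1) := fun n => match n with
      | 0 => i
      | 1 => f 0 ∘ₗ p
      | (m+2) => f (m+1)
    obtain ⟨h1, h2, h3⟩ := hY
    refine ⟨Y', f', ⟨hs.inj, ?_, ?_⟩, rfl, hZ, ?_⟩
    · cases k with
      | zero =>
        have h2' : Function.Surjective (f 0) := h2
        exact h2'.comp hs.surj
      | succ k => exact h2
    · intro j hj
      match j with
      | 0 =>
        intro x
        rw [← hs.exact x]
        exact (map_eq_zero_iff (f 0) h1)
      | 1 =>
        intro y
        refine (h3 0 (by omega) y).trans ?_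
        constructor
        · rintro ⟨z, rfl⟩
          obtain ⟨x, rfl⟩ := hs.surj z
          exact ⟨x, rfl⟩
        · rintro ⟨x, rfl⟩
          exact ⟨p x, rfl⟩
      | (m+2) => exact h3 (m+1) (by omega)
    · intro j h1 h2
      match j with
      | 1 => exact hX
      | (m+2) => exact hP (m+1) (by omega) (by omega)

/-- Left-to-right induction along a sequence. -/
theorem LP.inductL {QQ : ModuleCat.{0} R → Prop} {n : ℕ} {A Z : ModuleCat.{0} R}
    (h : LP PP n A Z) (hA : QQ A)
    (hstep : ∀ (A X N : ModuleCat.{0} R) (i : A →ₗ[R] X) (p : X →ₗ[R] N), PP X → IsSES i p →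
      QQ A → QQ N)
    (hiso : ∀ A A' : ModuleCat.{0} R, (A ≃ₗ[R] A') → QQ A → QQ A') : QQ Z := by
  induction n generalizing A with
  | zero => obtain ⟨e⟩ := h; exact hiso _ _ e hA
  | succ n ih =>
    obtain ⟨X, N, i, p, hX, hs, hN⟩ := h
    exact ih hN (hstep _ _ _ i p hX hs hA)

/-- Right-to-left induction along a sequence. -/
theorem LP.inductR {QQ : ModuleCat.{0} R → Prop} {n : ℕ} {A Z : ModuleCat.{0} R}
    (h : LP PP n A Z) (hZ : QQ Z)
    (hstep : ∀ (N X Z : ModuleCat.{0} R) (i : N →ₗ[R] X) (p : X →ₗ[R] Z), PP X → IsSES i p →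
      QQ Z → QQ N)
    (hiso : ∀ A A' : ModuleCat.{0} R, (A ≃ₗ[R] A') → QQ A → QQ A') : QQ A := by
  induction n generalizing Z with
  | zero => obtain ⟨e⟩ := h; exact hiso _ _ e.symm hZ
  | succ n ih =>
    obtain ⟨X, N, i, p, hX, hs, hN⟩ := h.peel
    exact ih hN (hstep _ _ _ i p hX hs hZ)

end SeqFacts

section AddFacts
variable {R : Type} [Ring R]

theorem IsSummand.refl (M : ModuleCat.{0} R) : IsSummand M M := ⟨LinearMap.id, LinearMap.id, rfl⟩

theorem isSummand_of_equiv {M N : ModuleCat.{0} R} (e : M ≃ₗ[R] N) : IsSummand M N :=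
  ⟨e.toLinearMap, e.symm.toLinearMap, by ext; simp⟩

theorem IsSummand.trans {M N L : ModuleCat.{0} R} (h : IsSummand M N) (h' : IsSummand N L) :
    IsSummand M L := by
  obtain ⟨a, b, hab⟩ := h
  obtain ⟨c, d, hcd⟩ := h'
  refine ⟨c ∘ₗ a, b ∘ₗ d, ?_⟩
  ext x
  have h1 := LinearMap.congr_fun hcd (a x)
  have h2 := LinearMap.congr_fun hab x
  simp at h1 h2 ⊢
  rw [h1, h2]

/-- Elementwise description of `add`. -/
theorem memAdd_iff {X M : ModuleCat.{0} R} :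
    MemAdd X M ↔ ∃ (n : ℕ) (ι : Fin n → (M →ₗ[R] X)) (π : Fin n → (X →ₗ[R] M)),
      ∀ m : M, ∑ a, π a (ι a m) = m := by
  constructor
  · rintro ⟨n, ι, π, h⟩
    refine ⟨n, fun a => LinearMap.proj a ∘ₗ ι, fun a => π ∘ₗ LinearMap.single R (fun _ => X) a, ?_⟩
    intro m
    have h1 := LinearMap.congr_fun h m
    simp only [LinearMap.comp_apply, LinearMap.id_apply] at h1 ⊢
    rw [← map_sum]
    conv_rhs => rw [← h1]
    congr 1
    exact LinearMap.sum_single_apply (fun _ => X) (ι m)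
  · rintro ⟨n, ι, π, h⟩
    refine ⟨n, LinearMap.pi ι, ∑ a, π a ∘ₗ LinearMap.proj a, ?_⟩
    ext m
    simp [h]

/-- `MemAdd` from an arbitrary finite index type. -/
theorem memAdd_of {X M : ModuleCat.{0} R} {α : Type*} [Fintype α] (ι : α → (M →ₗ[R] X))
    (π : α → (X →ₗ[R] M)) (h : ∀ m : M, ∑ a, π a (ι a m) = m) : MemAdd X M := by
  rw [memAdd_iff]
  let e := (Fintype.equivFin α).symm
  refine ⟨Fintype.card α, fun a => ι (e a), fun a => π (e a), fun m => ?_⟩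
  exact (Equiv.sum_comp e (fun a => π a (ι a m))).trans (h m)

theorem IsSummand.memAdd {X M : ModuleCat.{0} R} (h : IsSummand M X) : MemAdd X M := by
  obtain ⟨a, b, hab⟩ := h
  exact memAdd_of (α := Unit) (fun _ => a) (fun _ => b) (fun m => by
    simpa using LinearMap.congr_fun hab m)

theorem MemAdd.refl (X : ModuleCat.{0} R) : MemAdd X X := (IsSummand.refl X).memAdd

theorem MemAdd.trans {X Y M : ModuleCat.{0} R} (h : MemAdd X Y) (h' : MemAdd Y M) : MemAdd X M := by
  obtain ⟨n, a, b, hab⟩ := memAdd_iff.mp h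
  obtain ⟨m, c, d, hcd⟩ := memAdd_iff.mp h'
  refine memAdd_of (α := Fin m × Fin n) (fun q => a q.2 ∘ₗ c q.1) (fun q => d q.1 ∘ₗ b q.2) ?_
  intro x
  rw [Fintype.sum_prod_type]
  simp only [LinearMap.comp_apply, ← map_sum, hab, hcd]

theorem memAdd_of_equiv {X M : ModuleCat.{0} R} (e : M ≃ₗ[R] X) : MemAdd X M :=
  (isSummand_of_equiv e).memAdd

theorem memAdd_pow (X : ModuleCat.{0} R) (n : ℕ) : MemAdd X (ModuleCat.of R (Fin n → X)) :=
  ⟨n, IsSummand.refl _⟩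

theorem MemAdd.of_summand {X M N : ModuleCat.{0} R} (h : MemAdd X M) (h' : IsSummand N M) :
    MemAdd X N := h.trans h'.memAdd

theorem MemAdd.pow {X M : ModuleCat.{0} R} (h : MemAdd X M) (n : ℕ) :
    MemAdd X (ModuleCat.of R (Fin n → M)) := h.trans (memAdd_pow M n)

theorem MemAdd.finite {X M : ModuleCat.{0} R} (h : MemAdd X M) [Module.Finite R X] :
    Module.Finite R M := by
  obtain ⟨n, ι, π, h⟩ := h
  exact Module.Finite.of_surjective π (fun m => ⟨ι m, LinearMap.congr_fun h m⟩)

theorem IsSummand.projective {M N : ModuleCat.{0} R} (h : IsSummand N M)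
    (hM : Module.Projective R M) : Module.Projective R N := by
  obtain ⟨a, b, hab⟩ := h
  exact Module.Projective.of_split a b hab

theorem IsSummand.injective {M N : ModuleCat.{0} R} (h : IsSummand N M)
    (hM : Module.Injective R M) : Module.Injective R N := by
  obtain ⟨a, b, hab⟩ := h
  refine ⟨fun X Y _ _ _ _ f hf g => ?_⟩
  obtain ⟨g', hg'⟩ := hM.out f hf (a ∘ₗ g)
  refine ⟨b ∘ₗ g', fun x => ?_⟩
  rw [LinearMap.comp_apply, hg' x]
  exact LinearMap.congr_fun hab (g x)

theorem MemAdd.projective {M N : ModuleCat.{0} R} (h : MemAdd M N)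
    (hM : Module.Projective R M) : Module.Projective R N := by
  obtain ⟨n, h⟩ := h
  refine h.projective ?_
  have := hM
  have h2 : Module.Projective R (Π₀ _ : Fin n, M) := inferInstance
  exact Module.Projective.of_equiv (DFinsupp.linearEquivFunOnFintype (R := R))

theorem injective_pow {M : ModuleCat.{0} R} (hM : Module.Injective R M) (n : ℕ) :
    Module.Injective R (Fin n → M) := by
  refine ⟨fun X Y _ _ _ _ f hf g => ?_⟩
  choose g' hg' using fun a : Fin n => hM.out f hf (LinearMap.proj a ∘ₗ g)
  refine ⟨LinearMap.pi g', fun x => ?_⟩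
  ext a
  exact hg' a x

theorem MemAdd.injective {M N : ModuleCat.{0} R} (h : MemAdd M N)
    (hM : Module.Injective R M) : Module.Injective R N := by
  obtain ⟨n, h⟩ := h
  exact h.injective (injective_pow hM n)

/-- f.g. projectives lie in `add R`. -/
theorem memAdd_reg_of_projective {M : ModuleCat.{0} R} [Module.Finite R M]
    (hM : Module.Projective R M) : MemAdd (reg R) M := by
  obtain ⟨n, p, hp⟩ := Module.Finite.exists_fin' R M
  obtain ⟨s, hs⟩ := Module.projective_lifting_property p LinearMap.id hp
  exact ⟨n, s, p, hs⟩

theorem reg_projective : Module.Projective R (reg R) :=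
  inferInstanceAs (Module.Projective R R)

/-- An injective module that embeds is a summand. -/
theorem isSummand_of_injective {M N : ModuleCat.{0} R} (hM : Module.Injective R M)
    (f : M →ₗ[R] N) (hf : Function.Injective f) : IsSummand M N := by
  obtain ⟨g, hg⟩ := hM.out f hf LinearMap.id
  exact ⟨f, g, LinearMap.ext hg⟩

theorem isSummand_of_projective {M N : ModuleCat.{0} R} (hM : Module.Projective R M)
    (f : N →ₗ[R] M) (hf : Function.Surjective f) : IsSummand M N := by
  obtain ⟨s, hs⟩ := Module.projective_lifting_property f LinearMap.id hf
  exact ⟨s, f, hs⟩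

theorem MemAdd.extVanishing {X Y M N : ModuleCat.{0} R} (h : ExtVanishing X Y)
    (hM : MemAdd X M) (hN : MemAdd Y N) : ExtVanishing M N := by
  rw [extVanishing_iff] at *
  intro n
  obtain ⟨m, a, b, hab⟩ := memAdd_iff.mp hM
  obtain ⟨m', c, d, hcd⟩ := memAdd_iff.mp hN
  have e1 : 𝟙 M = ∑ j, ModuleCat.ofHom (a j) ≫ ModuleCat.ofHom (b j) := by
    apply ModuleCat.hom_ext
    ext x
    simp only [ModuleCat.hom_sum, LinearMap.sum_apply]
    exact (hab x).symm
  have e2 : 𝟙 N = ∑ j, ModuleCat.ofHom (c j) ≫ ModuleCat.ofHom (d j) := by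
    apply ModuleCat.hom_ext
    ext x
    simp only [ModuleCat.hom_sum, LinearMap.sum_apply]
    exact (hcd x).symm
  have h1 : ∀ α : Abelian.Ext X N (n+1), α = 0 := by
    intro α
    rw [← Abelian.Ext.comp_mk₀_id α, e2, Abelian.Ext.mk₀_sum, Abelian.Ext.comp_sum]
    refine Finset.sum_eq_zero fun j _ => ?_
    rw [← Abelian.Ext.mk₀_comp_mk₀, ← Abelian.Ext.comp_assoc_of_third_deg_zero,
      (h n).elim (α.comp (Abelian.Ext.mk₀ (ModuleCat.ofHom (c j))) (add_zero _)) 0,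
      Abelian.Ext.zero_comp]
  refine subsingleton_of_forall_eq 0 fun α => ?_
  rw [← Abelian.Ext.mk₀_id_comp α, e1, Abelian.Ext.mk₀_sum, Abelian.Ext.sum_comp]
  refine Finset.sum_eq_zero fun j _ => ?_
  rw [← Abelian.Ext.mk₀_comp_mk₀, Abelian.Ext.comp_assoc_of_second_deg_zero,
      h1 ((Abelian.Ext.mk₀ (ModuleCat.ofHom (b j))).comp α (zero_add _)),
      Abelian.Ext.comp_zero]

end AddFacts
end PS

namespace PS

section DimFacts
variable {R : Type} [Ring R]

/-- the class of injective modules -/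
def Inj (X : ModuleCat.{0} R) : Prop := Module.Injective R X
/-- the class of projective modules -/
def Proj (X : ModuleCat.{0} R) : Prop := Module.Projective R X

theorem inj_iff (X : ModuleCat.{0} R) : Inj X ↔ Injective X :=
  ⟨fun h => Module.injective_object_of_injective_module (inj := h) R X,
    fun h => Module.injective_module_of_injective_object (inj := h) R X⟩

theorem proj_iff (X : ModuleCat.{0} R) : Proj X ↔ Projective X :=
  IsProjective.iff_projective (R := R) X

theorem inj_iff_dim (X : ModuleCat.{0} R) : Inj X ↔ HasInjectiveDimensionLT X 1 :=
  (inj_iff X).trans (injective_iff_hasInjectiveDimensionLT_one)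

theorem proj_iff_dim (X : ModuleCat.{0} R) : Proj X ↔ HasProjectiveDimensionLT X 1 :=
  (proj_iff X).trans (projective_iff_hasProjectiveDimensionLT_one)

theorem retract_of_summand {M N : ModuleCat.{0} R} (h : IsSummand M N) : Nonempty (Retract M N) := by
  obtain ⟨a, b, hab⟩ := h
  exact ⟨⟨ModuleCat.ofHom a, ModuleCat.ofHom b, ModuleCat.hom_ext hab⟩⟩

theorem IsSummand.idim {M N : ModuleCat.{0} R} (h : IsSummand M N) (n : ℕ)
    (hN : HasInjectiveDimensionLT N n) : HasInjectiveDimensionLT M n := by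
  obtain ⟨r⟩ := retract_of_summand h
  exact r.hasInjectiveDimensionLT n

theorem IsSummand.pdim {M N : ModuleCat.{0} R} (h : IsSummand M N) (n : ℕ)
    (hN : HasProjectiveDimensionLT N n) : HasProjectiveDimensionLT M n := by
  obtain ⟨r⟩ := retract_of_summand h
  exact r.hasProjectiveDimensionLT n

theorem Inj.congr {A A' : ModuleCat.{0} R} (e : A ≃ₗ[R] A') (h : Inj A) : Inj A' :=
  (isSummand_of_equiv e.symm).injective h

theorem Proj.congr {A A' : ModuleCat.{0} R} (e : A ≃ₗ[R] A') (h : Proj A) : Proj A' :=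
  (isSummand_of_equiv e.symm).projective h

theorem LP.idim_iff {n : ℕ} {A Z : ModuleCat.{0} R} (h : LP Inj n A Z) :
    HasInjectiveDimensionLT A (n+1) ↔ Inj Z := by
  induction n generalizing A with
  | zero =>
    obtain ⟨e⟩ := h
    rw [zero_add, ← inj_iff_dim]
    exact ⟨Inj.congr e, Inj.congr e.symm⟩
  | succ n ih =>
    obtain ⟨X, N, i, p, hX, hs, hN⟩ := h
    rw [← ih hN]
    exact (hs.shortExact.hasInjectiveDimensionLT_X₃_iff n ((inj_iff X).mp hX)).symm

theorem LP.pdim_iff {n : ℕ} {A Z : ModuleCat.{0} R} (h : LP Proj n A Z) :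
    HasProjectiveDimensionLT Z (n+1) ↔ Proj A := by
  induction n generalizing Z with
  | zero =>
    obtain ⟨e⟩ := h
    rw [zero_add, ← proj_iff_dim]
    exact ⟨Proj.congr e.symm, Proj.congr e⟩
  | succ n ih =>
    obtain ⟨X, N, i, p, hX, hs, hN⟩ := h.peel
    rw [← ih hN]
    exact (hs.shortExact.hasProjectiveDimensionLT_X₃_iff n ((proj_iff X).mp hX))

theorem exists_inj_embedding (A : ModuleCat.{0} R) :
    ∃ (X : ModuleCat.{0} R) (i : A →ₗ[R] X), Inj X ∧ Function.Injective i :=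
  ⟨Injective.under A, (Injective.ι A).hom, (inj_iff _).mpr inferInstance,
    (ModuleCat.mono_iff_injective _).mp inferInstance⟩

theorem exists_proj_cover (A : ModuleCat.{0} R) :
    ∃ (X : ModuleCat.{0} R) (i : X →ₗ[R] A), Proj X ∧ Function.Surjective i :=
  ⟨Projective.over A, (Projective.π A).hom, (proj_iff _).mpr inferInstance,
    (ModuleCat.epi_iff_surjective _).mp inferInstance⟩

theorem exists_LP_inj (n : ℕ) (A : ModuleCat.{0} R) : ∃ Z, LP Inj n A Z := by
  induction n generalizing A with
  | zero => exact ⟨A, ⟨LinearEquiv.refl R A⟩⟩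
  | succ n ih =>
    obtain ⟨X, i, hX, hi⟩ := exists_inj_embedding A
    obtain ⟨Z, hZ⟩ := ih (ModuleCat.of R (X ⧸ LinearMap.range i))
    exact ⟨Z, X, _, i, _, hX, isSES_coker i hi, hZ⟩

theorem exists_LP_proj (n : ℕ) (Z : ModuleCat.{0} R) : ∃ A, LP Proj n A Z := by
  induction n generalizing Z with
  | zero => exact ⟨Z, ⟨LinearEquiv.refl R Z⟩⟩
  | succ n ih =>
    obtain ⟨X, i, hX, hi⟩ := exists_proj_cover Z
    obtain ⟨A, hA⟩ := ih (ModuleCat.of R (LinearMap.ker i))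
    exact ⟨A, hA.append hX (isSES_ker i hi)⟩

theorem pdimLE_iff (k : ℕ) (M : ModuleCat.{0} R) :
    PdimLE k M ↔ HasProjectiveDimensionLT M (k+1) := by
  constructor
  · rintro ⟨Y, f, hY, hP, rfl⟩
    exact (LP.of_seq (PP := Proj) hY (fun i _ h => hP i h)).pdim_iff.mpr (hP 0 (by omega))
  · intro h
    obtain ⟨A, hA⟩ := exists_LP_proj k M
    have hA' := hA.pdim_iff.mp h
    obtain ⟨Y, f, hY, rfl, hZ, hP⟩ := hA.to_seq
    refine ⟨Y, f, hY, fun i hi => ?_, hZ⟩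
    rcases Nat.eq_zero_or_pos i with rfl | h0
    · exact hA'
    · exact hP i h0 hi

theorem idimLE_iff (k : ℕ) (M : ModuleCat.{0} R) :
    IdimLE k M ↔ HasInjectiveDimensionLT M (k+1) := by
  constructor
  · rintro ⟨Y, f, hY, hP, rfl⟩
    exact (LP.of_seq (PP := Inj) hY (fun i h1 h => hP i h1 (by omega))).idim_iff.mpr
      (hP (k+1) (by omega) le_rfl)
  · intro h
    obtain ⟨A, hA⟩ := exists_LP_inj k M
    have hA' := hA.idim_iff.mp h
    obtain ⟨Y, f, hY, h0, rfl, hP⟩ := hA.to_seq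
    refine ⟨Y, f, hY, fun i hi1 hi => ?_, h0⟩
    rcases Nat.lt_or_ge i (k+1) with h2 | h2
    · exact hP i hi1 (by omega)
    · obtain rfl : i = k+1 := by omega
      exact hA'

theorem isSpecialTilting_iff (P : ModuleCat.{0} R) (k : ℕ) (T : ModuleCat.{0} R) :
    IsSpecialTilting P k T ↔ Module.Finite R T ∧ HasProjectiveDimensionLT T (k+1) ∧
      ExtVanishing T T ∧ ∃ Z, MemAdd T Z ∧ LP (fun X => MemAdd T X ∧ MemAdd P X) k (reg R) Z := by
  constructor
  · rintro ⟨⟨h1, h2, h3, -⟩, Y, f, hY, h0, hT, hP⟩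
    refine ⟨h1, (pdimLE_iff k T).mp h2, h3, Y (k+1), hT _ (by omega) le_rfl, ?_⟩
    rw [← h0]
    exact LP.of_seq hY (fun i h1 h2 => ⟨hT i h1 (by omega), hP i h1 h2⟩)
  · rintro ⟨h1, h2, h3, Z, hZ, hL⟩
    obtain ⟨Y, f, hY, h0, rfl, hP⟩ := hL.to_seq
    have hT : ∀ i, 1 ≤ i → i ≤ k+1 → MemAdd T (Y i) := by
      intro i hi1 hi
      rcases Nat.lt_or_ge i (k+1) with h2 | h2
      · exact (hP i hi1 (by omega)).1
      · obtain rfl : i = k+1 := by omega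
        exact hZ
    exact ⟨⟨h1, (pdimLE_iff k T).mpr h2, h3, Y, f, hY, h0, hT⟩, Y, f, hY, h0, hT,
      fun i hi hi' => (hP i hi hi').2⟩

theorem isSpecialCotilting_iff (K : Type) [Field K] [Algebra K R] (I : ModuleCat.{0} R) (k : ℕ)
    (C : ModuleCat.{0} R) :
    IsSpecialCotilting K I k C ↔ Module.Finite R C ∧ HasInjectiveDimensionLT C (k+1) ∧
      ExtVanishing C C ∧ ∃ A, MemAdd C A ∧
        LP (fun X => MemAdd C X ∧ MemAdd I X) k A (Dreg K R) := by
  constructor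
  · rintro ⟨⟨h1, h2, h3, -⟩, Y, f, hY, h0, hT, hP⟩
    refine ⟨h1, (idimLE_iff k C).mp h2, h3, Y 0, hT _ (by omega), ?_⟩
    rw [← h0]
    exact LP.of_seq hY (fun i h1 h2 => ⟨hT i (by omega), hP i h1 h2⟩)
  · rintro ⟨h1, h2, h3, Z, hZ, hL⟩
    obtain ⟨Y, f, hY, rfl, h0, hP⟩ := hL.to_seq
    have hT : ∀ i, i ≤ k → MemAdd C (Y i) := by
      intro i hi
      rcases Nat.eq_zero_or_pos i with rfl | h2
      · exact hZ
      · exact (hP i h2 hi).1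
    exact ⟨⟨h1, (idimLE_iff k C).mpr h2, h3, Y, f, hY, h0, hT⟩, Y, f, hY, h0, hT,
      fun i hi hi' => (hP i hi hi').2⟩

end DimFacts
end PS

namespace PS

section LemmaE
variable {R : Type} [Ring R] {PP : ModuleCat.{0} R → Prop}

theorem LP.exists_res {k : ℕ} {A Z : ModuleCat.{0} R} (h : LP PP k A Z) :
    ∃ (Kf Q : ℕ → ModuleCat.{0} R) (i : ∀ j, Kf (j+1) →ₗ[R] Q j) (p : ∀ j, Q j →ₗ[R] Kf j),
      Kf 0 = Z ∧ ∀ j, j < k → PP (Q j) ∧ IsSES (i j) (p j) ∧ ∃ m, LP PP m A (Kf (j+1)) := by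
  induction k generalizing Z with
  | zero => exact ⟨fun _ => Z, fun _ => Z, fun _ => 0, fun _ => 0, rfl, fun j hj => by omega⟩
  | succ k ih =>
    obtain ⟨X, N, i, p, hX, hs, hN⟩ := h.peel
    obtain ⟨Kf, Q, i', p', rfl, hj⟩ := ih hN
    refine ⟨fun n => match n with
        | 0 => Z
        | (m+1) => Kf m, fun n => match n with
        | 0 => X
        | (m+1) => Q m, fun n => match n with
        | 0 => i
        | (m+1) => i' m, fun n => match n with
        | 0 => p
        | (m+1) => p' m, rfl, fun j hjk => ?_⟩
    match j with
    | 0 => exact ⟨hX, hs, k, hN⟩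
    | (m+1) => exact hj m (by omega)

theorem LP.exists_cores {k : ℕ} {A Z : ModuleCat.{0} R} (h : LP PP k A Z) :
    ∃ (Kf Q : ℕ → ModuleCat.{0} R) (i : ∀ j, Kf j →ₗ[R] Q j) (p : ∀ j, Q j →ₗ[R] Kf (j+1)),
      Kf 0 = A ∧ ∀ j, j < k → PP (Q j) ∧ IsSES (i j) (p j) ∧ ∃ m, LP PP m (Kf (j+1)) Z := by
  induction k generalizing A with
  | zero => exact ⟨fun _ => A, fun _ => A, fun _ => 0, fun _ => 0, rfl, fun j hj => by omega⟩
  | succ k ih =>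
    obtain ⟨X, N, i, p, hX, hs, hN⟩ := h
    obtain ⟨Kf, Q, i', p', rfl, hj⟩ := ih hN
    refine ⟨fun n => match n with
        | 0 => A
        | (m+1) => Kf m, fun n => match n with
        | 0 => X
        | (m+1) => Q m, fun n => match n with
        | 0 => i
        | (m+1) => i' m, fun n => match n with
        | 0 => p
        | (m+1) => p' m, rfl, fun j hjk => ?_⟩
    match j with
    | 0 => exact ⟨hX, hs, k, hN⟩
    | (m+1) => exact hj m (by omega)

/-- factor a map through the kernel -/
theorem IsSES.factor_left {A X Z W : ModuleCat.{0} R} {i : A →ₗ[R] X} {p : X →ₗ[R] Z}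
    (h : IsSES i p) (g : W →ₗ[R] X) (hg : p ∘ₗ g = 0) : ∃ g' : W →ₗ[R] A, i ∘ₗ g' = g := by
  have hm : ∀ w, g w ∈ LinearMap.range i := fun w => (h.exact _).mp (LinearMap.congr_fun hg w)
  let e := LinearEquiv.ofInjective i h.inj
  refine ⟨e.symm.toLinearMap ∘ₗ LinearMap.codRestrict _ g hm, ?_⟩
  ext w
  have := e.apply_symm_apply ⟨g w, hm w⟩
  exact congrArg Subtype.val this

/-- factor a map through the cokernel -/
theorem IsSES.factor_right {A X Z W : ModuleCat.{0} R} {i : A →ₗ[R] X} {p : X →ₗ[R] Z}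
    (h : IsSES i p) (g : X →ₗ[R] W) (hg : g ∘ₗ i = 0) : ∃ g' : Z →ₗ[R] W, g' ∘ₗ p = g := by
  let e := p.quotKerEquivOfSurjective h.surj
  have hk : LinearMap.ker p ≤ LinearMap.ker g := by
    intro x hx
    obtain ⟨a, rfl⟩ := (h.exact x).mp hx
    exact LinearMap.congr_fun hg a
  refine ⟨(LinearMap.ker p).liftQ g hk ∘ₗ e.symm.toLinearMap, ?_⟩
  ext x
  have : e.symm (p x) = (LinearMap.ker p).mkQ x := by
    rw [LinearEquiv.symm_apply_eq]
    rfl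
  simp [this]

/-- Lemma E. -/
theorem lemmaE {k : ℕ} {A Z X₀ : ModuleCat.{0} R} (h : LP PP k A Z)
    (hcog : ∀ X : ModuleCat.{0} R, Module.Finite R X →
      ∃ (m : ℕ) (f : X →ₗ[R] (Fin m → Z)), Function.Injective f)
    (hinj : ∀ X, PP X → Inj X) (hfin : ∀ X, PP X → Module.Finite R X)
    (hpow : ∀ X (m : ℕ), PP X → PP (ModuleCat.of R (Fin m → X)))
    (hX₀ : Module.Finite R X₀)
    (hV : ∀ {W N X Y : ModuleCat.{0} R} {i : N →ₗ[R] X} {p : X →ₗ[R] Y}, (W = X₀ ∨ PP W) → PP X →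
      IsSES i p → (∃ m, LP PP m A N) → ∀ g : W →ₗ[R] Y, ∃ g' : W →ₗ[R] X, p ∘ₗ g' = g) :
    ∃ J : ModuleCat.{0} R, Module.Finite R J ∧ LP PP k X₀ J := by
  obtain ⟨Kf, Q, i, p, rfl, hQ⟩ := h.exists_res
  have main : ∀ n, n ≤ k → ∀ X : ModuleCat.{0} R, Module.Finite R X →
      (∀ j, j < n → ∀ g : X →ₗ[R] Kf j, ∃ g' : X →ₗ[R] Q j, p j ∘ₗ g' = g) →
      ∃ J : ModuleCat.{0} R, Module.Finite R J ∧ LP PP n X J := by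
    intro n
    induction n with
    | zero => intro _ X hX _; exact ⟨X, hX, ⟨LinearEquiv.refl R X⟩⟩
    | succ n ih =>
      intro hn X hX hl
      obtain ⟨m, f, hf⟩ := hcog X hX
      choose g hg using fun a : Fin m => hl 0 (by omega) (LinearMap.proj a ∘ₗ f)
      let Pm : ModuleCat.{0} R := ModuleCat.of R (Fin m → Q 0)
      have hPi : PP Pm := hpow _ m (hQ 0 (by omega)).1
      let u : X →ₗ[R] Pm := LinearMap.pi g
      have hu : Function.Injective u := by
        intro x y hxy
        apply hf
        ext a
        have h1 := LinearMap.congr_fun (hg a) x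
        have h2 := LinearMap.congr_fun (hg a) y
        have h3 : g a x = g a y := congrFun hxy a
        simp only [LinearMap.comp_apply, LinearMap.proj_apply] at h1 h2
        rw [← h1, ← h2, h3]
      have hs := isSES_coker u hu
      have hfP := hfin _ hPi
      obtain ⟨J, hJ, hLJ⟩ := ih (by omega) (ModuleCat.of R (Pm ⧸ LinearMap.range u))
        (Module.Finite.of_surjective _ hs.surj) (by
          intro j hj v
          obtain ⟨q1, q2, q3⟩ := hQ j (by omega)
          obtain ⟨q1', q2', q3'⟩ := hQ (j+1) (by omega)
          obtain ⟨w, hw⟩ := hV (W := Pm) (Or.inr hPi) q1 q2 q3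
            (v ∘ₗ (LinearMap.range u).mkQ)
          obtain ⟨w', hw'⟩ := q2.factor_left (w ∘ₗ u) (by
            rw [← LinearMap.comp_assoc, hw, LinearMap.comp_assoc]
            ext x
            have := hs.exact.apply_apply_eq_zero x
            simp only [LinearMap.comp_apply]
            rw [this]; simp)
          obtain ⟨w2, hw2⟩ := hl (j+1) (by omega) w'
          obtain ⟨w3, hw3⟩ := (hinj _ q1').out u hu w2
          obtain ⟨w4, hw4⟩ := hs.factor_right (w - i j ∘ₗ p (j+1) ∘ₗ w3) (by
            ext x
            have e1 := LinearMap.congr_fun hw' x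
            have e2 := LinearMap.congr_fun hw2 x
            have e3 := hw3 x
            simp only [LinearMap.comp_apply, LinearMap.sub_apply, LinearMap.zero_apply] at *
            rw [e3, e2, e1, sub_self])
          refine ⟨w4, ?_⟩
          refine LinearMap.ext fun y => ?_
          obtain ⟨y, rfl⟩ := hs.surj y
          have e4 := LinearMap.congr_fun hw4 y
          have e5 := LinearMap.congr_fun hw y
          simp only [LinearMap.comp_apply, LinearMap.sub_apply] at e4 e5 ⊢
          rw [e4, map_sub, q2.exact.apply_apply_eq_zero, sub_zero, e5])
      exact ⟨J, hJ, Pm, _, u, _, hPi, hs, hLJ⟩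
  exact main k le_rfl X₀ hX₀ (fun j hj g => by
    obtain ⟨q1, q2, q3⟩ := hQ j hj
    exact hV (Or.inl rfl) q1 q2 q3 g)

/-- Lemma E'. -/
theorem lemmaE' {k : ℕ} {A Z X₀ : ModuleCat.{0} R} [IsNoetherianRing R] (h : LP PP k A Z)
    (hgen : ∀ X : ModuleCat.{0} R, Module.Finite R X →
      ∃ (m : ℕ) (f : (Fin m → A) →ₗ[R] X), Function.Surjective f)
    (hproj : ∀ X, PP X → Proj X) (hfin : ∀ X, PP X → Module.Finite R X)
    (hpow : ∀ X (m : ℕ), PP X → PP (ModuleCat.of R (Fin m → X)))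
    (hX₀ : Module.Finite R X₀)
    (hV : ∀ {W N X Y : ModuleCat.{0} R} {i : N →ₗ[R] X} {p : X →ₗ[R] Y}, (W = X₀ ∨ PP W) → PP X →
      IsSES i p → (∃ m, LP PP m Y Z) → ∀ g : N →ₗ[R] W, ∃ g' : X →ₗ[R] W, g' ∘ₗ i = g) :
    ∃ J : ModuleCat.{0} R, Module.Finite R J ∧ LP PP k J X₀ := by
  obtain ⟨Kf, Q, i, p, rfl, hQ⟩ := h.exists_cores
  have main : ∀ n, n ≤ k → ∀ X : ModuleCat.{0} R, Module.Finite R X →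
      (∀ j, j < n → ∀ g : Kf j →ₗ[R] X, ∃ g' : Q j →ₗ[R] X, g' ∘ₗ i j = g) →
      ∃ J : ModuleCat.{0} R, Module.Finite R J ∧ LP PP n J X := by
    intro n
    induction n with
    | zero => intro _ X hX _; exact ⟨X, hX, ⟨LinearEquiv.refl R X⟩⟩
    | succ n ih =>
      intro hn X hX hl
      obtain ⟨m, f, hf⟩ := hgen X hX
      choose g hg using fun a : Fin m =>
        hl 0 (by omega) (f ∘ₗ LinearMap.single R (fun _ => Kf 0) a)
      let Pm : ModuleCat.{0} R := ModuleCat.of R (Fin m → Q 0)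
      have hPi : PP Pm := hpow _ m (hQ 0 (by omega)).1
      let u : Pm →ₗ[R] X := ∑ a, g a ∘ₗ LinearMap.proj a
      have hu : Function.Surjective u := by
        intro x
        obtain ⟨v, rfl⟩ := hf x
        refine ⟨fun a => i 0 (v a), ?_⟩
        have e : ∀ a, g a (i 0 (v a)) = f (Pi.single a (v a)) := fun a =>
          LinearMap.congr_fun (hg a) (v a)
        simp only [u, LinearMap.sum_apply, LinearMap.comp_apply]
        refine (Finset.sum_congr rfl (fun a _ => e a)).trans ?_
        rw [← map_sum]
        congr 1
        exact Finset.univ_sum_single v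
      have hs := isSES_ker u hu
      have hfP := hfin _ hPi
      obtain ⟨J, hJ, hLJ⟩ := ih (by omega) (ModuleCat.of R (LinearMap.ker u))
        (inferInstanceAs (Module.Finite R (LinearMap.ker u))) (by
          intro j hj v
          obtain ⟨q1, q2, q3⟩ := hQ j (by omega)
          obtain ⟨q1', q2', q3'⟩ := hQ (j+1) (by omega)
          obtain ⟨w, hw⟩ := hV (W := Pm) (Or.inr hPi) q1 q2 q3
            ((LinearMap.ker u).subtype ∘ₗ v)
          obtain ⟨w', hw'⟩ := q2.factor_right (u ∘ₗ w) (by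
            rw [LinearMap.comp_assoc, hw]
            ext x
            exact (v x).2)
          obtain ⟨w2, hw2⟩ := hl (j+1) (by omega) w'
          have hpj : Module.Projective R (Q (j+1)) := hproj _ q1'
          obtain ⟨w3, hw3⟩ := Module.projective_lifting_property u w2 hu
          obtain ⟨w4, hw4⟩ := hs.factor_left (w - w3 ∘ₗ i (j+1) ∘ₗ p j) (by
            ext x
            have e1 := LinearMap.congr_fun hw' x
            have e2 := LinearMap.congr_fun hw2 (p j x)
            have e3 := LinearMap.congr_fun hw3 (i (j+1) (p j x))
            simp only [LinearMap.comp_apply, LinearMap.sub_apply, LinearMap.zero_apply,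
              map_sub] at *
            rw [e3, e2, e1, sub_self])
          refine ⟨w4, ?_⟩
          refine LinearMap.ext fun y => Subtype.ext ?_
          have e4 := LinearMap.congr_fun hw4 (i j y)
          have e5 := LinearMap.congr_fun hw y
          simp only [LinearMap.comp_apply, LinearMap.sub_apply] at e4 e5 ⊢
          refine e4.trans ?_
          rw [q2.exact.apply_apply_eq_zero, map_zero, map_zero, sub_zero, e5]
          rfl)
      exact ⟨J, hJ, hLJ.append hPi hs⟩
  exact main k le_rfl X₀ hX₀ (fun j hj g => by
    obtain ⟨q1, q2, q3⟩ := hQ j hj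
    exact hV (Or.inl rfl) q1 q2 q3 g)

/-- Infinite injective resolutions, starting with a prescribed finite piece. -/
theorem domdimGE_of_LP {k : ℕ} {Z : ModuleCat.{0} R} (h : LP ProjInj k (reg R) Z) :
    DomdimGE R k := by
  have base : ∀ A : ModuleCat.{0} R, ∃ (Y : ℕ → ModuleCat.{0} R) (g : A →ₗ[R] Y 0)
      (f : ∀ i, Y i →ₗ[R] Y (i+1)), Function.Injective g ∧ Function.Exact g (f 0) ∧
      (∀ i, Function.Exact (f i) (f (i+1))) ∧ (∀ i, Module.Injective R (Y i)) := by
    intro A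
    choose E e hE he using fun A : ModuleCat.{0} R => exists_inj_embedding A
    let N : ℕ → ModuleCat.{0} R := fun n =>
      Nat.rec (motive := fun _ => ModuleCat.{0} R) A (fun _ M => ModuleCat.of R (E M ⧸ LinearMap.range (e M))) n
    let q : ∀ n, (E (N n) : ModuleCat.{0} R) →ₗ[R] (N (n+1) : ModuleCat.{0} R) :=
      fun n => (LinearMap.range (e (N n))).mkQ
    have hs : ∀ n, IsSES (e (N n)) (q n) := fun n => isSES_coker _ (he _)
    have hex : ∀ n, Function.Exact (e (N n)) (e (N (n+1)) ∘ₗ q n) := by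
      intro n x
      rw [← (hs n).exact x]
      exact map_eq_zero_iff _ (he _)
    refine ⟨fun n => E (N n), e A, fun n => e (N (n+1)) ∘ₗ q n, he A, hex 0, fun n => ?_,
      fun n => hE _⟩
    intro x
    rw [hex (n+1) x]
    constructor
    · rintro ⟨y, rfl⟩
      obtain ⟨z, rfl⟩ := (hs n).surj y
      exact ⟨z, rfl⟩
    · rintro ⟨y, rfl⟩
      exact ⟨q n y, rfl⟩
  have main : ∀ (k : ℕ) (A Z : ModuleCat.{0} R), LP ProjInj k A Z →
      ∃ (Y : ℕ → ModuleCat.{0} R) (g : A →ₗ[R] Y 0)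
      (f : ∀ i, Y i →ₗ[R] Y (i+1)), Function.Injective g ∧ Function.Exact g (f 0) ∧
      (∀ i, Function.Exact (f i) (f (i+1))) ∧ (∀ i, Module.Injective R (Y i)) ∧
      (∀ i, i < k → Module.Projective R (Y i)) := by
    intro k
    induction k with
    | zero =>
      intro A Z _
      obtain ⟨Y, g, f, h1, h2, h3, h4⟩ := base A
      exact ⟨Y, g, f, h1, h2, h3, h4, fun i hi => by omega⟩
    | succ k ih =>
      rintro A Z ⟨X, N, i, p, hX, hs, hN⟩
      obtain ⟨Y, g, f, h1, h2, h3, h4, h5⟩ := ih N Z hN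
      let Y' : ℕ → ModuleCat.{0} R := fun n => match n with
        | 0 => X
        | (m+1) => Y m
      let f' : ∀ i, Y' i →ₗ[R] Y' (i+1) := fun n => match n with
        | 0 => g ∘ₗ p
        | (m+1) => f m
      refine ⟨Y', i, f', hs.inj, ?_, ?_, ?_, ?_⟩
      · intro x
        rw [← hs.exact x]
        exact map_eq_zero_iff g h1
      · intro j
        match j with
        | 0 =>
          intro x
          refine (h2 x).trans ?_
          constructor
          · rintro ⟨y, rfl⟩
            obtain ⟨z, rfl⟩ := hs.surj y
            exact ⟨z, rfl⟩
          · rintro ⟨y, rfl⟩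
            exact ⟨p y, rfl⟩
        | (m+1) => exact h3 m
      · intro j
        match j with
        | 0 => exact hX.2
        | (m+1) => exact h4 m
      · intro j hj
        match j with
        | 0 => exact hX.1
        | (m+1) => exact h5 m (by omega)
  exact main k _ Z h

end LemmaE
end PS

namespace PS

/-- Additive functors between module categories, in terms of linear maps. -/
structure AddFun (R S : Type) [Ring R] [Ring S] where
  obj : ModuleCat.{0} R → ModuleCat.{0} S
  map : ∀ {X Y : ModuleCat.{0} R}, (X →ₗ[R] Y) → (obj X →ₗ[S] obj Y)
  map_id : ∀ X : ModuleCat.{0} R, map (LinearMap.id (R := R) (M := X)) = LinearMap.id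
  map_comp : ∀ {X Y Z : ModuleCat.{0} R} (f : X →ₗ[R] Y) (g : Y →ₗ[R] Z),
    map (g ∘ₗ f) = map g ∘ₗ map f
  map_add : ∀ {X Y : ModuleCat.{0} R} (f g : X →ₗ[R] Y), map (f + g) = map f + map g

namespace AddFun
variable {R S : Type} [Ring R] [Ring S] (F : AddFun R S)

/-- the action on Hom groups -/
def hom (X Y : ModuleCat.{0} R) : (X →ₗ[R] Y) →+ (F.obj X →ₗ[S] F.obj Y) :=
  AddMonoidHom.mk' F.map F.map_add

theorem map_zero (X Y : ModuleCat.{0} R) : F.map (0 : X →ₗ[R] Y) = 0 := (F.hom X Y).map_zero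

theorem map_sum {X Y : ModuleCat.{0} R} {α : Type*} [Fintype α] (f : α → (X →ₗ[R] Y)) :
    F.map (∑ a, f a) = ∑ a, F.map (f a) := by
  have := _root_.map_sum (F.hom X Y) f Finset.univ
  exact this

theorem isSummand {X Y : ModuleCat.{0} R} (h : IsSummand X Y) : IsSummand (F.obj X) (F.obj Y) := by
  obtain ⟨a, b, hab⟩ := h
  exact ⟨F.map a, F.map b, by rw [← F.map_comp, hab, F.map_id]⟩

theorem memAdd {X Y : ModuleCat.{0} R} (h : MemAdd X Y) : MemAdd (F.obj X) (F.obj Y) := by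
  obtain ⟨n, a, b, hab⟩ := memAdd_iff.mp h
  refine memAdd_of (fun j => F.map (a j)) (fun j => F.map (b j)) fun m => ?_
  have e : ∑ j, b j ∘ₗ a j = LinearMap.id := by
    ext x
    simpa [LinearMap.sum_apply] using hab x
  have e2 := congrArg F.map e
  rw [F.map_sum, F.map_id] at e2
  have := LinearMap.congr_fun e2 m
  simpa only [LinearMap.sum_apply, F.map_comp, LinearMap.comp_apply, LinearMap.id_apply] using this

/-- image of an isomorphism -/
def equiv {X Y : ModuleCat.{0} R} (e : X ≃ₗ[R] Y) : F.obj X ≃ₗ[S] F.obj Y :=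
  LinearEquiv.ofLinear (F.map e.toLinearMap) (F.map e.symm.toLinearMap)
    (by rw [← F.map_comp, LinearEquiv.comp_symm, F.map_id])
    (by rw [← F.map_comp, LinearEquiv.symm_comp, F.map_id])

/-- full and faithful at the pair `(X, Y)` -/
def FF (X Y : ModuleCat.{0} R) : Prop := Function.Bijective (F.hom X Y)

theorem FF.inj {F : AddFun R S} {X Y : ModuleCat.{0} R} (h : F.FF X Y) {f g : X →ₗ[R] Y}
    (e : F.map f = F.map g) : f = g := h.1 e

theorem FF.surj {F : AddFun R S} {X Y : ModuleCat.{0} R} (h : F.FF X Y)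
    (g : F.obj X →ₗ[S] F.obj Y) : ∃ f : X →ₗ[R] Y, F.map f = g := h.2 g

theorem FF.of_memAdd {F : AddFun R S} {X Y X' Y' : ModuleCat.{0} R} (h : F.FF X Y)
    (hX : MemAdd X X') (hY : MemAdd Y Y') : F.FF X' Y' := by
  obtain ⟨n, a, b, hab⟩ := memAdd_iff.mp hX
  obtain ⟨m, c, d, hcd⟩ := memAdd_iff.mp hY
  have e1 : ∑ j, b j ∘ₗ a j = LinearMap.id := by
    ext x
    simpa [LinearMap.sum_apply] using hab x
  have e2 : ∑ j, d j ∘ₗ c j = LinearMap.id := by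
    ext x
    simpa [LinearMap.sum_apply] using hcd x
  have e1' : ∑ j, F.map (b j) ∘ₗ F.map (a j) = LinearMap.id := by
    have := congrArg F.map e1
    rwa [F.map_sum, F.map_id, Finset.sum_congr rfl (fun j _ => F.map_comp (a j) (b j))] at this
  have e2' : ∑ j, F.map (d j) ∘ₗ F.map (c j) = LinearMap.id := by
    have := congrArg F.map e2
    rwa [F.map_sum, F.map_id, Finset.sum_congr rfl (fun j _ => F.map_comp (c j) (d j))] at this
  constructor
  · rw [injective_iff_map_eq_zero]
    intro f hf
    have h0 : ∀ i j, c j ∘ₗ f ∘ₗ b i = 0 := by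
      intro i j
      apply h.inj
      rw [F.map_comp, F.map_comp, F.map_zero]
      have : F.map f = 0 := hf
      rw [this]; simp
    ext x
    rw [← hab x, _root_.map_sum]
    refine Finset.sum_eq_zero fun i _ => ?_
    rw [← hcd (f (b i (a i x)))]
    refine Finset.sum_eq_zero fun j _ => ?_
    have := LinearMap.congr_fun (h0 i j) (a i x)
    simp only [LinearMap.comp_apply, LinearMap.zero_apply] at this
    rw [this, _root_.map_zero]
  · intro g
    choose q hq using fun (i : Fin n) (j : Fin m) => h.surj (F.map (c j) ∘ₗ g ∘ₗ F.map (b i))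
    refine ⟨∑ i, ∑ j, d j ∘ₗ q i j ∘ₗ a i, ?_⟩
    have hh : ∀ f, F.hom X' Y' f = F.map f := fun f => rfl
    rw [hh, F.map_sum]
    simp only [F.map_sum, F.map_comp, hq]
    ext x
    have f1 := fun y => LinearMap.congr_fun e1' y
    have f2 := fun y => LinearMap.congr_fun e2' y
    simp only [LinearMap.sum_apply, LinearMap.comp_apply, LinearMap.id_apply] at f1 f2 ⊢
    simp only [f2, ← _root_.map_sum, f1]

/-- image of a sequence, moving left to right -/
theorem _root_.PS.LP.mapL {PP : ModuleCat.{0} R → Prop} {PP' : ModuleCat.{0} S → Prop}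
    (good : ModuleCat.{0} R → Prop) {n : ℕ} {A Z : ModuleCat.{0} R} (h : LP PP n A Z)
    (hA : good A)
    (hstep : ∀ (A X N : ModuleCat.{0} R) (i : A →ₗ[R] X) (p : X →ₗ[R] N), PP X → IsSES i p →
      good A → good N ∧ IsSES (F.map i) (F.map p))
    (hP : ∀ X, PP X → PP' (F.obj X)) : LP PP' n (F.obj A) (F.obj Z) := by
  induction n generalizing A with
  | zero => obtain ⟨e⟩ := h; exact ⟨F.equiv e⟩
  | succ n ih =>
    obtain ⟨X, N, i, p, hX, hs, hN⟩ := h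
    obtain ⟨h1, h2⟩ := hstep _ _ _ i p hX hs hA
    exact ⟨_, _, _, _, hP X hX, h2, ih hN h1⟩

/-- image of a sequence, moving right to left -/
theorem _root_.PS.LP.mapR {PP : ModuleCat.{0} R → Prop} {PP' : ModuleCat.{0} S → Prop}
    (good : ModuleCat.{0} R → Prop) {n : ℕ} {A Z : ModuleCat.{0} R} (h : LP PP n A Z)
    (hZ : good Z)
    (hstep : ∀ (N X Z : ModuleCat.{0} R) (i : N →ₗ[R] X) (p : X →ₗ[R] Z), PP X → IsSES i p →
      good Z → good N ∧ IsSES (F.map i) (F.map p))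
    (hP : ∀ X, PP X → PP' (F.obj X)) : LP PP' n (F.obj A) (F.obj Z) := by
  induction n generalizing Z with
  | zero => obtain ⟨e⟩ := h; exact ⟨F.equiv e⟩
  | succ n ih =>
    obtain ⟨X, N, i, p, hX, hs, hN⟩ := h.peel
    obtain ⟨h1, h2⟩ := hstep _ _ _ i p hX hs hZ
    exact (ih hN h1).append (hP X hX) h2

variable {F}

theorem stepA {A X N W : ModuleCat.{0} R} {i : A →ₗ[R] X} {p : X →ₗ[R] N} (hs : IsSES i p)
    (hF : IsSES (F.map i) (F.map p)) (hW : Inj W) (hX : F.FF X W) (hA : F.FF A W)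
    (vX : ExtVanishing (F.obj X) (F.obj W)) (vA : ExtVanishing (F.obj A) (F.obj W)) :
    F.FF N W ∧ ExtVanishing (F.obj N) (F.obj W) := by
  refine ⟨⟨?_, ?_⟩, ?_⟩
  · rw [injective_iff_map_eq_zero]
    intro f hf
    have h0 : f ∘ₗ p = 0 := by
      apply hX.inj
      rw [F.map_comp, F.map_zero, show F.map f = 0 from hf, LinearMap.zero_comp]
    ext y
    obtain ⟨x, rfl⟩ := hs.surj y
    exact LinearMap.congr_fun h0 x
  · intro g
    obtain ⟨h, hh⟩ := hX.surj (g ∘ₗ F.map p)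
    have h0 : h ∘ₗ i = 0 := by
      apply hA.inj
      rw [F.map_comp, F.map_zero, hh]
      ext x
      simp [hF.exact.apply_apply_eq_zero]
    obtain ⟨f, hf⟩ := hs.factor_right h h0
    refine ⟨f, ?_⟩
    show F.map f = g
    ext y
    obtain ⟨x, rfl⟩ := hF.surj y
    have := LinearMap.congr_fun hh x
    rw [← hf, F.map_comp] at this
    exact this
  · refine extVanishing_of_extend vX vA hF fun g => ?_
    obtain ⟨f, rfl⟩ := hA.surj g
    obtain ⟨f', hf'⟩ := hW.out i hs.inj f
    refine ⟨F.map f', ?_⟩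
    rw [← F.map_comp]
    congr 1
    exact LinearMap.ext hf'

theorem stepB {N X Z W : ModuleCat.{0} R} {i : N →ₗ[R] X} {p : X →ₗ[R] Z} (hs : IsSES i p)
    (hF : IsSES (F.map i) (F.map p)) (hW : Proj W) (hX : F.FF W X) (hZ : F.FF W Z)
    (vX : ExtVanishing (F.obj W) (F.obj X)) (vZ : ExtVanishing (F.obj W) (F.obj Z)) :
    F.FF W N ∧ ExtVanishing (F.obj W) (F.obj N) := by
  refine ⟨⟨?_, ?_⟩, ?_⟩
  · rw [injective_iff_map_eq_zero]
    intro f hf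
    have h0 : i ∘ₗ f = 0 := by
      apply hX.inj
      rw [F.map_comp, F.map_zero, show F.map f = 0 from hf, LinearMap.comp_zero]
    ext y
    exact hs.inj ((LinearMap.congr_fun h0 y).trans (_root_.map_zero i).symm)
  · intro g
    obtain ⟨h, hh⟩ := hX.surj (F.map i ∘ₗ g)
    have h0 : p ∘ₗ h = 0 := by
      apply hZ.inj
      rw [F.map_comp, F.map_zero, hh]
      ext x
      simp [hF.exact.apply_apply_eq_zero]
    obtain ⟨f, hf⟩ := hs.factor_left h h0
    refine ⟨f, ?_⟩
    show F.map f = g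
    ext y
    apply hF.inj
    have := LinearMap.congr_fun hh y
    rw [← hf, F.map_comp] at this
    exact this
  · refine extVanishing_of_lift vX vZ hF fun g => ?_
    obtain ⟨f, rfl⟩ := hZ.surj g
    have : Module.Projective R W := hW
    obtain ⟨f', hf'⟩ := Module.projective_lifting_property p f hs.surj
    exact ⟨F.map f', by rw [← F.map_comp, hf']⟩

end AddFun
end PS

namespace PS
section
attribute [local instance] kMod kMod_smulCommClass kMod_end_smulCommClass

variable (K : Type) [Field K] {R : Type} [Ring R] [Algebra K R]

theorem kMod_smul_def (M : ModuleCat.{0} R) (c : K) (m : M) : c • m = algebraMap K R c • m := rfl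

instance kMod_tower (M : ModuleCat.{0} R) : IsScalarTower K R M :=
  ⟨fun c r m => by rw [kMod_smul_def, ← mul_smul, Algebra.smul_def]⟩

/-- restriction of scalars of a linear map -/
def kLin {X Y : ModuleCat.{0} R} (f : X →ₗ[R] Y) : X →ₗ[K] Y where
  toFun := f
  map_add' := f.map_add
  map_smul' c x := f.map_smul (algebraMap K R c) x

@[simp] theorem kLin_apply {X Y : ModuleCat.{0} R} (f : X →ₗ[R] Y) (x : X) :
    kLin K f x = f x := rfl

theorem kfinite [FiniteDimensional K R] (M : ModuleCat.{0} R) (h : Module.Finite R M) :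
    Module.Finite K M :=
  Module.Finite.trans R M

theorem finite_of_kfinite (M : ModuleCat.{0} R) (h : Module.Finite K M) : Module.Finite R M :=
  Module.Finite.of_restrictScalars_finite K R M

variable (R) in
/-- elements of `Dreg` are functionals -/
def drEq : Dreg K R ≃+ (R →ₗ[K] K) := AddEquiv.refl _

theorem drEq_smul (r : R) (φ : Dreg K R) (x : R) : drEq K R (r • φ) x = drEq K R φ (x * r) := rfl

theorem dreg_ext {φ ψ : Dreg K R} (h : ∀ x, drEq K R φ x = drEq K R ψ x) : φ = ψ :=
  (drEq K R).injective (LinearMap.ext h)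

/-- the adjunction `Hom_R(X, DR) = D X` -/
def homDreg (X : ModuleCat.{0} R) : (X →ₗ[R] Dreg K R) ≃+ (X →ₗ[K] K) where
  toFun f :=
    { toFun := fun x => drEq K R (f x) 1
      map_add' := fun x y => by simp
      map_smul' := fun c x => by
        rw [kMod_smul_def, map_smul, drEq_smul, one_mul, RingHom.id_apply,
          show algebraMap K R c = c • (1 : R) from Algebra.algebraMap_eq_smul_one c, map_smul] }
  invFun g :=
    { toFun := fun x => (drEq K R).symm
        { toFun := fun r => g (r • x)
          map_add' := fun r s => by rw [add_smul, map_add]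
          map_smul' := fun c r => by rw [smul_assoc, map_smul, RingHom.id_apply] }
      map_add' := fun x y => by
        apply dreg_ext; intro r
        show g (r • (x + y)) = g (r • x) + g (r • y)
        rw [smul_add, map_add]
      map_smul' := fun s x => by
        apply dreg_ext; intro r
        show g (r • s • x) = g ((r * s) • x)
        rw [mul_smul] }
  left_inv f := by
    refine LinearMap.ext fun x => dreg_ext K fun r => ?_
    show drEq K R (f (r • x)) 1 = _
    rw [map_smul, drEq_smul, one_mul]
  right_inv g := by
    refine LinearMap.ext fun x => ?_
    show g ((1 : R) • x) = g x
    rw [one_smul]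
  map_add' f g := rfl

theorem homDreg_apply (X : ModuleCat.{0} R) (f : X →ₗ[R] Dreg K R) (x : X) :
    homDreg K X f x = drEq K R (f x) 1 := rfl

theorem homDreg_symm_apply (X : ModuleCat.{0} R) (g : X →ₗ[K] K) (x : X) (r : R) :
    drEq K R ((homDreg K X).symm g x) r = g (r • x) := rfl

theorem dreg_extend {X Y : ModuleCat.{0} R} (f : X →ₗ[R] Y) (hf : Function.Injective f)
    (g : X →ₗ[R] Dreg K R) : ∃ h : Y →ₗ[R] Dreg K R, ∀ x, h (f x) = g x := by
  obtain ⟨l, hl⟩ := (kLin K f).exists_leftInverse_of_injective (LinearMap.ker_eq_bot.mpr hf)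
  refine ⟨(homDreg K Y).symm (homDreg K X g ∘ₗ l), fun x => ?_⟩
  apply dreg_ext
  intro r
  have h2 : ∀ x, l (f x) = x := fun x => LinearMap.congr_fun hl x
  rw [homDreg_symm_apply, ← map_smul, LinearMap.comp_apply, h2, homDreg_apply, map_smul,
    drEq_smul, one_mul]

theorem dreg_injective : Inj (Dreg K R) := by
  constructor
  intro X Y _ _ _ _ f hf g
  exact dreg_extend K (X := ModuleCat.of R X) (Y := ModuleCat.of R Y) f hf g

theorem dreg_cogen [FiniteDimensional K R] (X : ModuleCat.{0} R) (hX : Module.Finite R X) :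
    ∃ (m : ℕ) (f : X →ₗ[R] (Fin m → Dreg K R)), Function.Injective f := by
  have := kfinite K X hX
  let b := Module.finBasis K X
  refine ⟨_, LinearMap.pi fun i => (homDreg K X).symm (b.coord i), ?_⟩
  rw [injective_iff_map_eq_zero]
  intro x hx
  apply b.ext_elem
  intro i
  have h1 : (homDreg K X).symm (b.coord i) x = 0 := congrFun hx i
  have h2 := homDreg_symm_apply K X (b.coord i) x 1
  rw [h1, one_smul] at h2
  simpa using h2.symm

theorem dreg_finite [FiniteDimensional K R] : Module.Finite R (Dreg K R) := by
  apply finite_of_kfinite K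
  let e : (R →ₗ[K] K) ≃ₗ[K] Dreg K R :=
    { (drEq K R).symm with
      map_smul' := fun c φ => by
        apply dreg_ext; intro r
        show c • φ r = φ (r * algebraMap K R c)
        rw [← Algebra.commutes, ← Algebra.smul_def, map_smul] }
  exact Module.Finite.equiv e

theorem memAdd_dreg [FiniteDimensional K R] {X : ModuleCat.{0} R} (hX : Module.Finite R X)
    (hi : Inj X) : MemAdd (Dreg K R) X := by
  obtain ⟨m, f, hf⟩ := dreg_cogen K X hX
  exact ⟨m, isSummand_of_injective hi (N := ModuleCat.of R (Fin m → Dreg K R)) f hf⟩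

end
end PS

namespace PS
noncomputable section
attribute [local instance] kMod kMod_smulCommClass kMod_end_smulCommClass

variable (K : Type) [Field K] {R : Type} [Ring R] [Algebra K R]
variable {S : Type} [Ring S]

/-- compatibility of a ring isomorphism with the field actions -/
def Compat [Algebra K S] {C : ModuleCat.{0} R} (σ : S ≃+* (Module.End R C)ᵐᵒᵖ) : Prop :=
  ∀ (c : K) (x : C), (σ (algebraMap K S c)).unop x = algebraMap K R c • x

section
variable {R : Type} [Ring R] {S : Type} [Ring S]
variable {C : ModuleCat.{0} R} (σ : S ≃+* (Module.End R C)ᵐᵒᵖ)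

/-- the functor `Hom_R(C, -)` -/
def homF : AddFun R S where
  obj X := (ModuleCat.restrictScalars σ.toRingHom).obj (homTX C X)
  map {X Y} f :=
    { toFun := fun (φ : C →ₗ[R] X) => (f ∘ₗ φ : C →ₗ[R] Y)
      map_add' := fun φ ψ => LinearMap.comp_add φ ψ f
      map_smul' := fun s φ => rfl }
  map_id X := rfl
  map_comp f g := rfl
  map_add f g := rfl

/-- elements of `Hom_R(C,X)` -/
def hEq (X : ModuleCat.{0} R) : (homF σ).obj X ≃+ (C →ₗ[R] X) := AddEquiv.refl _

theorem hEq_smul (X : ModuleCat.{0} R) (s : S) (φ : (homF σ).obj X) :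
    hEq σ X (s • φ) = hEq σ X φ ∘ₗ (σ s).unop := rfl

theorem hEq_map {X Y : ModuleCat.{0} R} (f : X →ₗ[R] Y) (φ : (homF σ).obj X) :
    hEq σ Y ((homF σ).map f φ) = f ∘ₗ hEq σ X φ := rfl

theorem hEq_ext {X : ModuleCat.{0} R} {φ ψ : (homF σ).obj X}
    (h : ∀ x, hEq σ X φ x = hEq σ X ψ x) : φ = ψ := (hEq σ X).injective (LinearMap.ext h)

/-- `Hom_R(C, C)` is the regular module -/
def homF_reg : (homF σ).obj C ≃ₗ[S] reg S where
  toFun φ := σ.symm (MulOpposite.op (hEq σ C φ))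
  invFun s := (hEq σ C).symm (σ s).unop
  map_add' φ ψ := by
    have : MulOpposite.op (hEq σ C (φ + ψ)) = 
      (MulOpposite.op (hEq σ C φ) + MulOpposite.op (hEq σ C ψ) : (Module.End R C)ᵐᵒᵖ) := rfl
    rw [this]
    exact _root_.map_add σ.symm _ _
  map_smul' s φ := by
    have : MulOpposite.op (hEq σ C (s • φ)) = 
      (σ s * MulOpposite.op (hEq σ C φ) : (Module.End R C)ᵐᵒᵖ) := rfl
    rw [this, RingHom.id_apply]
    refine (_root_.map_mul σ.symm _ _).trans ?_
    rw [σ.symm_apply_apply]; rfl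
  left_inv φ := by
    show (hEq σ C).symm (σ (σ.symm (MulOpposite.op (hEq σ C φ)))).unop = φ
    rw [σ.apply_symm_apply]; rfl
  right_inv s := by
    exact σ.symm_apply_apply s

theorem homF_ff (W : ModuleCat.{0} R) : (homF σ).FF C W := by
  constructor
  · intro f g hfg
    have h1 : (homF σ).map f ((hEq σ C).symm LinearMap.id) =
      (homF σ).map g ((hEq σ C).symm LinearMap.id) := LinearMap.congr_fun hfg _
    exact h1
  · intro G
    refine ⟨hEq σ W (G ((hEq σ C).symm LinearMap.id)), ?_⟩
    show (homF σ).map _ = G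
    refine LinearMap.ext fun φ => ?_
    have : φ = (σ.symm (MulOpposite.op (hEq σ C φ))) • ((hEq σ C).symm LinearMap.id) := by
      apply hEq_ext; intro x
      rw [hEq_smul, σ.apply_symm_apply]; rfl
    rw [this, map_smul, map_smul]
    rfl

theorem homF_ses {A X Z : ModuleCat.{0} R} {i : A →ₗ[R] X} {p : X →ₗ[R] Z} (hs : IsSES i p)
    (hv : ExtVanishing C A) : IsSES ((homF σ).map i) ((homF σ).map p) := by
  refine ⟨?_, ?_, ?_⟩
  · intro φ ψ h
    apply hEq_ext; intro x
    apply hs.inj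
    exact LinearMap.congr_fun h x
  · intro φ
    constructor
    · intro h
      obtain ⟨f, hf⟩ := hs.factor_left (hEq σ X φ) h
      exact ⟨(hEq σ A).symm f, hf⟩
    · rintro ⟨ψ, rfl⟩
      apply hEq_ext; intro x
      exact hs.exact.apply_apply_eq_zero _
  · intro φ
    obtain ⟨f, hf⟩ := hv.lift hs (hEq σ Z φ)
    exact ⟨(hEq σ X).symm f, hf⟩
end

variable {C : ModuleCat.{0} R} (σ : S ≃+* (Module.End R C)ᵐᵒᵖ)

/-- elements of `D C` -/
def dtEq (C : ModuleCat.{0} R) (σ : S ≃+* (Module.End R C)ᵐᵒᵖ) :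
    (ModuleCat.restrictScalars σ.toRingHom).obj (DT K C) ≃+ (C →ₗ[K] K) := AddEquiv.refl _

theorem dtEq_smul (s : S) (φ : (ModuleCat.restrictScalars σ.toRingHom).obj (DT K C)) (x : C) :
    dtEq K C σ (s • φ) x = dtEq K C σ φ ((σ s).unop x) := rfl

/-- `Hom_R(C, DR) = DC` -/
def homF_dreg : (homF σ).obj (Dreg K R) ≃ₗ[S]
    (ModuleCat.restrictScalars σ.toRingHom).obj (DT K C) :=
  { ((hEq σ (Dreg K R)).trans (homDreg K C)).trans (dtEq K C σ).symm with
    map_smul' := fun s φ => rfl }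

theorem homF_finite [Algebra K S] [FiniteDimensional K R] (hσ : Compat K σ)
    (hC : Module.Finite R C) {X : ModuleCat.{0} R} (hX : Module.Finite R X) :
    Module.Finite S ((homF σ).obj X) := by
  apply finite_of_kfinite K
  have := kfinite K C hC
  have := kfinite K X hX
  let e : (homF σ).obj X →ₗ[K] (C →ₗ[K] X) :=
    { toFun := fun φ => kLin K (hEq σ X φ)
      map_add' := fun φ ψ => rfl
      map_smul' := fun c φ => by
        refine LinearMap.ext fun x => ?_
        show hEq σ X (algebraMap K S c • φ) x = algebraMap K R c • hEq σ X φ x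
        rw [hEq_smul, LinearMap.comp_apply, hσ, map_smul] }
  refine Module.Finite.of_injective e ?_
  intro φ ψ h
  exact hEq_ext σ fun x => LinearMap.congr_fun h x

end
end PS

namespace PS
noncomputable section
attribute [local instance] kMod kMod_smulCommClass kMod_end_smulCommClass

variable (K : Type) [Field K] {R : Type} [Ring R] [Algebra K R]
variable {S : Type} [Ring S]

/-- precomposition -/
def preK {X Y : ModuleCat.{0} R} (T : ModuleCat.{0} R) (f : X →ₗ[R] Y) :
    (Y →ₗ[R] T) →ₗ[K] (X →ₗ[R] T) where
  toFun q := q ∘ₗ f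
  map_add' _ _ := rfl
  map_smul' _ _ := rfl

theorem homfinite [FiniteDimensional K R] {X T : ModuleCat.{0} R} (hX : Module.Finite R X)
    (hT : Module.Finite R T) : Module.Finite K (X →ₗ[R] T) := by
  have := kfinite K X hX
  have := kfinite K T hT
  let e : (X →ₗ[R] T) →ₗ[K] (X →ₗ[K] T) :=
    { toFun := fun φ => kLin K φ
      map_add' := fun _ _ => rfl
      map_smul' := fun _ _ => rfl }
  refine Module.Finite.of_injective e ?_
  intro φ ψ h
  exact LinearMap.ext fun x => LinearMap.congr_fun h x

variable {T : ModuleCat.{0} R} (σ : S ≃+* (Module.End R T)ᵐᵒᵖ)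

/-- the functor `D Hom_R(-, T)` -/
def HF : AddFun R S where
  obj X := (ModuleCat.restrictScalars σ.toRingHom).obj (Ihom K X T)
  map {X Y} f :=
    { toFun := fun (φ : (X →ₗ[R] T) →ₗ[K] K) => (φ ∘ₗ preK K T f : (Y →ₗ[R] T) →ₗ[K] K)
      map_add' := fun _ _ => rfl
      map_smul' := fun _ _ => rfl }
  map_id _ := rfl
  map_comp _ _ := rfl
  map_add f g := by
    refine LinearMap.ext fun φ => ?_
    exact LinearMap.ext (f := ((φ : (_ →ₗ[R] T) →ₗ[K] K) ∘ₗ preK K T (f + g)))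
      (g := (φ : (_ →ₗ[R] T) →ₗ[K] K) ∘ₗ preK K T f + (φ : (_ →ₗ[R] T) →ₗ[K] K) ∘ₗ preK K T g)
      fun q => (congrArg (fun y => DFunLike.coe (F := (_ →ₗ[R] T) →ₗ[K] K) φ y)
        (LinearMap.comp_add f g q)).trans
        (LinearMap.map_add (φ : (_ →ₗ[R] T) →ₗ[K] K) (q ∘ₗ f) (q ∘ₗ g))

/-- elements of `D Hom_R(X, T)` -/
def HEq (X : ModuleCat.{0} R) : (HF K σ).obj X ≃+ ((X →ₗ[R] T) →ₗ[K] K) := AddEquiv.refl _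

theorem HEq_smul (X : ModuleCat.{0} R) (s : S) (φ : (HF K σ).obj X) (q : X →ₗ[R] T) :
    HEq K σ X (s • φ) q = HEq K σ X φ ((σ s).unop ∘ₗ q) := rfl

theorem HEq_map {X Y : ModuleCat.{0} R} (f : X →ₗ[R] Y) (φ : (HF K σ).obj X) (q : Y →ₗ[R] T) :
    HEq K σ Y ((HF K σ).map f φ) q = HEq K σ X φ (q ∘ₗ f) := rfl

theorem HEq_ext {X : ModuleCat.{0} R} {φ ψ : (HF K σ).obj X}
    (h : ∀ x, HEq K σ X φ x = HEq K σ X ψ x) : φ = ψ := (HEq K σ X).injective (LinearMap.ext h)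

theorem HF_ses {A X Z : ModuleCat.{0} R} {i : A →ₗ[R] X} {p : X →ₗ[R] Z} (hs : IsSES i p)
    (hv : ExtVanishing Z T) : IsSES ((HF K σ).map i) ((HF K σ).map p) := by
  have hsur : Function.Surjective (preK K T i) := fun q => hv.extend hs q
  have hinj : Function.Injective (preK K T p) := by
    intro q q' h
    refine LinearMap.ext fun z => ?_
    obtain ⟨x, rfl⟩ := hs.surj z
    exact LinearMap.congr_fun h x
  have hex : ∀ q, preK K T i q = 0 → ∃ q', preK K T p q' = q := fun q h => hs.factor_right q h
  refine ⟨?_, ?_, ?_⟩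
  · intro φ ψ h
    apply HEq_ext; intro q
    obtain ⟨q', rfl⟩ := hsur q
    have := congrArg (HEq K σ X) h
    exact LinearMap.congr_fun this q'
  · intro φ
    constructor
    · intro h
      obtain ⟨l, hl⟩ := (preK K T i).exists_rightInverse_of_surjective
        (LinearMap.range_eq_top.mpr hsur)
      refine ⟨(HEq K σ A).symm (HEq K σ X φ ∘ₗ l), ?_⟩
      apply HEq_ext; intro q
      show HEq K σ X φ (l (preK K T i q)) = HEq K σ X φ q
      rw [← sub_eq_zero, ← _root_.map_sub]
      obtain ⟨q', hq'⟩ := hex (l (preK K T i q) - q) (by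
        rw [_root_.map_sub, sub_eq_zero]; exact LinearMap.congr_fun hl (preK K T i q))
      rw [← hq']
      have := congrArg (HEq K σ Z) h
      exact LinearMap.congr_fun this q'
    · rintro ⟨ψ, rfl⟩
      apply HEq_ext; intro q
      rw [HEq_map, HEq_map]
      have : (q ∘ₗ p) ∘ₗ i = 0 := by
        refine LinearMap.ext fun a => ?_
        simp [hs.exact.apply_apply_eq_zero]
      rw [this, _root_.map_zero, _root_.map_zero]; rfl
  · intro φ
    obtain ⟨l, hl⟩ := (preK K T p).exists_leftInverse_of_injective
      (LinearMap.ker_eq_bot.mpr hinj)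
    refine ⟨(HEq K σ X).symm (HEq K σ Z φ ∘ₗ l), ?_⟩
    apply HEq_ext; intro q
    show HEq K σ Z φ (l (preK K T p q)) = HEq K σ Z φ q
    exact congrArg _ (LinearMap.congr_fun hl q)

/-- `Hom_R(R, T) = T` -/
def regHom (T : ModuleCat.{0} R) : (reg R →ₗ[R] T) ≃ₗ[K] T where
  toFun q := q (1 : R)
  invFun t := LinearMap.toSpanSingleton R T t
  map_add' _ _ := rfl
  map_smul' _ _ := rfl
  left_inv q := by
    refine LinearMap.ext fun r => ?_
    exact (q.map_smul (r : R) (1 : R)).symm.trans (congrArg q (mul_one (r : R)))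
  right_inv t := one_smul R t

/-- `D Hom_R(R, T) = DT` -/
def HF_reg : (HF K σ).obj (reg R) ≃ₗ[S]
    (ModuleCat.restrictScalars σ.toRingHom).obj (DT K T) where
  toFun φ := (dtEq K T σ).symm (HEq K σ _ φ ∘ₗ (regHom K T).symm.toLinearMap)
  invFun φ := (HEq K σ _).symm (dtEq K T σ φ ∘ₗ (regHom K T).toLinearMap)
  map_add' _ _ := rfl
  map_smul' s φ := by
    apply (dtEq K T σ).injective
    refine LinearMap.ext fun t => ?_
    show HEq K σ _ φ _ = HEq K σ _ φ _
    congr 1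
    refine LinearMap.ext fun r => ?_
    exact ((σ s).unop.map_smul (id r : R) t)
  left_inv φ := by
    apply HEq_ext; intro q
    exact congrArg (HEq K σ _ φ) ((regHom K T).symm_apply_apply q)
  right_inv φ := by
    apply (dtEq K T σ).injective
    refine LinearMap.ext fun t => ?_
    exact congrArg (dtEq K T σ φ) ((regHom K T).apply_symm_apply t)

variable [Algebra K S]

variable {K σ} in
theorem Compat.symm (hσ : Compat K σ) (c : K) (q : Module.End R T) :
    σ.symm (MulOpposite.op (c • q)) = c • σ.symm (MulOpposite.op q) := by
  rw [σ.symm_apply_eq, Algebra.smul_def, _root_.map_mul, σ.apply_symm_apply]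
  apply MulOpposite.unop_injective
  refine LinearMap.ext fun t => ?_
  show algebraMap K R c • q t = q ((σ (algebraMap K S c)).unop t)
  rw [hσ, _root_.map_smul]

/-- `Hom_R(T,T) = S` as vector spaces -/
def endEq (hσ : Compat K σ) : (T →ₗ[R] T) ≃ₗ[K] S where
  toFun q := σ.symm (MulOpposite.op q)
  invFun s := (σ s).unop
  map_add' q q' := (_root_.map_add σ.symm (MulOpposite.op q) (MulOpposite.op q'))
  map_smul' c q := hσ.symm c q
  left_inv q := congrArg MulOpposite.unop (σ.apply_symm_apply (MulOpposite.op q))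
  right_inv s := σ.symm_apply_apply s

/-- `D Hom_R(T,T) = DS` -/
def HF_T (hσ : Compat K σ) : (HF K σ).obj T ≃ₗ[S] Dreg K S where
  toFun φ := (drEq K S).symm (HEq K σ _ φ ∘ₗ (endEq K σ hσ).symm.toLinearMap)
  invFun φ := (HEq K σ _).symm (drEq K S φ ∘ₗ (endEq K σ hσ).toLinearMap)
  map_add' _ _ := rfl
  map_smul' s φ := by
    apply dreg_ext; intro x
    show HEq K σ _ φ ((σ s).unop ∘ₗ (σ x).unop) = HEq K σ _ φ (σ (x * s)).unop
    rw [_root_.map_mul]; rfl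
  left_inv φ := by
    apply HEq_ext; intro q
    exact congrArg (HEq K σ _ φ) ((endEq K σ hσ).symm_apply_apply q)
  right_inv φ := by
    apply dreg_ext; intro s
    exact congrArg (drEq K S φ) ((endEq K σ hσ).apply_symm_apply s)

/-- `HEq` is linear over the field -/
def HEqK (hσ : Compat K σ) (X : ModuleCat.{0} R) :
    (HF K σ).obj X ≃ₗ[K] ((X →ₗ[R] T) →ₗ[K] K) :=
  { HEq K σ X with
    map_smul' := fun c φ => by
      refine LinearMap.ext fun q => ?_
      show HEq K σ X (algebraMap K S c • φ) q = c • HEq K σ X φ q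
      rw [HEq_smul, ← _root_.map_smul]
      congr 1
      refine LinearMap.ext fun x => hσ c (q x) }

theorem HF_finite [FiniteDimensional K R] (hσ : Compat K σ)
    (hT : Module.Finite R T) {X : ModuleCat.{0} R} (hX : Module.Finite R X) :
    Module.Finite S ((HF K σ).obj X) := by
  apply finite_of_kfinite K
  have := homfinite K hX hT
  exact Module.Finite.equiv (HEqK K σ hσ X).symm

theorem HF_ff [FiniteDimensional K R] (hσ : Compat K σ) (hT : Module.Finite R T)
    {W : ModuleCat.{0} R} (hW : Module.Finite R W) : (HF K σ).FF W T := by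
  have := homfinite K hW hT
  constructor
  · intro f g hfg
    rw [← sub_eq_zero, ← Module.forall_dual_apply_eq_zero_iff K]
    intro φ
    have h1 := LinearMap.congr_fun hfg ((HEq K σ W).symm φ)
    have h2 := LinearMap.congr_fun (congrArg (HEq K σ T) h1) LinearMap.id
    have h3 : φ f = φ g := h2
    rw [_root_.map_sub, h3, sub_self]
  · intro G
    let ev : Module.Dual K (Module.Dual K (W →ₗ[R] T)) :=
      { toFun := fun φ => HEq K σ T (G ((HEqK K σ hσ W).symm φ)) LinearMap.id
        map_add' := fun φ ψ => by
          rw [_root_.map_add, _root_.map_add, _root_.map_add]; rfl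
        map_smul' := fun c φ => by
          rw [_root_.map_smul, kMod_smul_def, _root_.map_smul]
          show HEqK K σ hσ T (c • G ((HEqK K σ hσ W).symm φ)) LinearMap.id = _
          rw [_root_.map_smul]; rfl }
    obtain ⟨f, hf⟩ := (Module.evalEquiv K (W →ₗ[R] T)).surjective ev
    refine ⟨f, ?_⟩
    show (HF K σ).map f = G
    refine LinearMap.ext fun φ => ?_
    apply HEq_ext; intro q
    rw [HEq_map]
    have h1 : HEq K σ T (G (σ.symm (MulOpposite.op q) • φ)) LinearMap.id = 
        HEq K σ T (G φ) q := by
      rw [_root_.map_smul, HEq_smul, σ.apply_symm_apply]; rfl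
    rw [← h1]
    have h2 := LinearMap.congr_fun hf (HEq K σ W (σ.symm (MulOpposite.op q) • φ))
    refine Eq.trans ?_ h2
    show _ = HEq K σ W (σ.symm (MulOpposite.op q) • φ) f
    rw [HEq_smul, σ.apply_symm_apply]; rfl

end
end PS

namespace PS
section
variable (K : Type) [Field K] {R : Type} [Ring R] [Algebra K R] [FiniteDimensional K R]
variable {S : Type} [Ring S] [Algebra K S]

theorem coreA {C I : ModuleCat.{0} R} {k : ℕ} (σ : S ≃+* (Module.End R C)ᵐᵒᵖ)
    (hσ : Compat K σ) (hI : Inj I) (h : IsSpecialCotilting K I k C)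
    (P' : ModuleCat.{0} S)
    (hP' : ∀ X, MemAdd C X → MemAdd I X → MemAdd P' ((homF σ).obj X)) :
    IsSpecialTilting P' k ((homF σ).obj (Dreg K R)) ∧
    (homF σ).FF (Dreg K R) (Dreg K R) ∧
    ∃ Z, LP (fun Y => ∃ X, MemAdd C X ∧ MemAdd I X ∧ Y = (homF σ).obj X) k (reg S) Z := by
  rw [isSpecialCotilting_iff] at h
  obtain ⟨hfin, hid, hv, A, hA, hL⟩ := h
  have hinj : ∀ X, MemAdd C X ∧ MemAdd I X → Inj X := fun X hX => hX.2.injective hI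
  have hPfin : ∀ X, MemAdd C X ∧ MemAdd I X → Module.Finite R X := fun X hX => hX.1.finite
  have hFC : Proj ((homF σ).obj C) := Proj.congr (homF_reg σ).symm (reg_projective)
  have hFadd : ∀ X, MemAdd C X → Proj ((homF σ).obj X) := fun X hX =>
    ((homF σ).memAdd hX).projective hFC
  have good : ∀ {n : ℕ} {A Z : ModuleCat.{0} R},
      LP (fun X => MemAdd C X ∧ MemAdd I X) n A Z → ExtVanishing C A → ExtVanishing C Z := by
    intro n A Z hL hA
    refine hL.inductL (QQ := fun Z => ExtVanishing C Z) hA ?_ ?_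
    · intro A X N i p hX hs hA
      exact hA.coker (extVanishing_of_injective _ _ (hinj X hX)) hs
    · intro A A' e h
      exact MemAdd.extVanishing h (MemAdd.refl C) (memAdd_of_equiv e.symm)
  have vA : ExtVanishing C A := MemAdd.extVanishing hv (MemAdd.refl C) hA
  have hFFD : ExtVanishing C (Dreg K R) ∧ ∀ W, Inj W → (homF σ).FF (Dreg K R) W ∧
      ExtVanishing ((homF σ).obj (Dreg K R)) ((homF σ).obj W) := by
    refine hL.inductL (QQ := fun Z => ExtVanishing C Z ∧ ∀ W, Inj W → (homF σ).FF Z W ∧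
      ExtVanishing ((homF σ).obj Z) ((homF σ).obj W)) ⟨vA, ?_⟩ ?_ ?_
    · intro W _
      exact ⟨(homF_ff σ W).of_memAdd hA (MemAdd.refl W), extVanishing_of_projective _ _ (hFadd A hA)⟩
    · rintro A X N i p hX hs ⟨hA, hA'⟩
      refine ⟨hA.coker (extVanishing_of_injective _ _ (hinj X hX)) hs, fun W hW => ?_⟩
      exact AddFun.stepA hs (homF_ses σ hs hA) hW
        ((homF_ff σ W).of_memAdd hX.1 (MemAdd.refl W)) (hA' W hW).1
        (extVanishing_of_projective _ _ (hFadd X hX.1)) (hA' W hW).2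
    · rintro A A' e ⟨h1, h2⟩
      refine ⟨MemAdd.extVanishing h1 (MemAdd.refl C) (memAdd_of_equiv e.symm), fun W hW => ⟨?_, ?_⟩⟩
      · exact (h2 W hW).1.of_memAdd (memAdd_of_equiv e.symm) (MemAdd.refl W)
      · exact MemAdd.extVanishing (h2 W hW).2 ((homF σ).memAdd (memAdd_of_equiv e.symm))
          (MemAdd.refl _)
  have hDi : Inj (Dreg K R) := dreg_injective K
  have hDf := dreg_finite K (R := R)
  obtain ⟨J, hJf, hJ⟩ := lemmaE (X₀ := C) hL (dreg_cogen K) hinj hPfin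
    (fun X m hX => ⟨hX.1.pow m, hX.2.pow m⟩) hfin (by
      rintro W N X Y i p hW hX hs ⟨m, hm⟩ g
      have hWC : MemAdd C W := by
        rcases hW with rfl | hW
        · exact MemAdd.refl _
        · exact hW.1
      exact (MemAdd.extVanishing (good hm vA) hWC (MemAdd.refl N)).lift hs g)
  have hJi : Inj J := (hJ.mono hinj).idim_iff.mp hid
  have hJD : MemAdd (Dreg K R) J := memAdd_dreg K hJf hJi
  have hstep : ∀ (A X N : ModuleCat.{0} R) (i : A →ₗ[R] X) (p : X →ₗ[R] N),
      MemAdd C X ∧ MemAdd I X → IsSES i p → ExtVanishing C A → ExtVanishing C N ∧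
        IsSES ((homF σ).map i) ((homF σ).map p) := fun A X N i p hX hs hA =>
    ⟨hA.coker (extVanishing_of_injective _ _ (hinj X hX)) hs, homF_ses σ hs hA⟩
  have L1 : LP Proj k ((homF σ).obj A) ((homF σ).obj (Dreg K R)) :=
    hL.mapL (homF σ) (ExtVanishing C) vA hstep (fun X hX => hFadd X hX.1)
  have L2 : LP (fun Y => ∃ X, MemAdd C X ∧ MemAdd I X ∧ Y = (homF σ).obj X) k (reg S)
      ((homF σ).obj J) :=
    (hJ.mapL (homF σ) (ExtVanishing C) hv hstep (fun X hX => ⟨X, hX.1, hX.2, rfl⟩)).congr_left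
      (homF_reg σ).symm
  refine ⟨?_, (hFFD.2 _ hDi).1, _, L2⟩
  rw [isSpecialTilting_iff]
  refine ⟨homF_finite K σ hσ hfin hDf, L1.pdim_iff.mpr (hFadd A hA), (hFFD.2 _ hDi).2,
    _, (homF σ).memAdd hJD, L2.mono ?_⟩
  rintro _ ⟨X, h1, h2, rfl⟩
  exact ⟨(homF σ).memAdd (memAdd_dreg K (hPfin X ⟨h1, h2⟩) (hinj X ⟨h1, h2⟩)), hP' X h1 h2⟩

theorem coreB {T P : ModuleCat.{0} R} {k : ℕ} (σ : S ≃+* (Module.End R T)ᵐᵒᵖ)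
    (hσ : Compat K σ) (hP : Proj P) (h : IsSpecialTilting P k T)
    (I' : ModuleCat.{0} S)
    (hI' : ∀ X, MemAdd T X → MemAdd P X → MemAdd I' ((HF K σ).obj X)) :
    IsSpecialCotilting K I' k ((HF K σ).obj (reg R)) ∧
    (HF K σ).FF (reg R) (reg R) ∧
    ∃ Z, LP (fun Y => ∃ X, MemAdd T X ∧ MemAdd P X ∧ Y = (HF K σ).obj X) k Z (Dreg K S) := by
  have : IsNoetherianRing R := IsNoetherianRing.of_finite K R
  rw [isSpecialTilting_iff] at h
  obtain ⟨hfin, hpd, hv, A, hA, hL⟩ := h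
  have hproj : ∀ X, MemAdd T X ∧ MemAdd P X → Proj X := fun X hX => hX.2.projective hP
  have hPfin : ∀ X, MemAdd T X ∧ MemAdd P X → Module.Finite R X := fun X hX => hX.1.finite
  have hFT : Inj ((HF K σ).obj T) := Inj.congr (HF_T K σ hσ).symm (dreg_injective K)
  have hFadd : ∀ X, MemAdd T X → Inj ((HF K σ).obj X) := fun X hX =>
    ((HF K σ).memAdd hX).injective hFT
  have good : ∀ {n : ℕ} {A Z : ModuleCat.{0} R},
      LP (fun X => MemAdd T X ∧ MemAdd P X) n A Z → ExtVanishing Z T → ExtVanishing A T := by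
    intro n A Z hL hA
    refine hL.inductR (QQ := fun Z => ExtVanishing Z T) hA ?_ ?_
    · intro N X Z i p hX hs hA
      exact hA.ker (extVanishing_of_projective _ _ (hproj X hX)) hs
    · intro A A' e h
      exact MemAdd.extVanishing h (memAdd_of_equiv e.symm) (MemAdd.refl T)
  have vA : ExtVanishing A T := MemAdd.extVanishing hv hA (MemAdd.refl T)
  have hFFD : ExtVanishing (reg R) T ∧ ∀ W, Proj W → Module.Finite R W →
      (HF K σ).FF W (reg R) ∧
      ExtVanishing ((HF K σ).obj W) ((HF K σ).obj (reg R)) := by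
    refine hL.inductR (QQ := fun Z => ExtVanishing Z T ∧ ∀ W, Proj W → Module.Finite R W →
      (HF K σ).FF W Z ∧ ExtVanishing ((HF K σ).obj W) ((HF K σ).obj Z)) ⟨vA, ?_⟩ ?_ ?_
    · intro W _ hW
      exact ⟨(HF_ff K σ hσ hfin hW).of_memAdd (MemAdd.refl W) hA,
        extVanishing_of_injective _ _ (hFadd A hA)⟩
    · rintro N X Z i p hX hs ⟨hA, hA'⟩
      refine ⟨hA.ker (extVanishing_of_projective _ _ (hproj X hX)) hs, fun W hW hW' => ?_⟩
      exact AddFun.stepB hs (HF_ses K σ hs hA) hW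
        ((HF_ff K σ hσ hfin hW').of_memAdd (MemAdd.refl W) hX.1) (hA' W hW hW').1
        (extVanishing_of_injective _ _ (hFadd X hX.1)) (hA' W hW hW').2
    · rintro A A' e ⟨h1, h2⟩
      refine ⟨MemAdd.extVanishing h1 (memAdd_of_equiv e.symm) (MemAdd.refl T),
        fun W hW hW' => ⟨?_, ?_⟩⟩
      · exact (h2 W hW hW').1.of_memAdd (MemAdd.refl W) (memAdd_of_equiv e.symm)
      · exact MemAdd.extVanishing (h2 W hW hW').2 
          (MemAdd.refl _) ((HF K σ).memAdd (memAdd_of_equiv e.symm))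
  have hDi : Proj (reg R) := reg_projective
  have hDf : Module.Finite R (reg R) := Module.Finite.self R
  obtain ⟨J, hJf, hJ⟩ := lemmaE' (X₀ := T) hL (fun X hX => by
      obtain ⟨m, f, hf⟩ := Module.Finite.exists_fin' R X
      exact ⟨m, f, hf⟩) hproj hPfin
    (fun X m hX => ⟨hX.1.pow m, hX.2.pow m⟩) hfin (by
      rintro W N X Y i p hW hX hs ⟨m, hm⟩ g
      have hWC : MemAdd T W := by
        rcases hW with rfl | hW
        · exact MemAdd.refl _
        · exact hW.1
      exact (MemAdd.extVanishing (good hm vA) (MemAdd.refl Y) hWC).extend hs g)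
  have hJi : Proj J := (hJ.mono hproj).pdim_iff.mp hpd
  have := hJf
  have hJD : MemAdd (reg R) J := memAdd_reg_of_projective hJi
  have hstep : ∀ (N X Z : ModuleCat.{0} R) (i : N →ₗ[R] X) (p : X →ₗ[R] Z),
      MemAdd T X ∧ MemAdd P X → IsSES i p → ExtVanishing Z T → ExtVanishing N T ∧
        IsSES ((HF K σ).map i) ((HF K σ).map p) := fun N X Z i p hX hs hA =>
    ⟨hA.ker (extVanishing_of_projective _ _ (hproj X hX)) hs, HF_ses K σ hs hA⟩
  have L1 : LP Inj k ((HF K σ).obj (reg R)) ((HF K σ).obj A) :=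
    hL.mapR (HF K σ) (fun Z => ExtVanishing Z T) vA hstep (fun X hX => hFadd X hX.1)
  have L2 : LP (fun Y => ∃ X, MemAdd T X ∧ MemAdd P X ∧ Y = (HF K σ).obj X) k
      ((HF K σ).obj J) (Dreg K S) :=
    (hJ.mapR (HF K σ) (fun Z => ExtVanishing Z T) hv hstep
      (fun X hX => ⟨X, hX.1, hX.2, rfl⟩)).congr_right (HF_T K σ hσ)
  refine ⟨?_, (hFFD.2 _ hDi hDf).1, _, L2⟩
  rw [isSpecialCotilting_iff]
  refine ⟨HF_finite K σ hσ hfin hDf, L1.idim_iff.mpr (hFadd A hA), (hFFD.2 _ hDi hDf).2,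
    _, (HF K σ).memAdd hJD, L2.mono ?_⟩
  rintro _ ⟨X, h1, h2, rfl⟩
  have := hPfin X ⟨h1, h2⟩
  exact ⟨(HF K σ).memAdd (memAdd_reg_of_projective (hproj X ⟨h1, h2⟩)),
    hI' X h1 h2⟩
end
end PS

namespace PS
noncomputable section

section
variable {R : Type} [Ring R]

theorem IsSpecialCotilting.of_summand {K : Type} [Field K] [Algebra K R] {I C C' : ModuleCat.{0} R}
    {k : ℕ} (h : IsSpecialCotilting K I k C) (h1 : IsSummand C' C) (h2 : MemAdd C' C) :
    IsSpecialCotilting K I k C' := by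
  rw [isSpecialCotilting_iff] at *
  obtain ⟨hf, hd, hv, A, hA, hL⟩ := h
  refine ⟨(h1.memAdd).finite, h1.idim _ hd, MemAdd.extVanishing hv h1.memAdd h1.memAdd, A,
    h2.trans hA, hL.mono fun X hX => ⟨h2.trans hX.1, hX.2⟩⟩

theorem IsSpecialTilting.of_summand {P T T' : ModuleCat.{0} R}
    {k : ℕ} (h : IsSpecialTilting P k T) (h1 : IsSummand T' T) (h2 : MemAdd T' T) :
    IsSpecialTilting P k T' := by
  rw [isSpecialTilting_iff] at *
  obtain ⟨hf, hd, hv, A, hA, hL⟩ := h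
  refine ⟨(h1.memAdd).finite, h1.pdim _ hd, MemAdd.extVanishing hv h1.memAdd h1.memAdd, A,
    h2.trans hA, hL.mono fun X hX => ⟨h2.trans hX.1, hX.2⟩⟩
end

attribute [local instance] kMod kMod_smulCommClass kMod_end_smulCommClass

variable (K : Type) [Field K]

section Nak
variable {B : Type} [Ring B] [Algebra K B]

/-- elements of `ν⁻ I` -/
def niEq (I : ModuleCat.{0} B) : NakayamaInv K B I ≃+ (Dreg K B →ₗ[B] I) := AddEquiv.refl _

/-- right multiplication on `DB` -/
def drR (b : B) (φ : Dreg K B) : Dreg K B :=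
  (drEq K B).symm (drEq K B φ ∘ₗ LinearMap.mulLeft K b)

theorem drR_apply (b : B) (φ : Dreg K B) (x : B) :
    drEq K B (drR K b φ) x = drEq K B φ (b * x) := rfl

theorem niEq_smul (I : ModuleCat.{0} B) (b : B) (f : NakayamaInv K B I) (φ : Dreg K B) :
    niEq K I (b • f) φ = niEq K I f (drR K b φ) := rfl

/-- elements of `ν P` -/
def nkEq (P : ModuleCat.{0} B) : Nakayama K B P ≃+ ((P →ₗ[B] B) →ₗ[K] K) := AddEquiv.refl _

/-- right multiplication on `Hom(P,B)` -/
def hmR {P : ModuleCat.{0} B} (b : B) (g : P →ₗ[B] B) : P →ₗ[B] B where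
  toFun x := g x * b
  map_add' x y := by rw [map_add, add_mul]
  map_smul' s x := by rw [map_smul, smul_eq_mul, smul_eq_mul, mul_assoc]; rfl

theorem nkEq_smul (P : ModuleCat.{0} B) (b : B) (Λ : Nakayama K B P) (g : P →ₗ[B] B) :
    nkEq K P (b • Λ) g = nkEq K P Λ (hmR b g) := rfl

end Nak

variable {R : Type} [Ring R] [Algebra K R] [FiniteDimensional K R]
variable {S : Type} [Ring S] [Algebra K S]

/-- `ν⁻ D Hom(X,T) = Hom(T,X)` for `X` in `add T` -/
theorem nakInv_HF {T X : ModuleCat.{0} R} (σ : S ≃+* (Module.End R T)ᵐᵒᵖ) (hσ : Compat K σ)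
    (hT : Module.Finite R T) (hX : MemAdd T X) :
    Nonempty ((homF σ).obj X ≃ₗ[S] NakayamaInv K S ((HF K σ).obj X)) := by
  have ff : (HF K σ).FF T X := (HF_ff K σ hσ hT hT).of_memAdd (MemAdd.refl T) hX
  let e := HF_T K σ hσ
  let Φ : (homF σ).obj X →ₗ[S] NakayamaInv K S ((HF K σ).obj X) :=
    { toFun := fun g => (niEq K _).symm ((HF K σ).map (hEq σ X g) ∘ₗ e.symm.toLinearMap)
      map_add' := fun g g' => by
        rw [_root_.map_add, (HF K σ).map_add, LinearMap.add_comp]; rfl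
      map_smul' := fun b g => by
        apply (niEq K _).injective
        refine LinearMap.ext fun φ => ?_
        apply HEq_ext; intro q
        rw [RingHom.id_apply, niEq_smul, hEq_smul, (HF K σ).map_comp]
        show HEq K σ T (e.symm φ) ((q ∘ₗ hEq σ X g) ∘ₗ (σ b).unop) =
          HEq K σ T (e.symm (drR K b φ)) (q ∘ₗ hEq σ X g)
        show drEq K S φ (σ.symm (σ b * MulOpposite.op (q ∘ₗ hEq σ X g : Module.End R T))) = 
          drEq K S φ (b * σ.symm (MulOpposite.op (q ∘ₗ hEq σ X g : Module.End R T)))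
        rw [_root_.map_mul, σ.symm_apply_apply] }
  refine ⟨LinearEquiv.ofBijective Φ ⟨?_, ?_⟩⟩
  · intro g g' h
    apply (hEq σ X).injective
    apply ff.inj
    refine LinearMap.ext fun x => ?_
    have h1 : (HF K σ).map (hEq σ X g) ∘ₗ e.symm.toLinearMap =
      (HF K σ).map (hEq σ X g') ∘ₗ e.symm.toLinearMap := h
    have h2 := LinearMap.congr_fun h1 (e x)
    simpa using h2
  · intro f
    obtain ⟨g, hg⟩ := ff.surj (niEq K _ f ∘ₗ e.toLinearMap)
    refine ⟨(hEq σ X).symm g, ?_⟩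
    apply (niEq K _).injective
    show (HF K σ).map g ∘ₗ e.symm.toLinearMap = _
    rw [hg]
    refine LinearMap.ext fun φ => ?_
    simp

/-- `ν Hom(C,X) = D Hom(X,C)` for `X` in `add C` -/
theorem nak_homF {C X : ModuleCat.{0} R} (σ : S ≃+* (Module.End R C)ᵐᵒᵖ) (hσ : Compat K σ)
    (hX : MemAdd C X) :
    Nonempty ((HF K σ).obj X ≃ₗ[S] Nakayama K S ((homF σ).obj X)) := by
  have ff : (homF σ).FF X C := (homF_ff σ C).of_memAdd hX (MemAdd.refl C)
  let e := homF_reg σ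
  have es : ∀ φ, e φ = σ.symm (MulOpposite.op (hEq σ C φ)) := fun φ => rfl
  let E : (X →ₗ[R] C) →ₗ[K] ((homF σ).obj X →ₗ[S] S) :=
    { toFun := fun h => e.toLinearMap ∘ₗ (homF σ).map h
      map_add' := fun g g' => by
        refine LinearMap.ext fun φ => ?_
        exact e.map_add ((homF σ).map g φ) ((homF σ).map g' φ)
      map_smul' := fun c h => by
        refine LinearMap.ext fun φ => ?_
        exact hσ.symm c (h ∘ₗ hEq σ X φ) }
  have hE : Function.Bijective E := by
    constructor
    · intro g g' h
      apply ff.inj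
      refine LinearMap.ext fun x => e.injective ?_
      exact LinearMap.congr_fun h x
    · intro f
      obtain ⟨g, hg⟩ := ff.surj (e.symm.toLinearMap ∘ₗ f)
      refine ⟨g, ?_⟩
      show e.toLinearMap ∘ₗ (homF σ).map g = _
      rw [hg]
      refine LinearMap.ext fun φ => ?_
      exact e.apply_symm_apply (f φ)
  let E' := LinearEquiv.ofBijective E hE
  have key : ∀ b g, E'.symm (hmR b g) = (σ b).unop ∘ₗ E'.symm g := by
    intro b g
    rw [LinearEquiv.symm_apply_eq]
    obtain ⟨h, rfl⟩ := E'.surjective g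
    rw [E'.symm_apply_apply]
    refine LinearMap.ext fun φ => ?_
    show σ.symm (MulOpposite.op (h ∘ₗ hEq σ X φ : Module.End R C)) * b =
      σ.symm (MulOpposite.op (h ∘ₗ hEq σ X φ : Module.End R C) * σ b)
    rw [_root_.map_mul, σ.symm_apply_apply]
  exact ⟨{ toFun := fun φ => (nkEq K _).symm (HEq K σ X φ ∘ₗ E'.symm.toLinearMap)
           invFun := fun φ => (HEq K σ X).symm (nkEq K _ φ ∘ₗ E'.toLinearMap)
           map_add' := fun _ _ => rfl
           map_smul' := fun b φ => by
             apply (nkEq K _).injective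
             refine LinearMap.ext fun g => ?_
             rw [RingHom.id_apply, nkEq_smul]
             show HEq K σ X φ ((σ b).unop ∘ₗ E'.symm g) = HEq K σ X φ (E'.symm (hmR b g))
             rw [key]
           left_inv := fun φ => by
             apply HEq_ext; intro q
             show HEq K σ X φ (E'.symm (E' q)) = _
             rw [E'.symm_apply_apply]
           right_inv := fun φ => by
             apply (nkEq K _).injective
             refine LinearMap.ext fun g => ?_
             show nkEq K _ φ (E' (E'.symm g)) = _
             rw [E'.apply_symm_apply] }⟩

theorem part2 {P T : ModuleCat.{0} R} {k : ℕ} (hP : IsMaxProjInjSummand P)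
    (h : IsSpecialTilting P k T) (σ : S ≃+* (Module.End R T)ᵐᵒᵖ) (hσ : Compat K σ) :
    Inj ((HF K σ).obj P) ∧
    IsSpecialCotilting K ((HF K σ).obj P) k
      ((ModuleCat.restrictScalars σ.toRingHom).obj (DT K T)) ∧
    MemAdd ((ModuleCat.restrictScalars σ.toRingHom).obj (DT K T))
      (NakayamaInv K S ((HF K σ).obj P)) := by
  obtain ⟨hfin, -, -, A, hA, hL⟩ := (isSpecialTilting_iff _ _ _).mp h
  have hPT : MemAdd T P := by
    have : ∃ (X : ModuleCat.{0} R) (i : reg R →ₗ[R] X), MemAdd T X ∧ Function.Injective i := by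
      cases k with
      | zero => obtain ⟨e⟩ := hL; exact ⟨A, e.toLinearMap, hA, e.injective⟩
      | succ n => obtain ⟨X, N, i, p, hX, hs, -⟩ := hL; exact ⟨X, i, hX.1, hs.inj⟩
    obtain ⟨X, i, hX, hi⟩ := this
    obtain ⟨a, b, hab⟩ := hP.1
    refine MemAdd.trans hX (IsSummand.memAdd (isSummand_of_injective hP.2.1.2 (i ∘ₗ a) ?_))
    refine hi.comp (Function.LeftInverse.injective (g := b) fun x => LinearMap.congr_fun hab x)
  obtain ⟨h1, -, -⟩ := coreB K σ hσ hP.2.1.1 h ((HF K σ).obj P)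
    (fun X _ hX => (HF K σ).memAdd hX)
  have e := HF_reg K σ
  refine ⟨((HF K σ).memAdd hPT).injective (Inj.congr (HF_T K σ hσ).symm (dreg_injective K)),
    h1.of_summand (isSummand_of_equiv e.symm) (memAdd_of_equiv e), ?_⟩
  obtain ⟨n⟩ := nakInv_HF K σ hσ hfin hPT
  have hPfin : Module.Finite R P := hPT.finite
  refine MemAdd.trans (MemAdd.trans (memAdd_of_equiv (homF_dreg K σ)) ((homF σ).memAdd (memAdd_dreg K hPfin hP.2.1.2)))
    (memAdd_of_equiv n.symm)

theorem part4 {P C : ModuleCat.{0} R} {k : ℕ} (hP : IsMaxProjInjSummand P)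
    (h : IsSpecialCotilting K P k C) (σ : S ≃+* (Module.End R C)ᵐᵒᵖ) (hσ : Compat K σ) :
    Proj ((homF σ).obj P) ∧
    IsSpecialTilting ((homF σ).obj P) k
      ((ModuleCat.restrictScalars σ.toRingHom).obj (DT K C)) ∧
    MemAdd ((ModuleCat.restrictScalars σ.toRingHom).obj (DT K C))
      (Nakayama K S ((homF σ).obj P)) := by
  obtain ⟨hfin, -, -, A, hA, hL⟩ := (isSpecialCotilting_iff _ _ _ _).mp h
  have hPfin : Module.Finite R P := by
    have : Module.Finite R (reg R) := Module.Finite.self R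
    exact hP.1.memAdd.finite
  have hPC : MemAdd C P := by
    have : ∃ (X : ModuleCat.{0} R) (i : X →ₗ[R] Dreg K R), MemAdd C X ∧ Function.Surjective i := by
      cases k with
      | zero => obtain ⟨e⟩ := hL; exact ⟨A, e.toLinearMap, hA, e.surjective⟩
      | succ n => obtain ⟨X, N, i, p, hX, hs, -⟩ := hL.peel; exact ⟨X, p, hX.1, hs.surj⟩
    obtain ⟨X, i, hX, hi⟩ := this
    obtain ⟨m, a, b, hab⟩ := memAdd_dreg K hPfin hP.2.1.2
    have h2 : Function.Surjective (b ∘ₗ (LinearMap.pi fun j => i ∘ₗ LinearMap.proj j :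
        (Fin m → X) →ₗ[R] (Fin m → Dreg K R))) := by
      intro x
      choose y hy using fun j => hi ((a x : Fin m → Dreg K R) j)
      refine ⟨y, ?_⟩
      refine Eq.trans (congrArg b ?_) (LinearMap.congr_fun hab x)
      exact funext hy
    exact MemAdd.trans (hX.pow m) (IsSummand.memAdd (isSummand_of_projective
      (N := ModuleCat.of R (Fin m → X)) hP.2.1.1 _ h2))
  obtain ⟨h1, -, -⟩ := coreA K σ hσ hP.2.1.2 h ((homF σ).obj P)
    (fun X _ hX => (homF σ).memAdd hX)
  have e := homF_dreg K σ
  refine ⟨((homF σ).memAdd hPC).projective (Proj.congr (homF_reg σ).symm reg_projective),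
    h1.of_summand (isSummand_of_equiv e.symm) (memAdd_of_equiv e), ?_⟩
  obtain ⟨n⟩ := nak_homF K σ hσ hPC
  refine MemAdd.trans (MemAdd.trans (memAdd_of_equiv (HF_reg K σ)) ((HF K σ).memAdd hP.1.memAdd))
    (memAdd_of_equiv n.symm)

end
end PS

namespace PS
section
attribute [local instance] kMod kMod_smulCommClass kMod_end_smulCommClass

section comm
variable (K : Type) [Field K] (K' : Type) [Field K'] (Z : Type) [CommRing Z] [Algebra K Z]
  [Algebra K' Z] [FiniteDimensional K Z]

theorem socle_cyclic (m : Ideal Z) (hm : m.IsMaximal) (y ψ : Dreg K Z) (hy : y ≠ 0)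
    (hmy : ∀ z ∈ m, z • y = 0) (hψ : ∀ z ∈ m, z • ψ = 0) : ∃ z : Z, z • y = ψ := by
  let g : Z →ₗ[K] Module.Dual K Z :=
    { toFun := fun z => drEq K Z (z • y)
      map_add' := fun a b => by rw [add_smul, map_add]
      map_smul' := fun c a => by
        refine LinearMap.ext fun x => ?_
        rw [drEq_smul, RingHom.id_apply, LinearMap.smul_apply, drEq_smul, mul_smul_comm, map_smul] }
  let gz : Z →ₗ[Z] Dreg K Z := LinearMap.toSpanSingleton Z (Dreg K Z) y
  have hk : m = LinearMap.ker gz := by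
    refine hm.eq_of_le ?_ ?_
    · rw [Ideal.ne_top_iff_one]
      intro h
      apply hy
      have : gz 1 = 0 := h
      simpa [gz] using this
    · intro z hz
      show z • y = 0
      exact hmy z hz
  have hk2 : LinearMap.ker g = m.restrictScalars K := by
    ext z
    rw [Submodule.restrictScalars_mem]
    constructor
    · intro h
      rw [hk]
      show z • y = 0
      exact (drEq K Z).injective (by rw [map_zero]; exact h)
    · intro h
      show drEq K Z (z • y) = 0
      rw [hmy z h, map_zero]
  have hle : LinearMap.range g ≤ (m.restrictScalars K).dualAnnihilator := by
    rintro _ ⟨z, rfl⟩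
    rw [Submodule.mem_dualAnnihilator]
    intro w hw
    have : drEq K Z (w • z • y) 1 = 0 := by
      rw [smul_comm, hmy w hw, smul_zero, map_zero]; rfl
    rw [drEq_smul, one_mul] at this
    exact this
  have heq := Submodule.eq_of_le_of_finrank_eq hle (by
    have h1 := g.finrank_range_add_finrank_ker
    have h2 := Subspace.finrank_add_finrank_dualAnnihilator_eq (m.restrictScalars K)
    rw [hk2] at h1
    omega)
  have : drEq K Z ψ ∈ LinearMap.range g := by
    rw [heq, Submodule.mem_dualAnnihilator]
    intro w hw
    have := congrArg (fun q => drEq K Z q 1) (hψ w hw)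
    simpa [drEq_smul] using this
  obtain ⟨z, hz⟩ := this
  exact ⟨z, (drEq K Z).injective hz⟩

theorem socle_exists (m : Ideal Z) (hm : m.IsMaximal) :
    ∃ φ : Dreg K Z, φ ≠ 0 ∧ ∀ z ∈ m, z • φ = 0 := by
  have h1 : (1 : Z) ∉ m.restrictScalars K := (Ideal.ne_top_iff_one m).mp hm.ne_top
  obtain ⟨f, hf, hf'⟩ := Submodule.exists_le_ker_of_notMem h1
  refine ⟨(drEq K Z).symm f, ?_, ?_⟩
  · intro h
    apply hf
    have := congrArg (fun q => drEq K Z q 1) h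
    simpa using this
  · intro z hz
    apply dreg_ext
    intro x
    rw [drEq_smul]
    exact hf' (m.mul_mem_left x hz)

theorem exists_inj_dreg : ∃ u : Dreg K Z →ₗ[Z] Dreg K' Z, Function.Injective u := by
  have hart : IsArtinianRing Z := IsArtinianRing.of_finite K Z
  have hfin : Finite (MaximalSpectrum Z) := inferInstance
  have := Fintype.ofFinite (MaximalSpectrum Z)
  classical
  choose φ hφ0 hφ using fun m : MaximalSpectrum Z => socle_exists K Z m.asIdeal m.isMaximal
  have hl : ∀ m : MaximalSpectrum Z, ∃ l : Module.Dual K' (Dreg K Z), l (φ m) ≠ 0 := by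
    intro m
    by_contra! h
    exact hφ0 m ((Module.forall_dual_apply_eq_zero_iff K' _).mp h)
  choose l hl using hl
  have he : ∀ m : MaximalSpectrum Z, ∃ e : Z, ∀ m' : MaximalSpectrum Z,
      e - (if m' = m then 1 else 0) ∈ m'.asIdeal := by
    intro m
    refine Ideal.exists_forall_sub_mem_ideal (I := fun m' : MaximalSpectrum Z => m'.asIdeal) ?_ _
    intro a b hab
    exact MaximalSpectrum.isCoprime_of_ne hab
  choose e he using he
  have he' : ∀ m m', e m • φ m' = if m' = m then φ m' else 0 := by
    intro m m'
    have := hφ m' _ (he m m')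
    rw [sub_smul, sub_eq_zero] at this
    rw [this]
    split_ifs <;> simp
  let L : Dreg K Z →ₗ[K'] K' := ∑ m, l m ∘ₗ actMap K' Z (Dreg K Z) (e m)
  have hL : ∀ m, L (φ m) = l m (φ m) := by
    intro m
    have : L (φ m) = ∑ m', l m' (e m' • φ m) := by
      simp only [L, LinearMap.sum_apply]; rfl
    rw [this, Finset.sum_eq_single m]
    · rw [he', if_pos rfl]
    · intro b _ hb
      rw [he', if_neg hb.symm, map_zero]
    · intro h; exact absurd (Finset.mem_univ _) h
  refine ⟨(homDreg K' (Dreg K Z)).symm L, ?_⟩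
  rw [← LinearMap.ker_eq_bot, Submodule.eq_bot_iff]
  by_contra! hne
  obtain ⟨x, hx, hx0⟩ := hne
  obtain ⟨p, hp, -⟩ := exists_le_isAssociatedPrime_of_isNoetherianRing Z
    (M := LinearMap.ker ((homDreg K' (Dreg K Z)).symm L)) ⟨x, hx⟩
    (fun h => hx0 (congrArg Subtype.val h))
  obtain ⟨hpp, y, hy⟩ := isAssociatedPrime_iff.mp hp
  have hpm : p.IsMaximal := IsArtinianRing.isMaximal_of_isPrime p
  have hy0 : (y : Dreg K Z) ≠ 0 := by
    intro h
    apply hpp.ne_top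
    have h' : y = 0 := Subtype.ext h
    rw [hy, Ideal.eq_top_iff_one, Submodule.mem_colon_singleton, h', smul_zero]
    exact Submodule.zero_mem _
  have hyk : ∀ z ∈ p, z • (y : Dreg K Z) = 0 := by
    intro z hz
    rw [hy, Submodule.mem_colon_singleton, Submodule.mem_bot] at hz
    exact congrArg Subtype.val hz
  obtain ⟨z, hz⟩ := socle_cyclic K Z p hpm y (φ ⟨p, hpm⟩) hy0 hyk (hφ ⟨p, hpm⟩)
  have h1 : φ ⟨p, hpm⟩ ∈ LinearMap.ker ((homDreg K' (Dreg K Z)).symm L) := by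
    rw [← hz]; exact Submodule.smul_mem _ _ y.2
  have h2 := homDreg_symm_apply K' (Dreg K Z) L (φ ⟨p, hpm⟩) 1
  rw [LinearMap.mem_ker.mp h1, one_smul, hL] at h2
  exact hl _ (by rw [← h2, map_zero]; rfl)

theorem exists_equiv_dreg [FiniteDimensional K' Z] : Nonempty (Dreg K Z ≃ₗ[Z] Dreg K' Z) := by
  obtain ⟨u, hu⟩ := exists_inj_dreg K K' Z
  obtain ⟨v, hv⟩ := exists_inj_dreg K' K Z
  refine ⟨LinearEquiv.ofBijective u ⟨hu, ?_⟩⟩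
  have hf := kfinite K' (Dreg K' Z) (dreg_finite K')
  have : Function.Injective (kLin K' (u ∘ₗ v)) := hu.comp hv
  have := LinearMap.surjective_of_injective this
  intro x
  obtain ⟨y, hy⟩ := this x
  exact ⟨v y, hy⟩

end comm
end
end PS

namespace PS
section
attribute [local instance] kMod kMod_smulCommClass kMod_end_smulCommClass

section tw
variable {K K' : Type} [Field K] [Field K'] {Z : Type} [CommRing Z] [Algebra K Z] [Algebra K' Z]
variable {M N : Type} [AddCommGroup M] [Module Z M] [Module K M] [Module K' M]
  [IsScalarTower K Z M] [IsScalarTower K' Z M]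
  [AddCommGroup N] [Module Z N] [Module K N] [Module K' N]
  [IsScalarTower K Z N] [IsScalarTower K' Z N]

/-- the functional on `Z` attached to an element -/
def twAt (φ : M →ₗ[K] K) (m : M) : Dreg K Z := (drEq K Z).symm
  { toFun := fun z => φ (z • m)
    map_add' := fun a b => by rw [add_smul, map_add]
    map_smul' := fun c a => by rw [smul_assoc, map_smul, RingHom.id_apply] }

theorem twAt_apply (φ : M →ₗ[K] K) (m : M) (z : Z) :
    drEq K Z (twAt φ m) z = φ (z • m) := rfl

/-- comparison of duals -/
def twFun (u : Dreg K Z ≃ₗ[Z] Dreg K' Z) (φ : M →ₗ[K] K) : M →ₗ[K'] K' where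
  toFun m := drEq K' Z (u (twAt φ m)) 1
  map_add' a b := by
    have : (twAt φ (a + b) : Dreg K Z) = twAt φ a + twAt φ b := by
      apply dreg_ext; intro z
      show φ (z • (a + b)) = φ (z • a) + φ (z • b)
      rw [smul_add, map_add]
    rw [this, map_add, map_add]; rfl
  map_smul' c a := by
    have : (twAt φ (c • a) : Dreg K Z) = (algebraMap K' Z c) • twAt φ a := by
      apply dreg_ext; intro z
      show φ (z • (c • a)) = φ ((z * algebraMap K' Z c) • a)
      rw [mul_smul, algebraMap_smul]
    rw [this, map_smul, drEq_smul, one_mul, RingHom.id_apply, Algebra.algebraMap_eq_smul_one,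
      map_smul]

theorem twFun_apply (u : Dreg K Z ≃ₗ[Z] Dreg K' Z) (φ : M →ₗ[K] K) (m : M) :
    twFun u φ m = drEq K' Z (u (twAt φ m)) 1 := rfl

theorem twAt_smul (φ : M →ₗ[K] K) (z : Z) (m : M) :
    (twAt φ (z • m) : Dreg K Z) = z • twAt φ m := by
  apply dreg_ext; intro w
  show φ (w • z • m) = φ ((w * z) • m)
  rw [mul_smul]

theorem twAt_twFun (u : Dreg K Z ≃ₗ[Z] Dreg K' Z) (φ : M →ₗ[K] K) (m : M) :
    twAt (twFun u φ) m = u (twAt φ m) := by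
  apply dreg_ext; intro z
  rw [twAt_apply, twFun_apply, twAt_smul, map_smul, drEq_smul, one_mul]

/-- comparison of duals -/
def tw (u : Dreg K Z ≃ₗ[Z] Dreg K' Z) : (M →ₗ[K] K) ≃+ (M →ₗ[K'] K') where
  toFun := twFun u
  invFun := twFun u.symm
  left_inv φ := by
    refine LinearMap.ext fun m => ?_
    rw [twFun_apply, twAt_twFun, u.symm_apply_apply, twAt_apply, one_smul]
  right_inv φ := by
    refine LinearMap.ext fun m => ?_
    rw [twFun_apply, twAt_twFun, u.apply_symm_apply, twAt_apply, one_smul]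
  map_add' φ ψ := by
    refine LinearMap.ext fun m => ?_
    have : (twAt (φ + ψ) m : Dreg K Z) = twAt φ m + twAt ψ m := rfl
    rw [twFun_apply, this, map_add, map_add]; rfl

theorem tw_nat (u : Dreg K Z ≃ₗ[Z] Dreg K' Z) (a : M → N) (ha : ∀ (z : Z) m, a (z • m) = z • a m)
    (φ : N →ₗ[K] K) (φ' : M →ₗ[K] K) (h : ∀ m, φ' m = φ (a m)) (m : M) :
    tw u φ' m = tw u φ (a m) := by
  show drEq K' Z (u (twAt φ' m)) 1 = drEq K' Z (u (twAt φ (a m))) 1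
  have : (twAt φ' m : Dreg K Z) = twAt φ (a m) := by
    apply dreg_ext; intro z
    rw [twAt_apply, twAt_apply, h, ha]
  rw [this]

end tw

section cen
variable (K : Type) [Field K] (B : Type) [Ring B] [Algebra K B]

/-- the center is an algebra -/
def cenAlg : Algebra K (Subring.center B) :=
  ((algebraMap K B).codRestrict (Subring.center B) (fun c => by
    rw [Subring.mem_center_iff]
    intro g
    exact (Algebra.commutes c g).symm)).toAlgebra

attribute [local instance] cenAlg

theorem cen_tower : IsScalarTower K (Subring.center B) B :=
  ⟨fun c z b => by
    show ((algebraMap K B c * (z : B)) * b) = c • ((z : B) * b)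
    rw [mul_assoc, ← Algebra.smul_def]⟩

theorem cen_finite [FiniteDimensional K B] : FiniteDimensional K (Subring.center B) := by
  let f : Subring.center B →ₗ[K] B :=
    { toFun := fun z => z
      map_add' := fun _ _ => rfl
      map_smul' := fun c z => by
        show algebraMap K B c * (z : B) = c • (z : B)
        rw [Algebra.smul_def] }
  exact FiniteDimensional.of_injective f Subtype.val_injective

attribute [local instance] cen_tower cen_finite

variable (K' : Type) [Field K'] [Algebra K' B] [FiniteDimensional K B] [FiniteDimensional K' B]

theorem dreg_twist : ∃ e : Dreg K B ≃ₗ[B] Dreg K' B, ∀ b φ, e (drR K b φ) = drR K' b (e φ) := by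
  obtain ⟨u⟩ := exists_equiv_dreg K K' (Subring.center B)
  let e0 : (B →ₗ[K] K) ≃+ (B →ₗ[K'] K') := tw u
  have hl : ∀ (b : B) (φ : Dreg K B) (x : B),
      e0 (drEq K B (b • φ)) x = e0 (drEq K B φ) (x * b) := fun b φ x =>
    tw_nat u (fun y : B => y * b) (fun z m => mul_assoc (z : B) m b) (drEq K B φ)
      (drEq K B (b • φ)) (fun m => rfl) x
  have hr : ∀ (b : B) (φ : Dreg K B) (x : B),
      e0 (drEq K B (drR K b φ)) x = e0 (drEq K B φ) (b * x) := fun b φ x =>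
    tw_nat u (fun y : B => b * y) (fun z m => by
        show b * ((z : B) * m) = (z : B) * (b * m)
        rw [← mul_assoc, ← mul_assoc, Subring.mem_center_iff.mp z.2 b]) (drEq K B φ)
      (drEq K B (drR K b φ)) (fun m => rfl) x
  refine ⟨{ ((drEq K B).trans e0).trans (drEq K' B).symm with
            map_smul' := fun b φ => dreg_ext K' (hl b φ) }, fun b φ => dreg_ext K' (hr b φ)⟩

theorem cotilt_twist {I C : ModuleCat.{0} B} {k : ℕ} (h : IsSpecialCotilting K I k C) :
    IsSpecialCotilting K' I k C := by
  rw [isSpecialCotilting_iff] at h ⊢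
  obtain ⟨h1, h2, h3, A, hA, hL⟩ := h
  obtain ⟨e, -⟩ := dreg_twist K B K'
  exact ⟨h1, h2, h3, A, hA, hL.congr_right e⟩

theorem nakInv_twist (I : ModuleCat.{0} B) :
    Nonempty (NakayamaInv K B I ≃ₗ[B] NakayamaInv K' B I) := by
  obtain ⟨e, he⟩ := dreg_twist K B K'
  have he' : ∀ b φ, e.symm (drR K' b φ) = drR K b (e.symm φ) := fun b φ => by
    rw [e.symm_apply_eq, he, e.apply_symm_apply]
  exact ⟨{ toFun := fun f => (niEq K' I).symm (niEq K I f ∘ₗ e.symm.toLinearMap)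
           invFun := fun f => (niEq K I).symm (niEq K' I f ∘ₗ e.toLinearMap)
           map_add' := fun _ _ => rfl
           map_smul' := fun b f => by
             apply (niEq K' I).injective
             refine LinearMap.ext fun φ => ?_
             rw [RingHom.id_apply, niEq_smul]
             show niEq K I (b • f) (e.symm φ) = niEq K I f (e.symm (drR K' b φ))
             rw [niEq_smul, he']
           left_inv := fun f => by
             apply (niEq K I).injective
             refine LinearMap.ext fun φ => ?_
             show niEq K I f (e.symm (e φ)) = _
             rw [e.symm_apply_apply]
           right_inv := fun f => by
             apply (niEq K' I).injective
             refine LinearMap.ext fun φ => ?_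
             show niEq K' I f (e (e.symm φ)) = _
             rw [e.apply_symm_apply] }⟩

theorem nak_twist (P : ModuleCat.{0} B) :
    Nonempty (Nakayama K B P ≃ₗ[B] Nakayama K' B P) := by
  obtain ⟨u⟩ := exists_equiv_dreg K K' (Subring.center B)
  let e0 : ((P →ₗ[B] B) →ₗ[K] K) ≃+ ((P →ₗ[B] B) →ₗ[K'] K') := tw u
  have hl : ∀ (b : B) (φ : Nakayama K B P) (x : P →ₗ[B] B),
      e0 (nkEq K P (b • φ)) x = e0 (nkEq K P φ) (hmR b x) := fun b φ x =>
    tw_nat u (fun y : P →ₗ[B] B => (hmR b y : P →ₗ[B] B)) (fun z m => by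
        refine LinearMap.ext fun p => ?_
        exact mul_assoc (z : B) (m p) b) (nkEq K P φ)
      (nkEq K P (b • φ)) (fun m => rfl) x
  exact ⟨{ ((nkEq K P).trans e0).trans (nkEq K' P).symm with
            map_smul' := fun b φ => (nkEq K' P).injective (LinearMap.ext (hl b φ)) }⟩

end cen

section fin
variable (K : Type) [Field K] {R : Type} [Ring R] [Algebra K R] [FiniteDimensional K R]
variable {B : Type} [Ring B]

/-- transported algebra structure -/
def twAlg {T : ModuleCat.{0} R} (σ : B ≃+* (Module.End R T)ᵐᵒᵖ) : Algebra K B :=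
  (σ.symm.toRingHom.comp (algebraMap K (Module.End R T)ᵐᵒᵖ)).toAlgebra' (fun c b => by
    apply σ.injective
    show σ (σ.symm (algebraMap K _ c) * b) = σ (b * σ.symm (algebraMap K _ c))
    rw [_root_.map_mul, _root_.map_mul, σ.apply_symm_apply]
    exact Algebra.commutes c (σ b))

theorem twAlg_compat {T : ModuleCat.{0} R} (σ : B ≃+* (Module.End R T)ᵐᵒᵖ) :
    letI := twAlg K σ
    Compat K σ := by
  intro c x
  show (σ (σ.symm (algebraMap K (Module.End R T)ᵐᵒᵖ c))).unop x = _
  rw [σ.apply_symm_apply]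
  rfl

theorem twAlg_finite {T : ModuleCat.{0} R} (hT : Module.Finite R T)
    (σ : B ≃+* (Module.End R T)ᵐᵒᵖ) :
    @Module.Finite K B _ _ (twAlg K σ).toModule := by
  letI := twAlg K σ
  have h := homfinite K hT hT
  let e : (T →ₗ[R] T) →ₗ[K] B :=
    { toFun := fun f => σ.symm (MulOpposite.op f)
      map_add' := fun f g => by
        rw [MulOpposite.op_add]; exact _root_.map_add σ.symm _ _
      map_smul' := fun c f => by
        rw [RingHom.id_apply, Algebra.smul_def]
        apply σ.injective
        rw [σ.apply_symm_apply, _root_.map_mul, σ.apply_symm_apply]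
        show _ = σ (σ.symm (algebraMap K (Module.End R T)ᵐᵒᵖ c)) * _
        rw [σ.apply_symm_apply]
        apply MulOpposite.unop_injective
        refine LinearMap.ext fun x => ?_
        exact (map_smul f (algebraMap K R c) x).symm }
  exact Module.Finite.of_surjective e (fun b => ⟨(σ b).unop, σ.symm_apply_apply b⟩)

variable [Algebra K B] [FiniteDimensional K B]

theorem part2' {P T : ModuleCat.{0} R} {k : ℕ} (hP : IsMaxProjInjSummand P)
    (h : IsSpecialTilting P k T) (σ : B ≃+* (Module.End R T)ᵐᵒᵖ) :
    Inj ((ModuleCat.restrictScalars σ.toRingHom).obj (Ihom K P T)) ∧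
    IsSpecialCotilting K ((ModuleCat.restrictScalars σ.toRingHom).obj (Ihom K P T)) k
      ((ModuleCat.restrictScalars σ.toRingHom).obj (DT K T)) ∧
    MemAdd ((ModuleCat.restrictScalars σ.toRingHom).obj (DT K T))
      (NakayamaInv K B ((ModuleCat.restrictScalars σ.toRingHom).obj (Ihom K P T))) := by
  have hT : Module.Finite R T := ((isSpecialTilting_iff _ _ _).mp h).1
  obtain ⟨h1, h2, h3⟩ := @part2 K _ R _ _ _ B _ (twAlg K σ) P T k hP h σ (twAlg_compat K σ)
  have hf := twAlg_finite K hT σ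
  obtain ⟨e⟩ := @nakInv_twist K _ B _ (twAlg K σ) K _ _ hf _
    ((ModuleCat.restrictScalars σ.toRingHom).obj (Ihom K P T))
  exact ⟨h1, @cotilt_twist K _ B _ (twAlg K σ) K _ _ hf _ _ _ _ h2,
    MemAdd.trans h3 (memAdd_of_equiv e.symm)⟩

theorem part4' {P C : ModuleCat.{0} R} {k : ℕ} (hP : IsMaxProjInjSummand P)
    (h : IsSpecialCotilting K P k C) (σ : B ≃+* (Module.End R C)ᵐᵒᵖ) :
    Proj ((ModuleCat.restrictScalars σ.toRingHom).obj (homTX C P)) ∧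
    IsSpecialTilting ((ModuleCat.restrictScalars σ.toRingHom).obj (homTX C P)) k
      ((ModuleCat.restrictScalars σ.toRingHom).obj (DT K C)) ∧
    MemAdd ((ModuleCat.restrictScalars σ.toRingHom).obj (DT K C))
      (Nakayama K B ((ModuleCat.restrictScalars σ.toRingHom).obj (homTX C P))) := by
  have hT : Module.Finite R C := ((isSpecialCotilting_iff _ _ _ _).mp h).1
  obtain ⟨h1, h2, h3⟩ := @part4 K _ R _ _ _ B _ (twAlg K σ) P C k hP h σ (twAlg_compat K σ)
  have hf := twAlg_finite K hT σ
  obtain ⟨e⟩ := @nak_twist K _ B _ (twAlg K σ) K _ _ hf _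
    ((ModuleCat.restrictScalars σ.toRingHom).obj (homTX C P))
  exact ⟨h1, h2, MemAdd.trans h3 (memAdd_of_equiv e.symm)⟩

end fin
end
end PS

namespace PS
section
attribute [local instance] kMod kMod_smulCommClass kMod_end_smulCommClass

/-- ring-theoretic basicness -/
def RBas (E : Type) [Ring E] : Prop :=
  ∀ p q : E, p * q * p = p → q * p * q = q → p * p = 0 → q * q = 0 → p = 0

theorem RBas.of_equiv {E E' : Type} [Ring E] [Ring E'] (e : E ≃+* E') (h : RBas E) : RBas E' := by
  intro p q h1 h2 h3 h4
  apply e.symm.injective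
  rw [map_zero]
  refine h _ (e.symm q) ?_ ?_ ?_ ?_
  · rw [← map_mul, ← map_mul, h1]
  · rw [← map_mul, ← map_mul, h2]
  · rw [← map_mul, h3, map_zero]
  · rw [← map_mul, h4, map_zero]

theorem RBas.op {E : Type} [Ring E] (h : RBas E) : RBas Eᵐᵒᵖ := by
  intro p q h1 h2 h3 h4
  apply MulOpposite.unop_injective
  refine h p.unop q.unop ?_ ?_ ?_ ?_
  · rw [mul_assoc]; exact congrArg MulOpposite.unop h1
  · rw [mul_assoc]; exact congrArg MulOpposite.unop h2
  · exact congrArg MulOpposite.unop h3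
  · exact congrArg MulOpposite.unop h4

theorem RBas.unop {E : Type} [Ring E] (h : RBas Eᵐᵒᵖ) : RBas E :=
  h.op.of_equiv (RingEquiv.opOp E).symm

variable {R : Type} [Ring R]

theorem isBasic_iff (M : ModuleCat.{0} R) : IsBasic M ↔ RBas (Module.End R M) := by
  constructor
  · intro h p q h1 h2 h3 h4
    have a1 : ∀ x, p (q (p x)) = p x := fun x => LinearMap.congr_fun h1 x
    have a3 : ∀ x, p (p x) = 0 := fun x => LinearMap.congr_fun h3 x
    have a4 : ∀ x, q (q x) = 0 := fun x => LinearMap.congr_fun h4 x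
    have hs := h (ModuleCat.of R (LinearMap.range p)) ?_
    · refine LinearMap.ext fun x => ?_
      have : (⟨p x, x, rfl⟩ : LinearMap.range p) = 0 := hs.elim _ _
      exact congrArg Subtype.val this
    · let X := LinearMap.range p
      let ι : (X × X) →ₗ[R] M := LinearMap.coprod X.subtype (q ∘ₗ X.subtype)
      let π : M →ₗ[R] (X × X) := LinearMap.prod (p.rangeRestrict ∘ₗ q) p.rangeRestrict
      refine ⟨ι, π, ?_⟩
      refine LinearMap.ext fun z => ?_
      obtain ⟨⟨_, x, rfl⟩, ⟨_, y, rfl⟩⟩ := z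
      refine Prod.ext (Subtype.ext ?_) (Subtype.ext ?_)
      · show p (q (p x + q (p y))) = p x
        rw [map_add, map_add, a4, map_zero, add_zero, a1]
      · show p (p x + q (p y)) = p y
        rw [map_add, a3, a1, zero_add]
  · rintro h X ⟨ι, π, hp⟩
    have hp' : ∀ x : X × X, π (ι x) = x := fun x => LinearMap.congr_fun hp x
    let π' : M →ₗ[R] X × X := π
    let ι' : X × X →ₗ[R] M := ι
    have hp'' : ∀ x : X × X, π' (ι' x) = x := hp'
    let p : Module.End R M := ι' ∘ₗ LinearMap.inl R X X ∘ₗ LinearMap.snd R X X ∘ₗ π'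
    let q : Module.End R M := ι' ∘ₗ LinearMap.inr R X X ∘ₗ LinearMap.fst R X X ∘ₗ π'
    have ep : ∀ m, p m = ι' ((π' m).2, 0) := fun m => rfl
    have eq : ∀ m, q m = ι' (0, (π' m).1) := fun m => rfl
    have h0 : p = 0 := by
      refine h p q ?_ ?_ ?_ ?_
      · refine LinearMap.ext fun m => ?_
        show p (q (p m)) = p m
        simp only [ep, eq, hp'']
      · refine LinearMap.ext fun m => ?_
        show q (p (q m)) = q m
        simp only [ep, eq, hp'']
      · refine LinearMap.ext fun m => ?_
        show p (p m) = 0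
        simp only [ep, hp'']
        exact map_zero ι'
      · refine LinearMap.ext fun m => ?_
        show q (q m) = 0
        simp only [eq, hp'']
        exact map_zero ι'
    refine subsingleton_of_forall_eq 0 fun x => ?_
    have h1 : p (ι' (0, x)) = 0 := by rw [h0]; rfl
    rw [ep, hp''] at h1
    have h2 := congrArg π' h1
    rw [hp'', map_zero] at h2
    exact congrArg Prod.fst h2

theorem isBasic_reg_iff : IsBasic (reg R) ↔ RBas R := by
  rw [isBasic_iff]
  let e : Rᵐᵒᵖ ≃+* Module.End R (reg R) := RingEquiv.moduleEndSelf R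
  exact ⟨fun h => (h.of_equiv e.symm).unop, fun h => h.op.of_equiv e⟩

theorem MemAdd.pair {P A B Q : ModuleCat.{0} R} (hA : MemAdd P A) (hB : MemAdd P B)
    (iA : Q →ₗ[R] A) (pA : A →ₗ[R] Q) (iB : Q →ₗ[R] B) (pB : B →ₗ[R] Q)
    (h : ∀ x, pA (iA x) + pB (iB x) = x) : MemAdd P Q := by
  obtain ⟨n, a, b, hab⟩ := memAdd_iff.mp hA
  obtain ⟨m, c, d, hcd⟩ := memAdd_iff.mp hB
  refine memAdd_of (Sum.elim (fun j => a j ∘ₗ iA) (fun j => c j ∘ₗ iB))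
    (Sum.elim (fun j => pA ∘ₗ b j) (fun j => pB ∘ₗ d j)) fun x => ?_
  rw [Fintype.sum_sum_type]
  simp only [Sum.elim_inl, Sum.elim_inr, LinearMap.comp_apply]
  rw [← map_sum, ← map_sum, hab, hcd, h]

variable (K : Type) [Field K] [Algebra K R] [FiniteDimensional K R]

theorem finrank_lt {N M : ModuleCat.{0} R} (hM : Module.Finite R M) (f : N →ₗ[R] M)
    (hf : Function.Injective f) (hs : ¬ Function.Surjective f) :
    Module.finrank K N < Module.finrank K M := by
  have := kfinite K M hM
  have hi : Function.Injective (kLin K f) := hf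
  have : Module.Finite K N := Module.Finite.of_injective _ hi
  refine lt_of_le_of_ne (LinearMap.finrank_le_finrank_of_injective hi) fun h => hs ?_
  exact (LinearMap.injective_iff_surjective_of_finrank_eq_finrank h).mp hi

theorem exists_basic (K : Type) [Field K] [Algebra K R] [FiniteDimensional K R] (M : ModuleCat.{0} R) (hM : Module.Finite R M) :
    ∃ N : ModuleCat.{0} R, IsBasic N ∧ IsSummand N M ∧ MemAdd N M := by
  induction hn : Module.finrank K M using Nat.strong_induction_on generalizing M with
  | _ n ih =>
  by_cases hb : IsBasic M
  · exact ⟨M, hb, IsSummand.refl M, MemAdd.refl M⟩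
  unfold IsBasic at hb
  push Not at hb
  obtain ⟨X, ⟨ι, π, hp⟩, hX⟩ := hb
  have hp' : ∀ x : X × X, π (ι x) = x := fun x => LinearMap.congr_fun hp x
  let π' : M →ₗ[R] X × X := π
  let ι' : X × X →ₗ[R] M := ι
  have hp'' : ∀ x : X × X, π' (ι' x) = x := hp'
  let f : M →ₗ[R] X := LinearMap.snd R X X ∘ₗ π'
  let N := ModuleCat.of R (LinearMap.ker f)
  let pr : M →ₗ[R] LinearMap.ker f := LinearMap.codRestrict _
    (LinearMap.id - ι' ∘ₗ LinearMap.inr R X X ∘ₗ f) (fun m => by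
      rw [LinearMap.mem_ker]
      show (π' (m - ι' (0, f m))).2 = 0
      rw [map_sub, hp'']
      exact sub_self _)
  let sw : M →ₗ[R] LinearMap.ker f := LinearMap.codRestrict _
    (ι' ∘ₗ LinearMap.inl R X X ∘ₗ f) (fun m => by
      rw [LinearMap.mem_ker]
      show (π' (ι' (f m, 0))).2 = 0
      rw [hp''])
  let bk : LinearMap.ker f →ₗ[R] M :=
    (ι' ∘ₗ LinearMap.inr R X X ∘ₗ LinearMap.fst R X X ∘ₗ π') ∘ₗ (LinearMap.ker f).subtype
  have hsum : IsSummand N M := by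
    refine ⟨(LinearMap.ker f).subtype, pr, ?_⟩
    refine LinearMap.ext fun x => Subtype.ext ?_
    show (x : M) - ι' (0, f x) = x
    rw [LinearMap.mem_ker.mp x.2]
    have : ι' ((0 : X), (0 : X)) = 0 := map_zero ι'
    rw [this, sub_zero]
  have hmem : MemAdd N M := by
    refine MemAdd.pair (P := N) (A := N) (B := N) (MemAdd.refl N) (MemAdd.refl N) pr
      (LinearMap.ker f).subtype sw bk fun x => ?_
    show (x - ι' (0, f x)) + ι' (0, (π' (ι' (f x, 0))).1) = x
    rw [hp'', sub_add_cancel]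
  have hNfin : Module.Finite R N := hsum.memAdd.finite
  have hlt : Module.finrank K N < Module.finrank K M := by
    refine finrank_lt K (N := N) hM (LinearMap.ker f).subtype Subtype.val_injective fun hs => ?_
    obtain ⟨x, hx⟩ : ∃ x : X, x ≠ 0 := by
      by_contra! h
      exact not_subsingleton_iff_nontrivial.mpr hX (subsingleton_of_forall_eq 0 h)
    obtain ⟨y, hy⟩ := hs (ι' (0, x))
    apply hx
    have h1 : f (ι' (0, x)) = 0 := by rw [← hy]; exact y.2
    have h2 : f (ι' (0, x)) = x := by
      show (π' (ι' (0, x))).2 = x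
      rw [hp'']
    rw [← h2, h1]
  obtain ⟨N', h1, h2, h3⟩ := ih _ (hn ▸ hlt) N hNfin rfl
  exact ⟨N', h1, h2.trans hsum, h3.trans hmem⟩

end
end PS

namespace PS
section
attribute [local instance] kMod kMod_smulCommClass kMod_end_smulCommClass

variable {R : Type} [Ring R]

/-- local endomorphism ring -/
def Loc (Q : ModuleCat.{0} R) : Prop :=
  ∀ f g : Module.End R Q, f + g = 1 → IsUnit f ∨ IsUnit g

theorem Loc.add {Q : ModuleCat.{0} R} (h : Loc Q) {f g : Module.End R Q} (hu : IsUnit (f + g)) :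
    IsUnit f ∨ IsUnit g := by
  obtain ⟨u, hu⟩ := hu
  have : (↑u⁻¹ * f : Module.End R Q) + ↑u⁻¹ * g = 1 := by rw [← mul_add, ← hu, Units.inv_mul]
  rcases h _ _ this with h1 | h1
  · left
    have := u.isUnit.mul h1
    rwa [← mul_assoc, Units.mul_inv, one_mul] at this
  · right
    have := u.isUnit.mul h1
    rwa [← mul_assoc, Units.mul_inv, one_mul] at this

theorem Loc.sum {Q : ModuleCat.{0} R} (h : Loc Q) [Nontrivial (Module.End R Q)] {α : Type*}
    (s : Finset α) (f : α → Module.End R Q) (hu : IsUnit (∑ a ∈ s, f a)) : ∃ a, IsUnit (f a) := by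
  classical
  induction s using Finset.induction_on with
  | empty => rw [Finset.sum_empty] at hu; exact absurd hu not_isUnit_zero
  | insert a s ha ih =>
    rw [Finset.sum_insert ha] at hu
    rcases h.add hu with h1 | h1
    · exact ⟨a, h1⟩
    · exact ih h1

theorem isSummand_of_isUnit {Q Y : ModuleCat.{0} R} (i : Q →ₗ[R] Y) (p : Y →ₗ[R] Q)
    (h : IsUnit (p ∘ₗ i : Module.End R Q)) : IsSummand Q Y := by
  obtain ⟨u, hu⟩ := h
  refine ⟨i, (↑u⁻¹ : Module.End R Q) ∘ₗ p, ?_⟩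
  rw [LinearMap.comp_assoc, ← hu]
  exact u.inv_mul

theorem prod_injective {A B : ModuleCat.{0} R} (hA : Inj A) (hB : Inj B) :
    Inj (ModuleCat.of R (A × B)) := by
  constructor
  intro X Y _ _ _ _ f hf g
  obtain ⟨a, ha⟩ := hA.out f hf (LinearMap.fst R A B ∘ₗ g)
  obtain ⟨b, hb⟩ := hB.out f hf (LinearMap.snd R A B ∘ₗ g)
  exact ⟨a.prod b, fun x => Prod.ext (ha x) (hb x)⟩

theorem prod_projective {A B : ModuleCat.{0} R} (hA : Proj A) (hB : Proj B) :
    Proj (ModuleCat.of R (A × B)) := by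
  have : Module.Projective R A := hA
  have : Module.Projective R B := hB
  exact (inferInstance : Module.Projective R (A × B))

theorem loc_or_split (K : Type) [Field K] [Algebra K R] [FiniteDimensional K R]
    (Q : ModuleCat.{0} R) (hQ : Module.Finite R Q) :
    Loc Q ∨ ∃ (A B : ModuleCat.{0} R) (iA : Q →ₗ[R] A) (pA : A →ₗ[R] Q) (iB : Q →ₗ[R] B)
      (pB : B →ₗ[R] Q), Module.finrank K A < Module.finrank K Q ∧
      Module.finrank K B < Module.finrank K Q ∧ IsSummand A Q ∧ IsSummand B Q ∧
      ∀ x, pA (iA x) + pB (iB x) = x := by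
  have : IsNoetherianRing R := IsNoetherianRing.of_finite K R
  have : IsArtinianRing R := IsArtinianRing.of_finite K R
  have : IsNoetherian R Q := inferInstance
  have : IsArtinian R Q := inferInstance
  by_cases hs : ∀ A B : Submodule R Q, IsCompl A B → A = ⊥ ∨ B = ⊥
  · left
    intro f g hfg
    obtain ⟨n, hn⟩ := Filter.eventually_atTop.mp (LinearMap.eventually_isCompl_ker_pow_range_pow f)
    have hc := hn (n+1) (by omega)
    rcases hs _ _ hc with h | h
    · left
      rw [LinearMap.ker_eq_bot] at h
      have hi : Function.Injective f := by
        intro x y hxy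
        apply h
        rw [pow_succ, Module.End.mul_apply, Module.End.mul_apply, hxy]
      rw [Module.End.isUnit_iff]
      exact IsArtinian.bijective_of_injective_endomorphism f hi
    · right
      rw [LinearMap.range_eq_bot] at h
      have : IsNilpotent f := ⟨_, h⟩
      rw [← eq_sub_iff_add_eq'] at hfg
      rw [hfg]
      exact this.isUnit_one_sub
  · right
    push Not at hs
    obtain ⟨A, B, hc, hA, hB⟩ := hs
    refine ⟨ModuleCat.of R A, ModuleCat.of R B, Submodule.linearProjOfIsCompl A B hc, A.subtype,
      Submodule.linearProjOfIsCompl B A hc.symm, B.subtype, ?_, ?_, ?_, ?_, ?_⟩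
    · refine finrank_lt K (N := ModuleCat.of R A) hQ A.subtype Subtype.val_injective fun h => hB ?_
      have : A = ⊤ := by
        rw [← Submodule.range_subtype A]; exact LinearMap.range_eq_top.mpr h
      rw [this] at hc
      exact eq_bot_of_top_isCompl hc
    · refine finrank_lt K (N := ModuleCat.of R B) hQ B.subtype Subtype.val_injective fun h => hA ?_
      have : B = ⊤ := by
        rw [← Submodule.range_subtype B]; exact LinearMap.range_eq_top.mpr h
      rw [this] at hc
      exact eq_bot_of_isCompl_top hc
    · exact ⟨A.subtype, Submodule.linearProjOfIsCompl A B hc, LinearMap.ext fun x =>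
        Submodule.linearProjOfIsCompl_apply_left hc x⟩
    · exact ⟨B.subtype, Submodule.linearProjOfIsCompl B A hc.symm, LinearMap.ext fun x =>
        Submodule.linearProjOfIsCompl_apply_left hc.symm x⟩
    · intro x
      exact Submodule.projection_add_projection_eq_self hc x

/-- existence of a maximal projective-injective summand -/
theorem exists_max (K : Type) [Field K] [Algebra K R] [FiniteDimensional K R] :
    ∃ P : ModuleCat.{0} R, IsMaxProjInjSummand P ∧
      ∀ Q : ModuleCat.{0} R, Module.Finite R Q → ProjInj Q → MemAdd P Q := by
  have hreg : Module.Finite R (reg R) := Module.Finite.self R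
  let S : Set ℕ := {n | ∃ P : ModuleCat.{0} R, IsSummand P (reg R) ∧ ProjInj P ∧
    Module.finrank K P = n}
  have hle : ∀ P : ModuleCat.{0} R, IsSummand P (reg R) →
      Module.finrank K P ≤ Module.finrank K (reg R) := by
    rintro P ⟨a, b, hab⟩
    have := kfinite K (reg R) hreg
    refine LinearMap.finrank_le_finrank_of_injective (f := kLin K a) ?_
    exact Function.LeftInverse.injective (g := b) fun x => LinearMap.congr_fun hab x
  have hbdd : BddAbove S := ⟨Module.finrank K (reg R), by
    rintro _ ⟨P, h1, -, rfl⟩; exact hle P h1⟩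
  have hne : S.Nonempty := by
    refine ⟨_, ModuleCat.of R PUnit, ⟨0, 0, ?_⟩, ⟨?_, ?_⟩, rfl⟩
    · exact LinearMap.ext fun x => rfl
    · exact (inferInstance : Module.Projective R PUnit)
    · exact ⟨fun X Y _ _ _ _ f hf g => ⟨0, fun x => rfl⟩⟩
  obtain ⟨P, ⟨a, b, hab⟩, hPI, hP⟩ := Nat.sSup_mem hne hbdd
  have hmax : ∀ Q : ModuleCat.{0} R, IsSummand Q (reg R) → ProjInj Q →
      Module.finrank K Q ≤ Module.finrank K P := by
    intro Q h1 h2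
    rw [hP]
    exact le_csSup hbdd ⟨Q, h1, h2, rfl⟩
  have hab' : ∀ x, b (a x) = x := fun x => LinearMap.congr_fun hab x
  have main : ∀ Q : ModuleCat.{0} R, Module.Finite R Q → ProjInj Q → MemAdd P Q := by
    intro Q hQ hQI
    induction hn : Module.finrank K Q using Nat.strong_induction_on generalizing Q with
    | _ n ih =>
    rcases subsingleton_or_nontrivial Q with hsub | hnt
    · exact memAdd_of (α := Fin 0) (fun _ => 0) (fun _ => 0) fun m => Subsingleton.elim _ _
    rcases loc_or_split K Q hQ with hl | ⟨A, B, iA, pA, iB, pB, hA, hB, sA, sB, h⟩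
    · obtain ⟨m, c, d, hcd⟩ := memAdd_iff.mp (memAdd_reg_of_projective hQI.1)
      obtain ⟨j, hj⟩ := hl.sum Finset.univ (fun j => (d j ∘ₗ c j : Module.End R Q)) (by
        have : ∑ j, (d j ∘ₗ c j : Module.End R Q) = 1 := by
          refine LinearMap.ext fun x => ?_
          rw [LinearMap.sum_apply]
          exact hcd x
        rw [this]; exact isUnit_one)
      obtain ⟨s, t, hst⟩ := isSummand_of_isUnit (c j) (d j) hj
      have hst' : ∀ x, t (s x) = x := fun x => LinearMap.congr_fun hst x
      let P' := ModuleCat.of R (LinearMap.ker b)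
      let r : reg R →ₗ[R] LinearMap.ker b := LinearMap.codRestrict _ (LinearMap.id - a ∘ₗ b)
        (fun m => by
          rw [LinearMap.mem_ker]
          show b (m - a (b m)) = 0
          rw [map_sub, hab', sub_self])
      rcases hl (t ∘ₗ a ∘ₗ b ∘ₗ s) (t ∘ₗ (LinearMap.ker b).subtype ∘ₗ r ∘ₗ s) (by
        refine LinearMap.ext fun x => ?_
        show t (a (b (s x))) + t (s x - a (b (s x))) = x
        rw [map_sub, add_sub_cancel, hst']) with hu | hu
      · exact (isSummand_of_isUnit (b ∘ₗ s) (t ∘ₗ a) hu).memAdd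
      · exfalso
        obtain ⟨s', t', hst2⟩ := isSummand_of_isUnit (Y := P') (r ∘ₗ s)
          (t ∘ₗ (LinearMap.ker b).subtype) hu
        have hst2' : ∀ x, t' (s' x) = x := fun x => LinearMap.congr_fun hst2 x
        let s2 : Q →ₗ[R] LinearMap.ker b := s'
        let t2 : LinearMap.ker b →ₗ[R] Q := t'
        have h1 : IsSummand (ModuleCat.of R (P × Q)) (reg R) := by
          refine ⟨LinearMap.coprod a ((LinearMap.ker b).subtype ∘ₗ s2),
            LinearMap.prod b (t2 ∘ₗ r), ?_⟩
          refine LinearMap.ext fun x => ?_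
          obtain ⟨x, y⟩ := x
          have e1 : b (s2 y : reg R) = 0 := (s2 y).2
          refine Prod.ext ?_ ?_
          · show b (a x + (s2 y : reg R)) = x
            rw [map_add, hab', e1, add_zero]
          · show t2 (r (a x + (s2 y : reg R))) = y
            have : r (a x + (s2 y : reg R)) = s2 y := by
              apply Subtype.ext
              show (a x + (s2 y : reg R)) - a (b (a x + (s2 y : reg R))) = _
              rw [map_add, hab', e1, add_zero, add_sub_cancel_left]
            rw [this]
            exact hst2' y
        have h2 := hmax _ h1 ⟨prod_projective hPI.1 hQI.1, prod_injective hPI.2 hQI.2⟩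
        have hfin : Module.Finite R (ModuleCat.of R (P × Q)) := h1.memAdd.finite
        have h3 := finrank_lt K (N := P) (M := ModuleCat.of R (P × Q)) hfin
          (LinearMap.inl R P Q) LinearMap.inl_injective (fun hs => by
            obtain ⟨x, hx⟩ := exists_ne (0 : Q)
            obtain ⟨y, hy⟩ := hs ((0, x) : P × Q)
            exact hx (congrArg Prod.snd hy).symm)
        omega
    · have fA : Module.Finite R A := sA.memAdd.finite
      have fB : Module.Finite R B := sB.memAdd.finite
      exact MemAdd.pair
        (ih _ (hn ▸ hA) A fA ⟨sA.projective hQI.1, sA.injective hQI.2⟩ rfl)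
        (ih _ (hn ▸ hB) B fB ⟨sB.projective hQI.1, sB.injective hQI.2⟩ rfl) iA pA iB pB h
  refine ⟨P, ⟨⟨a, b, hab⟩, hPI, fun Q hQ hQI => main Q hQ.memAdd.finite hQI⟩, main⟩

end
end PS

namespace PS
noncomputable section
attribute [local instance] kMod kMod_smulCommClass kMod_end_smulCommClass

/-- composition of additive functors -/
def AddFun.comp {R S Q : Type} [Ring R] [Ring S] [Ring Q] (F : AddFun R S) (G : AddFun S Q) :
    AddFun R Q where
  obj X := G.obj (F.obj X)
  map f := G.map (F.map f)
  map_id X := by rw [F.map_id, G.map_id]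
  map_comp f g := by rw [F.map_comp, G.map_comp]
  map_add f g := by rw [F.map_add, G.map_add]

/-- extending a natural isomorphism from one object to its additive closure -/
theorem AddFun.summand_of_nat {R S : Type} [Ring R] [Ring S] (F G : AddFun R S)
    {D X : ModuleCat.{0} R} (hX : MemAdd D X) (θ : F.obj D ≃ₗ[S] G.obj D)
    (hθ : ∀ (u : D →ₗ[R] D) (x : F.obj D), θ (F.map u x) = G.map u (θ x)) :
    IsSummand (F.obj X) (G.obj X) := by
  obtain ⟨n, a, b, hab⟩ := memAdd_iff.mp hX
  have e1 : ∑ j, b j ∘ₗ a j = LinearMap.id := by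
    refine LinearMap.ext fun x => ?_
    simpa [LinearMap.sum_apply] using hab x
  have e1' : ∑ j, F.map (b j) ∘ₗ F.map (a j) = LinearMap.id := by
    have := congrArg F.map e1
    rwa [F.map_sum, F.map_id, Finset.sum_congr rfl (fun j _ => F.map_comp (a j) (b j))] at this
  have f1 := fun y => LinearMap.congr_fun e1' y
  simp only [LinearMap.sum_apply, LinearMap.comp_apply, LinearMap.id_apply] at f1
  refine ⟨∑ j, G.map (b j) ∘ₗ θ.toLinearMap ∘ₗ F.map (a j),
    ∑ i, F.map (b i) ∘ₗ θ.symm.toLinearMap ∘ₗ G.map (a i), LinearMap.ext fun x => ?_⟩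
  have key : ∀ i j, θ.symm (G.map (a i) (G.map (b j) (θ (F.map (a j) x)))) =
      F.map (a i) (F.map (b j) (F.map (a j) x)) := by
    intro i j
    rw [LinearEquiv.symm_apply_eq, ← LinearMap.comp_apply, ← G.map_comp, ← hθ, F.map_comp]
    rfl
  simp only [LinearMap.sum_apply, LinearMap.comp_apply, LinearMap.id_apply, _root_.map_sum,
    LinearEquiv.coe_coe, key]
  simp only [← _root_.map_sum, f1]

variable (K : Type) [Field K] {B : Type} [Ring B] [Algebra K B]

/-- the functor `ν⁻` -/
def NI : AddFun B B where
  obj X := NakayamaInv K B X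
  map {X Y} f :=
    { toFun := fun g => (niEq K Y).symm (f ∘ₗ niEq K X g)
      map_add' := fun g g' => LinearMap.comp_add _ _ f
      map_smul' := fun b g => rfl }
  map_id _ := rfl
  map_comp _ _ := rfl
  map_add _ _ := rfl

theorem NI_map {X Y : ModuleCat.{0} B} (f : X →ₗ[B] Y) (g : NakayamaInv K B X) (φ : Dreg K B) :
    niEq K Y ((NI K).map f g) φ = f (niEq K X g φ) := rfl

/-- precomposition -/
def preB {X Y : ModuleCat.{0} B} (f : X →ₗ[B] Y) : (Y →ₗ[B] B) →ₗ[K] (X →ₗ[B] B) where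
  toFun q := q ∘ₗ f
  map_add' _ _ := rfl
  map_smul' _ _ := rfl

/-- the functor `ν` -/
def NK : AddFun B B where
  obj X := Nakayama K B X
  map {X Y} f :=
    { toFun := fun Λ => (nkEq K Y).symm (nkEq K X Λ ∘ₗ preB K f)
      map_add' := fun g g' => rfl
      map_smul' := fun b g => rfl }
  map_id _ := rfl
  map_comp _ _ := rfl
  map_add f g := by
    refine LinearMap.ext fun Λ => ?_
    apply (nkEq K _).injective
    refine LinearMap.ext fun q => ?_
    show nkEq K _ Λ (q ∘ₗ (f + g)) = nkEq K _ Λ (q ∘ₗ f) + nkEq K _ Λ (q ∘ₗ g)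
    rw [LinearMap.comp_add, _root_.map_add]

theorem NK_map {X Y : ModuleCat.{0} B} (f : X →ₗ[B] Y) (Λ : Nakayama K B X) (q : Y →ₗ[B] B) :
    nkEq K Y ((NK K).map f Λ) q = nkEq K X Λ (q ∘ₗ f) := rfl

/-- every endomorphism of `DB` is a right multiplication -/
theorem exists_drR [FiniteDimensional K B] (f : Dreg K B →ₗ[B] Dreg K B) :
    ∃ b : B, ∀ φ, f φ = drR K b φ := by
  let e : (B →ₗ[K] K) ≃ₗ[K] Dreg K B :=
    { (drEq K B).symm with
      map_smul' := fun c φ => by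
        apply dreg_ext; intro r
        show c • φ r = φ (r * algebraMap K B c)
        rw [← Algebra.commutes, ← Algebra.smul_def, _root_.map_smul] }
  let l : Module.Dual K (Module.Dual K B) := homDreg K (Dreg K B) f ∘ₗ e.toLinearMap
  obtain ⟨b, hb⟩ := (Module.evalEquiv K B).surjective l
  have hb' : ∀ φ : Dreg K B, drEq K B (f φ) 1 = drEq K B φ b := fun φ =>
    (LinearMap.congr_fun hb (drEq K B φ)).symm
  refine ⟨b, fun φ => dreg_ext K fun x => ?_⟩
  have h1 := hb' (x • φ)
  rw [_root_.map_smul, drEq_smul, drEq_smul, one_mul] at h1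
  rw [h1, drR_apply]

theorem drR_inj {b : B} (h : ∀ φ, drR K b φ = 0) : b = 0 := by
  rw [← Module.forall_dual_apply_eq_zero_iff K]
  intro φ
  have h1 := congrArg (fun ψ => drEq K B ψ 1) (h ((drEq K B).symm φ))
  simp only [drR_apply, mul_one] at h1
  exact h1

/-- right multiplication as a linear map -/
def drL (b : B) : Dreg K B →ₗ[B] Dreg K B where
  toFun := drR K b
  map_add' _ _ := rfl
  map_smul' s φ := by
    apply dreg_ext; intro x
    show drEq K B φ (b * x * s) = drEq K B φ (b * (x * s))
    rw [mul_assoc]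

/-- `B = End(DB)ᵒᵖ` -/
def bEndDreg [FiniteDimensional K B] : B ≃+* (Module.End B (Dreg K B))ᵐᵒᵖ :=
  RingEquiv.ofBijective
    ({ toFun := fun b => MulOpposite.op (drL K b)
       map_one' := by
        apply MulOpposite.unop_injective
        refine LinearMap.ext fun φ => dreg_ext K fun x => ?_
        show drEq K B φ (1 * x) = drEq K B φ x
        rw [one_mul]
       map_mul' := fun a b => by
        apply MulOpposite.unop_injective
        refine LinearMap.ext fun φ => dreg_ext K fun x => ?_
        show drEq K B φ (a * b * x) = drEq K B φ (a * (b * x))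
        rw [mul_assoc]
       map_zero' := by
        apply MulOpposite.unop_injective
        refine LinearMap.ext fun φ => dreg_ext K fun x => ?_
        show drEq K B φ (0 * x) = 0
        rw [zero_mul, _root_.map_zero]
       map_add' := fun a b => by
        apply MulOpposite.unop_injective
        refine LinearMap.ext fun φ => dreg_ext K fun x => ?_
        show drEq K B φ ((a + b) * x) = drEq K B φ (a * x) + drEq K B φ (b * x)
        rw [add_mul, _root_.map_add] } : B →+* (Module.End B (Dreg K B))ᵐᵒᵖ)
    (by
      constructor
      · rw [injective_iff_map_eq_zero]
        intro b hb
        apply drR_inj K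
        intro φ
        exact LinearMap.congr_fun (congrArg MulOpposite.unop hb) φ
      · intro f
        obtain ⟨b, hb⟩ := exists_drR K f.unop
        refine ⟨b, MulOpposite.unop_injective (LinearMap.ext fun φ => (hb φ).symm)⟩)

/-- `ν⁻ DB = B` -/
def niReg [FiniteDimensional K B] : reg B ≃ₗ[B] NakayamaInv K B (Dreg K B) :=
  LinearEquiv.ofBijective
    (LinearMap.toSpanSingleton B (NakayamaInv K B (Dreg K B)) ((niEq K _).symm LinearMap.id))
    (by
      constructor
      · rw [injective_iff_map_eq_zero]
        intro b hb
        apply drR_inj K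
        intro φ
        exact LinearMap.congr_fun (congrArg (niEq K _) hb) φ
      · intro f
        obtain ⟨b, hb⟩ := exists_drR K (niEq K _ f)
        refine ⟨b, (niEq K _).injective (LinearMap.ext fun φ => (hb φ).symm)⟩)

/-- right multiplication on the regular module -/
def regMul {B : Type} [Ring B] (b : B) : reg B →ₗ[B] B := LinearMap.toSpanSingleton B B b

/-- `ν B = DB` -/
def nkReg : Dreg K B ≃ₗ[B] Nakayama K B (reg B) where
  toFun φ := (nkEq K _).symm
    { toFun := fun g : reg B →ₗ[B] B => drEq K B φ (g (1 : B))
      map_add' := fun g g' => _root_.map_add (drEq K B φ) _ _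
      map_smul' := fun c g => _root_.map_smul (drEq K B φ) _ _ }
  invFun Λ := (drEq K B).symm
    { toFun := fun b => nkEq K _ Λ (regMul b)
      map_add' := fun a b => (congrArg (nkEq K _ Λ) (LinearMap.ext fun (x : B) =>
        show x * (a + b) = x * a + x * b from mul_add x a b)).trans
          (_root_.map_add (nkEq K _ Λ) (regMul a) (regMul b))
      map_smul' := fun c b => (congrArg (nkEq K _ Λ) (LinearMap.ext fun (x : B) =>
        show x * (c • b) = c • (x * b) from mul_smul_comm c x b)).trans
          (_root_.map_smul (nkEq K _ Λ) c (regMul b)) }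
  map_add' _ _ := rfl
  map_smul' b φ := rfl
  left_inv φ := by
    apply dreg_ext; intro x
    show drEq K B φ (1 * x) = drEq K B φ x
    rw [one_mul]
  right_inv Λ := by
    apply (nkEq K _).injective
    refine LinearMap.ext fun g => ?_
    show nkEq K _ Λ (regMul (g (1 : B))) = nkEq K _ Λ g
    congr 1
    refine LinearMap.ext fun (x : B) => ?_
    exact (g.map_smul (x : B) (1 : B)).symm.trans (congrArg g (mul_one (x : B)))

variable {S : Type} [Ring S]

/-- `Hom(C, X)` is a summand of `D Hom(ν⁻ X, C)` for `X` in `add DB` -/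
theorem homF_summand [FiniteDimensional K B] {C X : ModuleCat.{0} B}
    (σ : S ≃+* (Module.End B C)ᵐᵒᵖ) (hX : MemAdd (Dreg K B) X) :
    IsSummand ((homF σ).obj X) ((HF K σ).obj (NakayamaInv K B X)) := by
  let θ : (homF σ).obj (Dreg K B) ≃ₗ[S] (HF K σ).obj (NakayamaInv K B (Dreg K B)) :=
    (homF_dreg K σ).trans ((HF_reg K σ).symm.trans ((HF K σ).equiv (niReg K)))
  refine AddFun.summand_of_nat (homF σ) ((NI K).comp (HF K σ)) hX θ ?_
  intro u f
  obtain ⟨r, hr⟩ := exists_drR K u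
  apply HEq_ext
  intro (g : NakayamaInv K B (Dreg K B) →ₗ[B] C)
  let i0 : NakayamaInv K B (Dreg K B) := (niEq K _).symm LinearMap.id
  have e1 : HEq K σ _ (θ ((homF σ).map u f)) g =
      drEq K B (u (hEq σ _ f (g ((1 : B) • i0)))) 1 := rfl
  have e2 : HEq K σ _ (((NI K).comp (HF K σ)).map u (θ f)) g =
      drEq K B (hEq σ _ f (g ((NI K).map u ((1 : B) • i0)))) 1 := rfl
  have e3 : ((NI K).map u i0 : NakayamaInv K B (Dreg K B)) = r • i0 :=
    (niEq K _).injective (LinearMap.ext fun φ => hr φ)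
  have e4 : (hEq σ _ f (g ((NI K).map u ((1 : B) • i0)))) = r • hEq σ _ f (g ((1 : B) • i0)) := by
    rw [one_smul]
    exact (congrArg (fun z => hEq σ _ f (g z)) e3).trans (by
      show hEq σ _ f (g (r • i0)) = _
      rw [g.map_smul, _root_.map_smul])
  refine e1.trans (Eq.trans ?_ e2.symm)
  rw [e4, drEq_smul, hr, drR_apply, one_mul, mul_one]

/-- `D Hom(X, T)` is a summand of `Hom(T, ν X)` for `X` in `add B` -/
theorem HF_summand {T X : ModuleCat.{0} B}
    (σ : S ≃+* (Module.End B T)ᵐᵒᵖ) (hX : MemAdd (reg B) X) :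
    IsSummand ((HF K σ).obj X) ((homF σ).obj (Nakayama K B X)) := by
  let θ : (HF K σ).obj (reg B) ≃ₗ[S] (homF σ).obj (Nakayama K B (reg B)) :=
    (HF_reg K σ).trans ((homF_dreg K σ).symm.trans ((homF σ).equiv (nkReg K)))
  refine AddFun.summand_of_nat (HF K σ) ((NK K).comp (homF σ)) hX θ ?_
  intro u Λ
  apply hEq_ext
  intro t
  apply (nkEq K _).injective
  refine LinearMap.ext fun g => ?_
  have e1 : nkEq K _ (hEq σ _ (θ ((HF K σ).map u Λ)) t) g =
      HEq K σ _ Λ (LinearMap.toSpanSingleton B T (g (1 : B) • t) ∘ₗ u) := rfl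
  have e2 : nkEq K _ (hEq σ _ (((NK K).comp (homF σ)).map u (θ Λ)) t) g =
      HEq K σ _ Λ (LinearMap.toSpanSingleton B T (g (u (1 : B)) • t)) := rfl
  refine e1.trans (Eq.trans ?_ e2.symm)
  congr 1
  refine LinearMap.ext fun (x : B) => ?_
  let u1 : B := u (1 : B)
  have hu : u x = (x * u1 : B) :=
    (congrArg u (mul_one x).symm).trans (u.map_smul x (1 : B))
  have hg : g (u (1 : B)) = u1 * g (1 : B) :=
    (congrArg g (mul_one u1).symm).trans (g.map_smul u1 (1 : B))
  have e3 : (LinearMap.toSpanSingleton B T (g (1 : B) • t) ∘ₗ u) x = (x * u1 : B) • g (1 : B) • t :=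
    congrArg (fun z : B => z • g (1 : B) • t) hu
  have e4 : LinearMap.toSpanSingleton B T (g (u (1 : B)) • t) x = x • g (u (1 : B)) • t := rfl
  refine e3.trans (Eq.trans ?_ e4.symm)
  rw [hg, mul_smul, mul_smul]

end
end PS

namespace PS
noncomputable section
attribute [local instance] kMod kMod_smulCommClass kMod_end_smulCommClass

/-- endomorphism rings under a fully faithful functor -/
def AddFun.FF.endEquiv {R S : Type} [Ring R] [Ring S] {F : AddFun R S} {X : ModuleCat.{0} R}
    (h : F.FF X X) : Module.End R X ≃+* Module.End S (F.obj X) :=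
  RingEquiv.ofBijective
    ({ toFun := fun f => F.map f
       map_one' := F.map_id X
       map_mul' := fun f g => F.map_comp g f
       map_zero' := F.map_zero X X
       map_add' := F.map_add } : Module.End R X →+* Module.End S (F.obj X)) h

variable (K : Type) [Field K] {B : Type} [Ring B] [Algebra K B] [FiniteDimensional K B]
variable {S : Type} [Ring S] [Algebra K S] [FiniteDimensional K S]

theorem back1 {C I : ModuleCat.{0} B} {k : ℕ} (hI : Inj I) (h : IsSpecialCotilting K I k C)
    (hν : MemAdd C (NakayamaInv K B I)) (hC : IsBasic C) (hB : IsBasic (reg B))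
    (σ : S ≃+* (Module.End B C)ᵐᵒᵖ) (hσ : Compat K σ) :
    IsBasic (reg S) ∧ ∃ P T : ModuleCat.{0} S, IsMaxProjInjSummand P ∧ DomdimGE S k ∧ IsBasic T ∧
      IsSpecialTilting P k T ∧ Nonempty (B ≃+* (Module.End S T)ᵐᵒᵖ) := by
  have hfin : Module.Finite B C := ((isSpecialCotilting_iff _ _ _ _).mp h).1
  have hXfin : ∀ X, MemAdd C X → MemAdd I X → Module.Finite S ((homF σ).obj X) := fun X h1 _ =>
    homF_finite K σ hσ hfin h1.finite
  have hPI : ∀ X, MemAdd C X → MemAdd I X → ProjInj ((homF σ).obj X) := by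
    intro X h1 h2
    refine ⟨((homF σ).memAdd h1).projective (Proj.congr (homF_reg σ).symm reg_projective), ?_⟩
    have hXi : Inj X := h2.injective hI
    have hs := homF_summand K σ (memAdd_dreg K h1.finite hXi)
    have h3 : MemAdd C (NakayamaInv K B X) := hν.trans ((NI K).memAdd h2)
    have h4 : Inj ((HF K σ).obj (NakayamaInv K B X)) :=
      ((HF K σ).memAdd h3).injective (Inj.congr (HF_T K σ hσ).symm (dreg_injective K))
    exact hs.injective h4
  obtain ⟨P, hP, hmax⟩ := exists_max (R := S) K
  obtain ⟨hT, hff, Z, hL⟩ := coreA K σ hσ hI h P (fun X h1 h2 => hmax _ (hXfin X h1 h2) (hPI X h1 h2))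
  have eB : B ≃+* (Module.End S ((homF σ).obj (Dreg K B)))ᵐᵒᵖ :=
    (bEndDreg K).trans (RingEquiv.op hff.endEquiv)
  refine ⟨?_, P, (homF σ).obj (Dreg K B), hP, ?_, ?_, hT, ⟨eB⟩⟩
  · rw [isBasic_reg_iff]
    exact (((isBasic_iff C).mp hC).op).of_equiv σ.symm
  · refine domdimGE_of_LP (hL.mono ?_)
    rintro _ ⟨X, h1, h2, rfl⟩
    exact hPI X h1 h2
  · rw [isBasic_iff]
    exact ((isBasic_reg_iff.mp hB).of_equiv eB).unop

theorem back3 {T P : ModuleCat.{0} B} {k : ℕ} (hPr : Proj P) (h : IsSpecialTilting P k T)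
    (hν : MemAdd T (Nakayama K B P)) (hT : IsBasic T) (hB : IsBasic (reg B))
    (σ : S ≃+* (Module.End B T)ᵐᵒᵖ) (hσ : Compat K σ) :
    IsBasic (reg S) ∧ ∃ Q C : ModuleCat.{0} S, IsMaxProjInjSummand Q ∧ DomdimGE S k ∧ IsBasic C ∧
      IsSpecialCotilting K Q k C ∧ Nonempty (B ≃+* (Module.End S C)ᵐᵒᵖ) := by
  have hfin : Module.Finite B T := ((isSpecialTilting_iff _ _ _).mp h).1
  have hXfin : ∀ X, MemAdd T X → MemAdd P X → Module.Finite S ((HF K σ).obj X) := fun X h1 _ =>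
    HF_finite K σ hσ hfin h1.finite
  have hPI : ∀ X, MemAdd T X → MemAdd P X → ProjInj ((HF K σ).obj X) := by
    intro X h1 h2
    refine ⟨?_, ((HF K σ).memAdd h1).injective
      (Inj.congr (HF_T K σ hσ).symm (dreg_injective K))⟩
    have hXp : Proj X := h2.projective hPr
    have hXf : Module.Finite B X := h1.finite
    have hs := HF_summand K σ (memAdd_reg_of_projective hXp)
    have h3 : MemAdd T (Nakayama K B X) := hν.trans ((NK K).memAdd h2)
    have h4 : Proj ((homF σ).obj (Nakayama K B X)) :=
      ((homF σ).memAdd h3).projective (Proj.congr (homF_reg σ).symm reg_projective)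
    exact hs.projective h4
  obtain ⟨Q, hQ, hmax⟩ := exists_max (R := S) K
  obtain ⟨hC, hff, Z, hL⟩ := coreB K σ hσ hPr h Q (fun X h1 h2 => hmax _ (hXfin X h1 h2) (hPI X h1 h2))
  have eB : B ≃+* (Module.End S ((HF K σ).obj (reg B)))ᵐᵒᵖ :=
    (RingEquiv.opOp B).trans ((RingEquiv.op (RingEquiv.moduleEndSelf B)).trans
      (RingEquiv.op hff.endEquiv))
  refine ⟨?_, Q, (HF K σ).obj (reg B), hQ, ?_, ?_, hC, ⟨eB⟩⟩
  · rw [isBasic_reg_iff]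
    exact (((isBasic_iff T).mp hT).op).of_equiv σ.symm
  · have hL' : LP (fun Y => Module.Finite S Y ∧ ProjInj Y) k Z (Dreg K S) := by
      refine hL.mono ?_
      rintro _ ⟨X, h1, h2, rfl⟩
      exact ⟨hXfin X h1 h2, hPI X h1 h2⟩
    have hreg : Module.Finite S (reg S) := Module.Finite.self S
    obtain ⟨J, -, hJ⟩ := lemmaE (X₀ := reg S) hL' (fun X hX => dreg_cogen K X hX)
      (fun X hX => hX.2.2) (fun X hX => hX.1)
      (fun X m hX => ⟨by
          have := hX.1
          exact (MemAdd.refl X |>.pow m).finite, (MemAdd.refl X |>.pow m).projective hX.2.1,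
        (MemAdd.refl X |>.pow m).injective hX.2.2⟩) hreg (by
        intro W N X Y i p hW hX hs _ g
        have hWp : Proj W := by
          rcases hW with rfl | hW
          · exact reg_projective
          · exact hW.2.1
        have : Module.Projective S W := hWp
        exact Module.projective_lifting_property p g hs.surj)
    exact domdimGE_of_LP (hJ.mono fun X hX => hX.2)
  · rw [isBasic_iff]
    exact ((isBasic_reg_iff.mp hB).of_equiv eB).unop

theorem back1' {C I : ModuleCat.{0} B} {k : ℕ} (hI : Inj I) (h : IsSpecialCotilting K I k C)
    (hν : MemAdd C (NakayamaInv K B I)) (hB : IsBasic (reg B)) :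
    ∃ (Γ : Type) (_ : Ring Γ) (_ : Algebra K Γ) (_ : FiniteDimensional K Γ)
        (_ : IsBasic (reg Γ)) (Pii Tk : ModuleCat.{0} Γ),
        IsMaxProjInjSummand Pii ∧ DomdimGE Γ k ∧ IsBasic Tk ∧ IsSpecialTilting Pii k Tk ∧
        Nonempty (B ≃+* (Module.End Γ Tk)ᵐᵒᵖ) := by
  have hfin : Module.Finite B C := ((isSpecialCotilting_iff _ _ _ _).mp h).1
  obtain ⟨C', hb, h1, h2⟩ := exists_basic K C hfin
  have h' := h.of_summand h1 h2
  have hfin' : Module.Finite B C' := ((isSpecialCotilting_iff _ _ _ _).mp h').1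
  have key : ∀ (Γ : Type) (iΓ : Ring Γ) (σ : Γ ≃+* (Module.End B C')ᵐᵒᵖ),
      ∃ (_ : Algebra K Γ) (_ : FiniteDimensional K Γ)
        (_ : IsBasic (reg Γ)) (Pii Tk : ModuleCat.{0} Γ),
        IsMaxProjInjSummand Pii ∧ DomdimGE Γ k ∧ IsBasic Tk ∧ IsSpecialTilting Pii k Tk ∧
        Nonempty (B ≃+* (Module.End Γ Tk)ᵐᵒᵖ) := by
    intro Γ iΓ σ
    letI := twAlg K σ
    haveI hf : FiniteDimensional K Γ := twAlg_finite K hfin' σ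
    obtain ⟨e, P, T, hh⟩ := back1 K hI h' (h2.trans hν) hb hB σ (twAlg_compat K σ)
    exact ⟨twAlg K σ, hf, e, P, T, hh⟩
  exact ⟨_, _, key _ _ (RingEquiv.refl (Module.End B C')ᵐᵒᵖ)⟩

theorem back3' {T P : ModuleCat.{0} B} {k : ℕ} (hPr : Proj P) (h : IsSpecialTilting P k T)
    (hν : MemAdd T (Nakayama K B P)) (hB : IsBasic (reg B)) :
    ∃ (Γ : Type) (_ : Ring Γ) (_ : Algebra K Γ) (_ : FiniteDimensional K Γ)
        (_ : IsBasic (reg Γ)) (Pii Ck : ModuleCat.{0} Γ),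
        IsMaxProjInjSummand Pii ∧ DomdimGE Γ k ∧ IsBasic Ck ∧ IsSpecialCotilting K Pii k Ck ∧
        Nonempty (B ≃+* (Module.End Γ Ck)ᵐᵒᵖ) := by
  have hfin : Module.Finite B T := ((isSpecialTilting_iff _ _ _).mp h).1
  obtain ⟨T', hb, h1, h2⟩ := exists_basic K T hfin
  have h' := h.of_summand h1 h2
  have hfin' : Module.Finite B T' := ((isSpecialTilting_iff _ _ _).mp h').1
  have key : ∀ (Γ : Type) (iΓ : Ring Γ) (σ : Γ ≃+* (Module.End B T')ᵐᵒᵖ),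
      ∃ (_ : Algebra K Γ) (_ : FiniteDimensional K Γ)
        (_ : IsBasic (reg Γ)) (Pii Ck : ModuleCat.{0} Γ),
        IsMaxProjInjSummand Pii ∧ DomdimGE Γ k ∧ IsBasic Ck ∧ IsSpecialCotilting K Pii k Ck ∧
        Nonempty (B ≃+* (Module.End Γ Ck)ᵐᵒᵖ) := by
    intro Γ iΓ σ
    letI := twAlg K σ
    haveI hf : FiniteDimensional K Γ := twAlg_finite K hfin' σ
    obtain ⟨e, P, C, hh⟩ := back3 K hPr h' (h2.trans hν) hb hB σ (twAlg_compat K σ)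
    exact ⟨twAlg K σ, hf, e, P, C, hh⟩
  exact ⟨_, _, key _ _ (RingEquiv.refl (Module.End B T')ᵐᵒᵖ)⟩

end
end PS

open PS in
/-- A basic finite-dimensional algebra `B` is isomorphic to a `k`-shifted algebra iff there are an
injective `B`-module `I` and an `I`-special `k`-cotilting module `C` with `ν⁻I ∈ add C`; under
this isomorphism `C` corresponds to the dual of the `k`-shifted module.  Dually for `k`-coshifted
algebras, projective `P`, `P`-special `k`-tilting `T` with `νP ∈ add T`. -/
theorem statement4 (K : Type) [Field K] (B : Type) [Ring B] [Algebra K B]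
    [FiniteDimensional K B] (hbasic : IsBasic (reg B)) (k : ℕ) :
    -- shifted algebras
    ((∃ (Γ : Type) (_ : Ring Γ) (_ : Algebra K Γ) (_ : FiniteDimensional K Γ)
        (_ : IsBasic (reg Γ)) (Pii Tk : ModuleCat.{0} Γ),
        IsMaxProjInjSummand Pii ∧ DomdimGE Γ k ∧ IsBasic Tk ∧ IsSpecialTilting Pii k Tk ∧
        Nonempty (B ≃+* (Module.End Γ Tk)ᵐᵒᵖ)) ↔
      (∃ I C : ModuleCat.{0} B, Module.Injective B I ∧ IsSpecialCotilting K I k C ∧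
        MemAdd C (NakayamaInv K B I))) ∧
    -- under the isomorphism, `C` is the dual of the `k`-shifted module
    (∀ (Γ : Type) (_ : Ring Γ) (_ : Algebra K Γ) (_ : FiniteDimensional K Γ)
        (_ : IsBasic (reg Γ)) (Pii Tk : ModuleCat.{0} Γ),
        IsMaxProjInjSummand Pii → DomdimGE Γ k → IsBasic Tk → IsSpecialTilting Pii k Tk →
        ∀ σ : B ≃+* (Module.End Γ Tk)ᵐᵒᵖ,
          Module.Injective B ((ModuleCat.restrictScalars σ.toRingHom).obj (Ihom K Pii Tk)) ∧
          IsSpecialCotilting K ((ModuleCat.restrictScalars σ.toRingHom).obj (Ihom K Pii Tk)) k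
            ((ModuleCat.restrictScalars σ.toRingHom).obj (DT K Tk)) ∧
          MemAdd ((ModuleCat.restrictScalars σ.toRingHom).obj (DT K Tk))
            (NakayamaInv K B ((ModuleCat.restrictScalars σ.toRingHom).obj (Ihom K Pii Tk)))) ∧
    -- coshifted algebras
    ((∃ (Γ : Type) (_ : Ring Γ) (_ : Algebra K Γ) (_ : FiniteDimensional K Γ)
        (_ : IsBasic (reg Γ)) (Pii Ck : ModuleCat.{0} Γ),
        IsMaxProjInjSummand Pii ∧ DomdimGE Γ k ∧ IsBasic Ck ∧ IsSpecialCotilting K Pii k Ck ∧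
        Nonempty (B ≃+* (Module.End Γ Ck)ᵐᵒᵖ)) ↔
      (∃ P T : ModuleCat.{0} B, Module.Projective B P ∧ IsSpecialTilting P k T ∧
        MemAdd T (Nakayama K B P))) ∧
    -- under the isomorphism, `T` is the dual of the `k`-coshifted module
    (∀ (Γ : Type) (_ : Ring Γ) (_ : Algebra K Γ) (_ : FiniteDimensional K Γ)
        (_ : IsBasic (reg Γ)) (Pii Ck : ModuleCat.{0} Γ),
        IsMaxProjInjSummand Pii → DomdimGE Γ k → IsBasic Ck → IsSpecialCotilting K Pii k Ck →
        ∀ σ : B ≃+* (Module.End Γ Ck)ᵐᵒᵖ,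
          Module.Projective B ((ModuleCat.restrictScalars σ.toRingHom).obj (homTX Ck Pii)) ∧
          IsSpecialTilting ((ModuleCat.restrictScalars σ.toRingHom).obj (homTX Ck Pii)) k
            ((ModuleCat.restrictScalars σ.toRingHom).obj (DT K Ck)) ∧
          MemAdd ((ModuleCat.restrictScalars σ.toRingHom).obj (DT K Ck))
            (Nakayama K B ((ModuleCat.restrictScalars σ.toRingHom).obj (homTX Ck Pii)))) := by
  exact ⟨⟨fun ⟨Γ, i1, i2, i3, _, Pii, Tk, hP, _, _, hT, ⟨σ⟩⟩ =>
      ⟨_, _, part2' K hP hT σ⟩,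
    fun ⟨I, C, hI, h, hν⟩ => back1' K hI h hν hbasic⟩,
    fun Γ _ _ _ _ Pii Tk hP _ _ hT σ => part2' K hP hT σ,
    ⟨fun ⟨Γ, i1, i2, i3, _, Pii, Ck, hP, _, _, hC, ⟨σ⟩⟩ =>
      ⟨_, _, part4' K hP hC σ⟩,
    fun ⟨P, T, hP, h, hν⟩ => back3' K hP h hν hbasic⟩,
    fun Γ _ _ _ _ Pii Ck hP _ _ hC σ => part4' K hP hC σ⟩
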